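/- Let (d(n))_{n≥1} satisfy Conditions (a) and (b) and Condition P, and let 𝒢_{d(n)} denote the set of simple graphs on vertex set [n] = {1,…,n} in which vertex i has degree d_i(n) for every i, and 𝒢c_{d(n)} ⊆ 𝒢_{d(n)} the subset of connected graphs. Then, as n → ∞, (1/n)·log( |𝒢c_{d(n)}| · (∏_{i=1}^n d_i(n)!) / (ℓ_n − 1)!! ) → −K(p), i.e. |𝒢c_{d(n)}| = e^{−K(p)n + o(n)} · (ℓ_n − 1)!!/∏_{i=1}^n d_i(n)!; moreover (1/n)·log( |𝒢c_{d(n)}| / |𝒢_{d(n)}| ) → −K(p). -/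

import Mathlib

namespace PaperCM

noncomputable section

/-- Number of vertices of a type sequence. -/
def numV (m : ℕ →₀ ℕ) : ℕ := m.sum fun _ c => c

/-- Total degree of a type sequence. -/
def totalDeg (m : ℕ →₀ ℕ) : ℕ := m.sum fun i c => i * c

/-- The nondecreasing degree sequence associated with a type sequence:
`degOf m i` is the least `j` with `m 1 + ⋯ + m j ≥ i + 1` (vertices `0`-indexed). -/
def degOf (m : ℕ →₀ ℕ) (i : ℕ) : ℕ :=
  sInf {j : ℕ | i < ∑ k ∈ Finset.Icc 1 j, m k}

/-- The half-edges of a type sequence: pairs `(v, j)` with `j < d_v`. -/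
abbrev HalfEdges (m : ℕ →₀ ℕ) := Σ v : Fin (numV m), Fin (degOf m (v : ℕ))

/-- A configuration: a perfect matching of the half-edges, encoded as a
fixed-point free involution. -/
def IsConfig (m : ℕ →₀ ℕ) (f : HalfEdges m → HalfEdges m) : Prop :=
  Function.Involutive f ∧ ∀ x, f x ≠ x

/-- Adjacency in the multigraph induced by a configuration. -/
def adj (m : ℕ →₀ ℕ) (f : HalfEdges m → HalfEdges m) (u v : Fin (numV m)) : Prop :=
  ∃ (j : Fin (degOf m (u : ℕ))) (j' : Fin (degOf m (v : ℕ))), f ⟨u, j⟩ = ⟨v, j'⟩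

/-- The multigraph of the configuration is connected. -/
def IsConn (m : ℕ →₀ ℕ) (f : HalfEdges m → HalfEdges m) : Prop :=
  ∀ u v : Fin (numV m), Relation.ReflTransGen (adj m f) u v

/-- The configuration is simple: no self-loops and no multiple edges. -/
def IsSimple (m : ℕ →₀ ℕ) (f : HalfEdges m → HalfEdges m) : Prop :=
  (∀ x : HalfEdges m, (f x).1 ≠ x.1) ∧
    ∀ x y : HalfEdges m, x.1 = y.1 → (f x).1 = (f y).1 → x = y ∨ x = f y

/-- The vertex set of the component of `v`. -/
def component (m : ℕ →₀ ℕ) (f : HalfEdges m → HalfEdges m) (v : Fin (numV m)) :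
    Set (Fin (numV m)) :=
  {u | Relation.ReflTransGen (adj m f) v u}

/-- The type of the component of `v`: the number of its vertices of each degree. -/
def compType (m : ℕ →₀ ℕ) (f : HalfEdges m → HalfEdges m) (v : Fin (numV m)) (i : ℕ) : ℕ :=
  Set.ncard {u : Fin (numV m) | u ∈ component m f v ∧ degOf m (u : ℕ) = i}

/-- The configuration has a component with type `m'`. -/
def HasCompOfType (m : ℕ →₀ ℕ) (f : HalfEdges m → HalfEdges m) (m' : ℕ →₀ ℕ) : Prop :=
  ∃ v : Fin (numV m), ∀ i, compType m f v i = m' i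

/-- `v` is the minimal representative of its component. -/
def IsRep (m : ℕ →₀ ℕ) (f : HalfEdges m → HalfEdges m) (v : Fin (numV m)) : Prop :=
  ∀ u ∈ component m f v, v ≤ u

/-- Number of components of the configuration whose type lies in `𝒩`. -/
def numCompIn (m : ℕ →₀ ℕ) (f : HalfEdges m → HalfEdges m) (𝒩 : Set (ℕ →₀ ℕ)) : ℕ :=
  Set.ncard {v : Fin (numV m) | IsRep m f v ∧ ∃ m' ∈ 𝒩, ∀ i, compType m f v i = m' i}

/-- `|𝒞_m|`: the number of configurations with type `m`. -/
def cC (m : ℕ →₀ ℕ) : ℕ := Set.ncard {f | IsConfig m f}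
/-- `|𝒞c_m|`: the number of connected configurations with type `m`. -/
def cCc (m : ℕ →₀ ℕ) : ℕ := Set.ncard {f | IsConfig m f ∧ IsConn m f}
/-- `|𝒮_m|`: the number of simple configurations with type `m`. -/
def cS (m : ℕ →₀ ℕ) : ℕ := Set.ncard {f | IsConfig m f ∧ IsSimple m f}
/-- `|𝒮c_m|`: the number of connected simple configurations with type `m`. -/
def cSc (m : ℕ →₀ ℕ) : ℕ := Set.ncard {f | IsConfig m f ∧ IsSimple m f ∧ IsConn m f}
/-- `|𝒞_m^{m'}|`: configurations with type `m` having a component of type `m'`. -/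
def cCcomp (m m' : ℕ →₀ ℕ) : ℕ := Set.ncard {f | IsConfig m f ∧ HasCompOfType m f m'}
/-- `|𝒮_m^{m'}|`. -/
def cScomp (m m' : ℕ →₀ ℕ) : ℕ :=
  Set.ncard {f | IsConfig m f ∧ IsSimple m f ∧ HasCompOfType m f m'}
/-- `|𝒞_m^{𝒩}|`: configurations with type `m` having a component whose type lies in `𝒩`. -/
def cCcompSet (m : ℕ →₀ ℕ) (𝒩 : Set (ℕ →₀ ℕ)) : ℕ :=
  Set.ncard {f | IsConfig m f ∧ ∃ m' ∈ 𝒩, HasCompOfType m f m'}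
/-- `|𝒮_m^{𝒩}|`. -/
def cScompSet (m : ℕ →₀ ℕ) (𝒩 : Set (ℕ →₀ ℕ)) : ℕ :=
  Set.ncard {f | IsConfig m f ∧ IsSimple m f ∧ ∃ m' ∈ 𝒩, HasCompOfType m f m'}

/-- The type sequence `n(n) = (n_i(n))_{i ≥ 1}` of the degree sequence `d(n)`. -/
def typeOf (d : (n : ℕ) → Fin n → ℕ) (n : ℕ) : ℕ →₀ ℕ :=
  ∑ j : Fin n, Finsupp.single (d n j) 1

/-- The total degree `ℓ_n = Σ_i i·n_i = Σ_j d_j(n)`. -/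
def ℓTot (d : (n : ℕ) → Fin n → ℕ) (n : ℕ) : ℕ := ∑ j : Fin n, d n j

/-- The set `𝒩^ε(n)` of type sequences approximating `n` from below. -/
def Neps (ε : ℝ) (nn : ℕ →₀ ℕ) : Set (ℕ →₀ ℕ) :=
  {m | m ≤ nn ∧ (1 - ε) * (totalDeg nn : ℝ) < (totalDeg m : ℝ)}

/-- `β(p)`: the solution in `(0,1)` of the fixed-point equation
`Σ_k k p_k = (1-β²) Σ_k k p_k/(1-β^k)`. -/
def betaOf (p : ℕ → ℝ) : ℝ :=
  sInf {β : ℝ | β ∈ Set.Ioo 0 1 ∧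
    ∑' k : ℕ, (k : ℝ) * p k = (1 - β ^ 2) * ∑' k : ℕ, (k : ℝ) * p k / (1 - β ^ k)}

/-- The exponential rate `K(p)`. -/
def Kof (p : ℕ → ℝ) : ℝ :=
  (∑' k : ℕ, (k : ℝ) * p k) / 2 * Real.log (1 - betaOf p ^ 2)
    - ∑' k : ℕ, p k * Real.log (1 - betaOf p ^ k)

end

end PaperCM

namespace PaperCM

section PartialMatchings

variable {H : Type*}

/-- A perfect matching, encoded as a fixed-point free involution. -/
def IsMatching (f : H → H) : Prop := Function.Involutive f ∧ ∀ x, f x ≠ x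

/-- A partial matching is an involution, its fixed points being the unmatched elements;
`F` extends `f` if it contains all its pairs. -/
def Extends (f F : H → H) : Prop := ∀ x, f x ≠ x → F x = f x

theorem extends_id (F : H → H) : Extends id F := fun _ h => absurd rfl h

theorem Extends.trans {f g h : H → H} (h₁ : Extends f g) (h₂ : Extends g h) : Extends f h := by
  intro x hx
  rw [← h₁ x hx]
  exact h₂ x (by rwa [h₁ x hx])

theorem Extends.free_of_free {f F : H → H} (hf : Function.Involutive f)
    (hF : Function.Involutive F) (h : Extends f F) {x : H} (hx : f x = x) :
    f (F x) = F x := by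
  by_contra hne
  have h1 := h _ hne
  rw [hF x] at h1
  have h2 := hf (F x)
  rw [← h1, hx] at h2
  exact hne (by rw [← h1]; exact h2)

variable [DecidableEq H]

/-- The partial matching obtained from `f` by pairing the unmatched elements `x` and `y`. -/
def link (f : H → H) (x y : H) : H → H := fun z => if z = x then y else if z = y then x else f z

theorem link_left (f : H → H) (x y : H) : link f x y x = y := by simp [link]

theorem link_right (f : H → H) (x y : H) : link f x y y = x := by
  unfold link; split_ifs with h <;> simp_all

theorem link_of_ne {f : H → H} {x y z : H} (hx : z ≠ x) (hy : z ≠ y) : link f x y z = f z := by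
  simp [link, hx, hy]

theorem link_involutive {f : H → H} (hf : Function.Involutive f) {x y : H} (hx : f x = x)
    (hy : f y = y) : Function.Involutive (link f x y) := by
  intro z
  by_cases h1 : z = x
  · subst h1; rw [link_left, link_right]
  by_cases h2 : z = y
  · subst h2; rw [link_right, link_left]
  rw [link_of_ne h1 h2, link_of_ne, hf]
  · intro h; exact h1 (by rw [← hf z, h, hx])
  · intro h; exact h2 (by rw [← hf z, h, hy])

theorem link_free_iff {f : H → H} {x y z : H} (hxy : x ≠ y) :
    link f x y z = z ↔ f z = z ∧ z ≠ x ∧ z ≠ y := by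
  by_cases h1 : z = x
  · subst h1; rw [link_left]; simp [hxy.symm]
  by_cases h2 : z = y
  · subst h2; rw [link_right]; simp [hxy]
  simp [link_of_ne h1 h2, h1, h2]

theorem extends_link {f : H → H} {x y : H} (hx : f x = x) (hy : f y = y) :
    Extends f (link f x y) := by
  intro z hz
  refine link_of_ne ?_ ?_ <;> rintro rfl <;> contradiction

theorem Extends.apply_link {f F : H → H} {x y : H} (hxy : y ≠ x) (h : Extends (link f x y) F) :
    F x = y := by
  rw [h x (by rwa [link_left]), link_left]

variable [Fintype H]

open Classical in
/-- The number of extensions of `f` satisfying `P`. -/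
noncomputable def numExt (P : (H → H) → Prop) (f : H → H) : ℕ :=
  (Finset.univ.filter fun F => P F ∧ Extends f F).card

theorem numExt_mono {P Q : (H → H) → Prop} {f : H → H} (h : ∀ F, Extends f F → P F → Q F) :
    numExt P f ≤ numExt Q f := by
  classical
  refine Finset.card_le_card fun F hF => ?_
  simp only [Finset.mem_filter, Finset.mem_univ, true_and] at hF ⊢
  exact ⟨h F hF.2 hF.1, hF.2⟩

theorem one_le_numExt {P : (H → H) → Prop} {f F : H → H} (hP : P F) (hF : Extends f F) :
    1 ≤ numExt P f := by
  classical
  exact Finset.card_pos.2 ⟨F, by simp [hP, hF]⟩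

theorem sum_numExt_link_le {P : (H → H) → Prop} {f : H → H} {x : H} (hx : f x = x)
    (Y : Finset H) (hY : ∀ y ∈ Y, f y = y ∧ y ≠ x) :
    ∑ y ∈ Y, numExt P (link f x y) ≤ numExt P f := by
  classical
  unfold numExt
  rw [← Finset.card_biUnion]
  · refine Finset.card_le_card fun F hF => ?_
    simp only [Finset.mem_biUnion, Finset.mem_filter, Finset.mem_univ, true_and] at hF ⊢
    obtain ⟨y, hy, hP, hE⟩ := hF
    exact ⟨hP, (extends_link hx (hY y hy).1).trans hE⟩
  · intro y hy z hz hyz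
    refine Finset.disjoint_left.2 fun F hF hF' => ?_
    simp only [Finset.mem_filter, Finset.mem_univ, true_and] at hF hF'
    exact hyz ((hF.2.apply_link (hY y hy).2).symm.trans (hF'.2.apply_link (hY z hz).2))

theorem mul_le_numExt {P : (H → H) → Prop} {f : H → H} {x : H} (hx : f x = x)
    (Y : Finset H) (hY : ∀ y ∈ Y, f y = y ∧ y ≠ x) {b : ℕ}
    (hb : ∀ y ∈ Y, b ≤ numExt P (link f x y)) : Y.card * b ≤ numExt P f := by
  refine le_trans ?_ (sum_numExt_link_le hx Y hY)
  rw [← smul_eq_mul]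
  exact Finset.card_nsmul_le_sum _ _ _ hb

/-- The unmatched elements of a partial matching. -/
def free (f : H → H) : Finset H := Finset.univ.filter fun x => f x = x

@[simp] theorem mem_free {f : H → H} {x : H} : x ∈ free f ↔ f x = x := by simp [free]

theorem free_link {f : H → H} {x y : H} (hxy : x ≠ y) :
    free (link f x y) = ((free f).erase x).erase y := by
  ext z
  simp only [mem_free, link_free_iff hxy, Finset.mem_erase]
  tauto

theorem numExt_isMatching {f : H → H} (hf : Function.Involutive f) {k : ℕ}
    (hk : (free f).card = 2 * k) :
    numExt IsMatching f = Nat.doubleFactorial (2 * k - 1) := by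
  classical
  induction k generalizing f with
  | zero =>
    have h0 : ∀ x, f x ≠ x := by
      intro x hx
      have : x ∈ free f := by simpa using hx
      simp_all
    have : (Finset.univ.filter fun F : H → H => IsMatching F ∧ Extends f F) = {f} := by
      ext F
      simp only [Finset.mem_filter, Finset.mem_univ, true_and, Finset.mem_singleton]
      constructor
      · rintro ⟨_, h⟩
        funext x
        exact h x (h0 x)
      · rintro rfl
        exact ⟨⟨hf, h0⟩, fun _ _ => rfl⟩
    simp [numExt, this]
  | succ k ih =>
    obtain ⟨x, hx⟩ : (free f).Nonempty := by
      rw [← Finset.card_pos]; omega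
    rw [mem_free] at hx
    have hY : ∀ y ∈ (free f).erase x, f y = y ∧ y ≠ x := by
      intro y hy
      simp only [Finset.mem_erase, mem_free] at hy
      exact ⟨hy.2, hy.1⟩
    have hle := sum_numExt_link_le (P := IsMatching) hx _ hY
    have hge : numExt IsMatching f ≤ ∑ y ∈ (free f).erase x, numExt IsMatching (link f x y) := by
      unfold numExt
      refine le_trans (Finset.card_le_card ?_) Finset.card_biUnion_le
      intro F hF
      simp only [Finset.mem_biUnion, Finset.mem_filter, Finset.mem_univ, true_and] at hF ⊢
      refine ⟨F x, ?_, hF.1, ?_⟩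
      · simp [hF.1.2 x, hF.2.free_of_free hf hF.1.1 hx]
      · intro z hz
        by_cases h1 : z = x
        · subst h1; rw [link_left]
        by_cases h2 : z = F x
        · subst h2; rw [link_right, hF.1.1]
        · rw [link_of_ne h1 h2] at hz ⊢
          exact hF.2 z hz
    have hsum : ∑ y ∈ (free f).erase x, numExt IsMatching (link f x y) =
        ∑ y ∈ (free f).erase x, Nat.doubleFactorial (2 * k - 1) := by
      refine Finset.sum_congr rfl fun y hy => ?_
      refine ih (link_involutive hf hx (hY y hy).1) ?_
      rw [free_link (hY y hy).2.symm, Finset.card_erase_of_mem hy,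
        Finset.card_erase_of_mem (by simpa using hx)]
      omega
    rw [le_antisymm hge hle, hsum, Finset.sum_const,
      Finset.card_erase_of_mem (by simpa using hx), hk,
      smul_eq_mul]
    cases k with
    | zero => simp
    | succ k =>
      have : 2 * (k + 1 + 1) - 1 = (2 * (k + 1) - 1) + 2 := by omega
      rw [this, Nat.doubleFactorial]


/-- The number of perfect matchings of a set of even cardinality. -/
theorem ncard_isMatching (h : Even (Fintype.card H)) :
    Set.ncard {f : H → H | IsMatching f} = Nat.doubleFactorial (Fintype.card H - 1) := by
  classical
  obtain ⟨k, hk⟩ := h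
  have := numExt_isMatching (f := (id : H → H)) (fun _ => rfl) (k := k)
    (by simp [free, Finset.card_univ, hk]; omega)
  rw [hk, ← two_mul, ← this, numExt, Set.ncard_eq_toFinset_card']
  congr 1
  ext F
  simp [extends_id]

end PartialMatchings

section SimpleMatchings

variable {H V : Type*}

/-- A partial matching of half-edges is simple if the induced multigraph has neither self-loops
nor multiple edges. -/
def SimpleMatching (vert : H → V) (f : H → H) : Prop :=
  (∀ x, f x ≠ x → vert (f x) ≠ vert x) ∧
    ∀ x y, f x ≠ x → f y ≠ y → vert x = vert y → vert (f x) = vert (f y) → x = y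

variable [DecidableEq H]

theorem SimpleMatching.link {vert : H → V} {f : H → H} (hf : Function.Involutive f)
    (h : SimpleMatching vert f) {x y : H} (hx : f x = x) (hy : f y = y)
    (hxy : vert x ≠ vert y) (hadj : ∀ z, f z ≠ z → vert z = vert x → vert (f z) ≠ vert y) :
    SimpleMatching vert (link f x y) := by
  have hadj' : ∀ z, f z ≠ z → vert z = vert y → vert (f z) ≠ vert x := by
    intro z hz h1 h2
    refine hadj (f z) (fun h' => hz ?_) h2 (by rw [hf z, h1])
    rw [hf z] at h'; exact h'.symm
  have key : ∀ z, PaperCM.link f x y z ≠ z → (z = x ∧ PaperCM.link f x y z = y) ∨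
      (z = y ∧ PaperCM.link f x y z = x) ∨ (f z ≠ z ∧ PaperCM.link f x y z = f z) := by
    intro z hz
    by_cases h1 : z = x
    · subst h1; exact Or.inl ⟨rfl, link_left _ _ _⟩
    by_cases h2 : z = y
    · subst h2; exact Or.inr (Or.inl ⟨rfl, link_right _ _ _⟩)
    · rw [link_of_ne h1 h2] at hz ⊢
      exact Or.inr (Or.inr ⟨hz, rfl⟩)
  constructor
  · intro z hz
    rcases key z hz with ⟨rfl, h1⟩ | ⟨rfl, h1⟩ | ⟨h1, h2⟩
    · rw [h1]; exact hxy.symm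
    · rw [h1]; exact hxy
    · rw [h2]; exact h.1 z h1
  · intro z w hz hw hv hfv
    rcases key z hz with ⟨rfl, h1⟩ | ⟨rfl, h1⟩ | ⟨h1, h2⟩ <;>
    rcases key w hw with ⟨rfl, h3⟩ | ⟨rfl, h3⟩ | ⟨h3, h4⟩
    · rfl
    · exact absurd hv hxy
    · rw [h1, h4] at hfv; exact absurd hfv.symm (hadj w h3 hv.symm)
    · exact absurd hv.symm hxy
    · rfl
    · rw [h1, h4] at hfv; exact absurd hfv.symm (hadj' w h3 hv.symm)
    · rw [h2, h3] at hfv; exact absurd hfv (hadj z h1 hv)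
    · rw [h2, h3] at hfv; exact absurd hfv (hadj' z h1 hv)
    · rw [h2, h4] at hfv; exact h.2 z w h1 h3 hv hfv

variable [Fintype H]

theorem exists_simple_completion {vert : H → V} {R : Finset H}
    (hR : ∀ x ∈ R, ∀ y, vert x = vert y → x = y) {f : H → H}
    (hf : Function.Involutive f) (hs : SimpleMatching vert f) (hRf : R ⊆ free f)
    (hcard : (free f \ R).card = R.card) :
    ∃ F, (IsMatching F ∧ SimpleMatching vert F ∧ ∀ x ∈ R, F x ∉ R) ∧ Extends f F := by
  let e := Finset.equivOfCardEq hcard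
  have he : ∀ z (h : z ∈ free f \ R), (e ⟨z, h⟩ : H) ∈ R := fun z h => (e ⟨z, h⟩).2
  have he' : ∀ z (h : z ∈ R), (e.symm ⟨z, h⟩ : H) ∈ free f \ R := fun z h => (e.symm ⟨z, h⟩).2
  let F : H → H := fun z => if h : z ∈ R then (e.symm ⟨z, h⟩ : H) else
    if h' : z ∈ free f \ R then (e ⟨z, h'⟩ : H) else f z
  have F1 : ∀ z (h : z ∈ R), F z = e.symm ⟨z, h⟩ := fun z h => by simp only [F, dif_pos h]
  have F2 : ∀ z (h : z ∈ free f \ R), F z = e ⟨z, h⟩ := fun z h => by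
    have : z ∉ R := (Finset.mem_sdiff.1 h).2
    simp only [F, dif_neg this, dif_pos h]
  have F3 : ∀ z, f z ≠ z → F z = f z := fun z h => by
    have h1 : z ∉ R := fun h' => h (by simpa using hRf h')
    have h2 : z ∉ free f \ R := fun h' => h (by simpa using (Finset.mem_sdiff.1 h').1)
    simp only [F, dif_neg h1, dif_neg h2]
  have cases3 : ∀ z, z ∈ R ∨ z ∈ free f \ R ∨ f z ≠ z := by
    intro z; simp only [Finset.mem_sdiff, mem_free]; tauto
  have hinv : Function.Involutive F := by
    intro z
    rcases cases3 z with h | h | h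
    · rw [F1 z h, F2 _ (he' z h)]; simp
    · rw [F2 z h, F1 _ (he z h)]; simp
    · rw [F3 z h, F3, hf]
      rw [hf]; exact h.symm
  have hne : ∀ z, F z ≠ z := by
    intro z hz
    rcases cases3 z with h | h | h
    · rw [F1 z h] at hz
      have := he' z h
      rw [hz] at this; exact (Finset.mem_sdiff.1 this).2 h
    · rw [F2 z h] at hz
      have := he z h
      rw [hz] at this; exact (Finset.mem_sdiff.1 h).2 this
    · rw [F3 z h] at hz; exact h hz
  refine ⟨F, ⟨⟨hinv, hne⟩, ⟨?_, ?_⟩, ?_⟩, F3⟩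
  · intro z _ hv
    rcases cases3 z with h | h | h
    · exact hne z (hR z h _ hv.symm).symm
    · refine hne z (hR _ ?_ _ hv)
      rw [F2 z h]; exact he z h
    · rw [F3 z h] at hv; exact hs.1 z h hv
  · intro z w _ _ hv hfv
    by_cases hz : f z ≠ z
    · by_cases hw : f w ≠ w
      · rw [F3 z hz, F3 w hw] at hfv
        exact hs.2 z w hz hw hv hfv
      · rcases cases3 w with h | h | h
        · exact (hR w h z hv.symm).symm
        · have := hR (F w) (by rw [F2 w h]; exact he w h) _ hfv.symm
          exact (hinv.injective this).symm
        · exact absurd h hw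
    · rcases cases3 z with h | h | h
      · exact hR z h w hv
      · have := hR (F z) (by rw [F2 z h]; exact he z h) _ hfv
        exact hinv.injective this
      · exact absurd h hz
  · intro x hx
    rw [F1 x hx]
    exact (Finset.mem_sdiff.1 (he' x hx)).2

/-- Greedy lower bound for the number of simple completions of a partial matching: the elements of
`R`, which lie on distinct vertices of degree one, absorb the half-edges left over by the greedy
procedure. -/
theorem doubleFactorial_le_numExt_simple [DecidableEq V] {vert : H → V} {R : Finset H}
    (hR : ∀ x ∈ R, ∀ y, vert x = vert y → x = y) {M : ℕ} (hM : M + M * M ≤ R.card) {j : ℕ}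
    {f : H → H} (hf : Function.Involutive f) (hs : SimpleMatching vert f) (hRf : R ⊆ free f)
    (hdeg : ∀ x ∈ free f \ R, (Finset.univ.filter fun y => vert y = vert x).card ≤ M)
    (hcard : (free f \ R).card = R.card + 2 * j) :
    Nat.doubleFactorial (2 * j) ≤
      numExt (fun F => IsMatching F ∧ SimpleMatching vert F ∧ ∀ x ∈ R, F x ∉ R) f := by
  induction j generalizing f with
  | zero =>
    obtain ⟨F, hF, hE⟩ := exists_simple_completion hR hf hs hRf (by simpa using hcard)
    simpa using one_le_numExt hF hE
  | succ j ih =>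
    obtain ⟨x, hxm⟩ : (free f \ R).Nonempty := by
      rw [← Finset.card_pos]; omega
    have hx : f x = x := by simpa using (Finset.mem_sdiff.1 hxm).1
    have hxR : x ∉ R := (Finset.mem_sdiff.1 hxm).2
    set N := Finset.univ.filter fun y => vert y = vert x with hN
    set bad := N ∪ N.biUnion fun z => (free f \ R).filter fun y => vert y = vert (f z) with hbad
    have hbadcard : bad.card ≤ M + M * M := by
      refine (Finset.card_union_le _ _).trans (add_le_add (hdeg x hxm) ?_)
      refine Finset.card_biUnion_le.trans ?_
      refine (Finset.sum_le_card_nsmul _ _ M ?_).trans ?_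
      · intro z _
        rcases Finset.eq_empty_or_nonempty ((free f \ R).filter fun y => vert y = vert (f z))
          with h | ⟨w, hw⟩
        · rw [h]; simp
        · rw [Finset.mem_filter] at hw
          refine (Finset.card_le_card ?_).trans (hdeg w hw.1)
          intro y hy
          rw [Finset.mem_filter] at hy
          simp [hy.2, hw.2]
      · rw [smul_eq_mul]; exact Nat.mul_le_mul_right _ (hdeg x hxm)
    have hYp : ∀ y ∈ (free f \ R) \ bad, f y = y ∧ y ∉ R ∧ y ≠ x ∧ vert x ≠ vert y ∧
        ∀ z, f z ≠ z → vert z = vert x → vert (f z) ≠ vert y := by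
      intro y hy
      have h0 := (Finset.mem_sdiff.1 hy).1
      have h3 := (Finset.mem_sdiff.1 hy).2
      have h1 : f y = y := by simpa using (Finset.mem_sdiff.1 h0).1
      have h2 : y ∉ R := (Finset.mem_sdiff.1 h0).2
      rw [hbad, Finset.mem_union, not_or] at h3
      have h4 : vert x ≠ vert y := fun h => h3.1 (by simp [hN, h])
      refine ⟨h1, h2, fun h => h4 (by rw [h]), h4, ?_⟩
      intro z _ hzx hzy
      refine h3.2 (Finset.mem_biUnion.2 ⟨z, by simp [hN, hzx], ?_⟩)
      rw [Finset.mem_filter]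
      exact ⟨h0, hzy.symm⟩
    have hYcard : 2 * (j + 1) ≤ ((free f \ R) \ bad).card := by
      have := Finset.le_card_sdiff bad (free f \ R)
      omega
    have key := mul_le_numExt
      (P := fun F => IsMatching F ∧ SimpleMatching vert F ∧ ∀ x ∈ R, F x ∉ R)
      hx ((free f \ R) \ bad) (b := Nat.doubleFactorial (2 * j))
      (fun y hy => ⟨(hYp y hy).1, (hYp y hy).2.2.1⟩) ?_
    · refine le_trans ?_ key
      have : 2 * (j + 1) = 2 * j + 2 := by ring
      rw [this, Nat.doubleFactorial_add_two]
      exact Nat.mul_le_mul_right _ hYcard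
    · intro y hy
      obtain ⟨h1, h2, h3, h4, h5⟩ := hYp y hy
      have hfree : free (link f x y) \ R = ((free f \ R).erase x).erase y := by
        rw [free_link h3.symm]
        ext z; simp only [Finset.mem_sdiff, Finset.mem_erase]; tauto
      refine ih (link_involutive hf hx h1) (hs.link hf hx h1 h4 h5) ?_ ?_ ?_
      · intro z hz
        rw [free_link h3.symm, Finset.mem_erase, Finset.mem_erase]
        exact ⟨fun h => h2 (h ▸ hz), fun h => hxR (h ▸ hz), hRf hz⟩
      · intro z hz
        rw [hfree, Finset.mem_erase, Finset.mem_erase] at hz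
        exact hdeg z hz.2.2
      · rw [hfree, Finset.card_erase_of_mem, Finset.card_erase_of_mem hxm, hcard]
        · omega
        · rw [Finset.mem_erase]
          exact ⟨h3, (Finset.mem_sdiff.1 hy).1⟩

end SimpleMatchings

section Connecting

variable {H V : Type*}

/-- Two vertices are joined by a partial matching if every vertex colouring which is constant along
the edges gives them the same colour. -/
def Joined (vert : H → V) (f : H → H) (u v : V) : Prop :=
  ∀ c : V → Prop, (∀ x, c (vert x) ↔ c (vert (f x))) → (c u ↔ c v)

theorem Joined.refl (vert : H → V) (f : H → H) (u : V) : Joined vert f u u := fun _ _ => Iff.rfl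

theorem Joined.symm {vert : H → V} {f : H → H} {u v : V} (h : Joined vert f u v) :
    Joined vert f v u := fun c hc => (h c hc).symm

theorem Joined.trans {vert : H → V} {f : H → H} {u v w : V} (h : Joined vert f u v)
    (h' : Joined vert f v w) : Joined vert f u w := fun c hc => (h c hc).trans (h' c hc)

theorem joined_apply (vert : H → V) (f : H → H) (x : H) : Joined vert f (vert x) (vert (f x)) :=
  fun _ hc => hc x

theorem Joined.mono {vert : H → V} {f F : H → H} (hE : Extends f F) {u v : V}
    (h : Joined vert f u v) : Joined vert F u v := by
  intro c hc
  refine h c fun x => ?_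
  by_cases hx : f x = x
  · rw [hx]
  · rw [← hE x hx]; exact hc x

theorem doubleFactorial_le_succ (n : ℕ) :
    Nat.doubleFactorial n ≤ Nat.doubleFactorial (n + 1) := by
  induction n using Nat.twoStepInduction with
  | zero => simp
  | one => simp [Nat.doubleFactorial]
  | more n ih _ =>
    rw [Nat.doubleFactorial_add_two, show n + 2 + 1 = n + 1 + 2 by ring,
      Nat.doubleFactorial_add_two]
    exact Nat.mul_le_mul (by omega) ih

theorem doubleFactorial_mono : Monotone Nat.doubleFactorial :=
  monotone_nat_of_le_succ doubleFactorial_le_succ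

theorem doubleFactorial_le_mul_pow {n h : ℕ} (h0 : 0 < h) (hn : n ≤ h) (q : ℕ) :
    Nat.doubleFactorial n ≤ Nat.doubleFactorial (n - q) * h ^ q := by
  induction q with
  | zero => simp
  | succ q ih =>
    refine ih.trans ?_
    rw [pow_succ, mul_comm (h ^ q) h, ← mul_assoc]
    refine Nat.mul_le_mul_right _ ?_
    rw [show n - (q + 1) = n - q - 1 by omega]
    rcases Nat.eq_zero_or_pos (n - q) with h1 | h1
    · rw [h1]
      simp; omega
    · obtain ⟨k, hk⟩ : ∃ k, n - q = k + 1 := ⟨n - q - 1, by omega⟩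
      rw [hk, Nat.doubleFactorial_add_one, Nat.add_sub_cancel, mul_comm]
      exact Nat.mul_le_mul (doubleFactorial_mono (by omega)) (by omega)

variable [DecidableEq H] [Fintype H] [DecidableEq V]

/-- Pairing up the half-edges at random connects the components of a partial matching with at
least inverse polynomial probability, provided that every component has at least two unmatched
half-edges. -/
theorem doubleFactorial_le_numExt_joined {vert : H → V} {R : Finset H}
    (hR : ∀ x ∈ R, ∀ y, vert x = vert y → x = y) {M : ℕ} (hM : M + M * M ≤ R.card) {j h t : ℕ}
    {U : V → Prop} (hU : ∀ x, x ∉ R → U (vert x))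
    {f : H → H} {κ : V → V} {J : Finset V}
    (hf : Function.Involutive f) (hs : SimpleMatching vert f) (hRf : R ⊆ free f)
    (hdeg : ∀ x ∈ free f \ R, (Finset.univ.filter fun y => vert y = vert x).card ≤ M)
    (hκ : ∀ x, κ (vert (f x)) = κ (vert x)) (hJ : ∀ v, U v → κ v ∈ J)
    (hjoin : ∀ u v, U u → U v → κ u = κ v → Joined vert f u v)
    (hfree : ∀ l ∈ J, 2 ≤ ((free f \ R).filter fun x => κ (vert x) = l).card)
    (hJc : J.card = t + 1)
    (hcard : (free f \ R).card = R.card + 2 * j + 2 * t)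
    (h0 : 0 < h) (hh : (free f \ R).card ≤ h) :
    Nat.doubleFactorial (free f \ R).card ≤
      numExt (fun F => IsMatching F ∧ SimpleMatching vert F ∧ (∀ x ∈ R, F x ∉ R) ∧
        ∀ u v, U u → U v → Joined vert F u v) f * (t + 1) * h ^ R.card := by
  induction t generalizing f κ J with
  | zero =>
    obtain ⟨l, hl⟩ := Finset.card_eq_one.1 hJc
    have h1 := doubleFactorial_le_numExt_simple hR hM (j := j) hf hs hRf hdeg (by omega)
    have h2 : numExt (fun F => IsMatching F ∧ SimpleMatching vert F ∧ ∀ x ∈ R, F x ∉ R) f ≤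
        numExt (fun F => IsMatching F ∧ SimpleMatching vert F ∧ (∀ x ∈ R, F x ∉ R) ∧
        ∀ u v, U u → U v → Joined vert F u v) f := by
      refine numExt_mono fun F hE hF => ⟨hF.1, hF.2.1, hF.2.2, fun u v hu hv => ?_⟩
      refine Joined.mono hE (hjoin u v hu hv ?_)
      have h3 := hJ u hu
      have h4 := hJ v hv
      rw [hl, Finset.mem_singleton] at h3 h4
      rw [h3, h4]
    have h3 := doubleFactorial_le_mul_pow h0 hh R.card
    rw [show (free f \ R).card - R.card = 2 * j by omega] at h3
    refine h3.trans (Nat.mul_le_mul_right _ ?_)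
    simpa using h1.trans h2
  | succ t ih =>
    set A := free f \ R with hA
    set P := (fun F => IsMatching F ∧ SimpleMatching vert F ∧ (∀ x ∈ R, F x ∉ R) ∧
        ∀ u v, U u → U v → Joined vert F u v) with hP
    have hsum : A.card = ∑ l ∈ J, (A.filter fun x => κ (vert x) = l).card :=
      Finset.card_eq_sum_card_fiberwise fun x hx =>
        hJ _ (hU x (Finset.mem_sdiff.1 (Finset.mem_coe.1 hx)).2)
    obtain ⟨l, hlJ, hl⟩ : ∃ l ∈ J, (A.filter fun x => κ (vert x) = l).card * J.card ≤ A.card := by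
      by_contra! hcon
      have hne : J.Nonempty := Finset.card_pos.1 (by omega)
      have : ∑ l ∈ J, A.card < ∑ l ∈ J, (A.filter fun x => κ (vert x) = l).card * J.card :=
        Finset.sum_lt_sum_of_nonempty hne hcon
      rw [← Finset.sum_mul, ← hsum, Finset.sum_const, smul_eq_mul, mul_comm] at this
      exact lt_irrefl _ this
    obtain ⟨x, hx⟩ : (A.filter fun x => κ (vert x) = l).Nonempty := by
      rw [← Finset.card_pos]; have := hfree l hlJ; omega
    rw [Finset.mem_filter] at hx
    obtain ⟨hxA, hxl⟩ := hx
    have hxf : f x = x := by simpa using (Finset.mem_sdiff.1 hxA).1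
    have hxR : x ∉ R := (Finset.mem_sdiff.1 hxA).2
    set Y := A.filter fun y => κ (vert y) ≠ l with hY
    have hYc : (A.filter fun x => κ (vert x) = l).card + Y.card = A.card :=
      Finset.card_filter_add_card_filter_not _
    have hYp : ∀ y ∈ Y, f y = y ∧ y ≠ x := by
      intro y hy
      rw [hY, Finset.mem_filter] at hy
      refine ⟨by simpa using (Finset.mem_sdiff.1 hy.1).1, ?_⟩
      rintro rfl; exact hy.2 hxl
    have hstep : ∀ y ∈ Y, Nat.doubleFactorial (A.card - 2) ≤
        numExt P (link f x y) * (t + 1) * h ^ R.card := by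
      intro y hy
      obtain ⟨hyf, hyx⟩ := hYp y hy
      rw [hY, Finset.mem_filter] at hy
      obtain ⟨hyA, hyl⟩ := hy
      have hyR : y ∉ R := (Finset.mem_sdiff.1 hyA).2
      have hE := extends_link hxf hyf
      have hA' : free (link f x y) \ R = (A.erase x).erase y := by
        rw [free_link hyx.symm]
        ext z; simp only [hA, Finset.mem_sdiff, Finset.mem_erase]; tauto
      have hA'c : (free (link f x y) \ R).card = A.card - 2 := by
        rw [hA', Finset.card_erase_of_mem (Finset.mem_erase.2 ⟨hyx, hyA⟩),
          Finset.card_erase_of_mem hxA]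
        omega
      have hxy : vert x ≠ vert y := fun h => hyl (by rw [← h, hxl])
      rw [← hA'c]
      refine ih (κ := fun v => if κ v = κ (vert y) then l else κ v) (J := J.erase (κ (vert y)))
        (link_involutive hf hxf hyf) (hs.link hf hxf hyf hxy ?_) ?_ ?_ ?_ ?_ ?_ ?_ ?_ ?_ ?_
      · intro z hz hzx hzy'
        refine hyl ?_
        rw [← hzy', hκ, hzx, hxl]
      · intro z hz
        rw [free_link hyx.symm, Finset.mem_erase, Finset.mem_erase]
        exact ⟨fun h => hyR (h ▸ hz), fun h => hxR (h ▸ hz), hRf hz⟩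
      · intro z hz
        rw [hA', Finset.mem_erase, Finset.mem_erase] at hz
        exact hdeg z hz.2.2
      · intro z
        by_cases h1 : z = x
        · rw [h1, link_left, hxl, if_pos rfl, if_neg (Ne.symm hyl)]
        by_cases h2 : z = y
        · rw [h2, link_right, hxl, if_pos rfl, if_neg (Ne.symm hyl)]
        · rw [link_of_ne h1 h2, hκ]
      · intro v hv
        split_ifs with h1
        · exact Finset.mem_erase.2 ⟨Ne.symm hyl, hlJ⟩
        · exact Finset.mem_erase.2 ⟨h1, hJ v hv⟩
      · intro u v hu hv huv
        have hto : ∀ w, U w → (κ w = κ (vert y) ∨ κ w = l) →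
            Joined vert (link f x y) w (vert x) := by
          intro w hw hcase
          rcases hcase with h1 | h1
          · refine ((hjoin w (vert y) hw (hU y hyR) h1).mono hE).trans ?_
            have := joined_apply vert (link f x y) y
            rwa [link_right] at this
          · exact (hjoin w (vert x) hw (hU x hxR) (by rw [h1, hxl])).mono hE
        split_ifs at huv with h1 h2 h2
        · exact (hto u hu (Or.inl h1)).trans (hto v hv (Or.inl h2)).symm
        · exact (hto u hu (Or.inl h1)).trans (hto v hv (Or.inr huv.symm)).symm
        · exact (hto u hu (Or.inr huv)).trans (hto v hv (Or.inl h2)).symm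
        · exact (hjoin u v hu hv huv).mono hE
      · intro m hm
        rw [Finset.mem_erase] at hm
        rw [hA']
        by_cases hml : m = l
        · subst hml
          have hyc : κ (vert y) ∈ J := hJ _ (hU y hyR)
          have hc1 := hfree _ hlJ
          have hc2 := hfree _ hyc
          have hsub : ((A.filter fun z => κ (vert z) = m).erase x) ∪
              ((A.filter fun z => κ (vert z) = κ (vert y)).erase y) ⊆
              ((A.erase x).erase y).filter fun z =>
                (if κ (vert z) = κ (vert y) then m else κ (vert z)) = m := by
            intro z hz
            simp only [Finset.mem_union, Finset.mem_erase, Finset.mem_filter] at hz ⊢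
            rcases hz with ⟨h1, h2, h3⟩ | ⟨h1, h2, h3⟩
            · refine ⟨⟨?_, h1, h2⟩, ?_⟩
              · rintro rfl; exact hyl h3
              · split_ifs <;> [rfl; exact h3]
            · refine ⟨⟨h1, ?_, h2⟩, ?_⟩
              · rintro rfl; exact hyl (by rw [← h3, hxl])
              · rw [if_pos h3]
          refine le_trans ?_ (Finset.card_le_card hsub)
          rw [Finset.card_union_of_disjoint, Finset.card_erase_of_mem (by simp [hxA, hxl]),
            Finset.card_erase_of_mem (by simp [hyA])]
          · omega
          · refine Finset.disjoint_left.2 fun z hz hz' => ?_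
            simp only [Finset.mem_erase, Finset.mem_filter] at hz hz'
            exact hyl (by rw [← hz'.2.2, hz.2.2])
        · refine (hfree m hm.2).trans (Finset.card_le_card fun z hz => ?_)
          simp only [Finset.mem_erase, Finset.mem_filter] at hz ⊢
          refine ⟨⟨?_, ?_, hz.1⟩, ?_⟩
          · rintro rfl; exact hm.1 hz.2.symm
          · rintro rfl; exact hml (by rw [← hz.2, hxl])
          · rw [if_neg (by rw [hz.2]; exact hm.1), hz.2]
      · rw [Finset.card_erase_of_mem (hJ _ (hU y hyR)), hJc]; omega
      · rw [hA'c, hcard]; omega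
      · rw [hA'c]; omega
    have hYsum : Y.card * Nat.doubleFactorial (A.card - 2) ≤ numExt P f * (t + 1) * h ^ R.card := by
      calc Y.card * Nat.doubleFactorial (A.card - 2)
          = ∑ y ∈ Y, Nat.doubleFactorial (A.card - 2) := by rw [Finset.sum_const, smul_eq_mul]
        _ ≤ ∑ y ∈ Y, numExt P (link f x y) * (t + 1) * h ^ R.card := Finset.sum_le_sum hstep
        _ = (∑ y ∈ Y, numExt P (link f x y)) * (t + 1) * h ^ R.card := by
          rw [Finset.sum_mul, Finset.sum_mul]
        _ ≤ _ := by
          gcongr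
          exact sum_numExt_link_le hxf Y hYp
    have hA2 : Nat.doubleFactorial A.card = A.card * Nat.doubleFactorial (A.card - 2) := by
      obtain ⟨k, hk⟩ : ∃ k, A.card = k + 2 := ⟨A.card - 2, by omega⟩
      rw [hk, Nat.doubleFactorial_add_two, Nat.add_sub_cancel]
    have hYJ : A.card * (t + 1) ≤ Y.card * (t + 1 + 1) := by
      rw [hJc] at hl
      nlinarith
    refine Nat.le_of_mul_le_mul_right (c := t + 1) ?_ (by omega)
    calc Nat.doubleFactorial A.card * (t + 1)
        = (A.card * (t + 1)) * Nat.doubleFactorial (A.card - 2) := by rw [hA2]; ring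
      _ ≤ (Y.card * (t + 1 + 1)) * Nat.doubleFactorial (A.card - 2) := by gcongr
      _ = (Y.card * Nat.doubleFactorial (A.card - 2)) * (t + 1 + 1) := by ring
      _ ≤ (numExt P f * (t + 1) * h ^ R.card) * (t + 1 + 1) := by gcongr
      _ = _ := by ring

end Connecting

section Forests

variable {H V : Type*} [DecidableEq H]

/-- A partial matching between `Z` and `O` forms a forest with root map `ρ` and rank `r`:
every component is a tree containing a vertex of `W` or an unmatched element of `O`,
which is then its root, and the matched elements of `O` point towards vertices of lower rank. -/
structure IsForest (vert : H → V) (O Z : Finset H) (U W : V → Prop) (f : H → H) (ρ : V → V)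
    (r : V → ℕ) : Prop where
  involutive : Function.Involutive f
  cross : ∀ x, f x ≠ x → (x ∈ Z ∧ f x ∈ O) ∨ (x ∈ O ∧ f x ∈ Z)
  root_apply : ∀ x, ρ (vert (f x)) = ρ (vert x)
  root_of_mem : ∀ w, W w → ρ w = w
  root_of_free : ∀ x ∈ O, f x = x → ρ (vert x) = vert x
  root_mem : ∀ v, U v → W (ρ v) ∨ ∃ x ∈ O, f x = x ∧ vert x = ρ v
  joined : ∀ v, Joined vert f v (ρ v)
  rank_lt : ∀ x ∈ O, f x ≠ x → r (vert (f x)) < r (vert x)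

theorem isForest_id {vert : H → V} {O Z : Finset H} {U W : V → Prop}
    (hUW : ∀ v, U v → W v ∨ ∃ x ∈ O, vert x = v) :
    IsForest vert O Z U W id id fun _ => 0 where
  involutive _ := rfl
  cross _ h := absurd rfl h
  root_apply _ := rfl
  root_of_mem _ _ := rfl
  root_of_free _ _ _ := rfl
  root_mem v hv := (hUW v hv).imp_right fun ⟨x, hx, h⟩ => ⟨x, hx, rfl, h⟩
  joined _ := Joined.refl _ _ _
  rank_lt _ _ h := absurd rfl h

open Classical in
theorem IsForest.link {vert : H → V} {O Z : Finset H} {U W : V → Prop}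
    (hOZ : Disjoint O Z) (hO : ∀ x ∈ O, ∀ y ∈ O, vert x = vert y → x = y)
    (hOW : ∀ x ∈ O, ¬ W (vert x)) (hZU : ∀ x ∈ Z, U (vert x))
    {f : H → H} {ρ : V → V} {r : V → ℕ} (h : IsForest vert O Z U W f ρ r) {z o : H}
    (hz : z ∈ Z) (ho : o ∈ O) (hfz : f z = z) (hfo : f o = o) (hne : ρ (vert z) ≠ vert o) :
    IsForest vert O Z U W (link f z o) (fun v => if ρ v = vert o then ρ (vert z) else ρ v)
      (fun v => if ρ v = vert o then r v + r (vert z) + 1 else r v) := by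
  have hzo : z ≠ o := fun e => Finset.disjoint_left.1 hOZ ho (e ▸ hz)
  have hro := h.root_of_free o ho hfo
  have hE := extends_link hfz hfo
  refine ⟨link_involutive h.involutive hfz hfo, ?_, ?_, ?_, ?_, ?_, ?_, ?_⟩
  · intro x hx
    by_cases h1 : x = z
    · subst h1; rw [link_left]; exact Or.inl ⟨hz, ho⟩
    by_cases h2 : x = o
    · subst h2; rw [link_right]; exact Or.inr ⟨ho, hz⟩
    · rw [link_of_ne h1 h2] at hx ⊢; exact h.cross x hx
  · intro x
    by_cases h1 : x = z
    · rw [h1, link_left, if_pos hro, if_neg hne]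
    by_cases h2 : x = o
    · rw [h2, link_right, if_pos hro, if_neg hne]
    · rw [link_of_ne h1 h2, h.root_apply]
  · intro w hw
    have h1 := h.root_of_mem w hw
    simp only [h1]
    rw [if_neg]
    rintro rfl; exact hOW o ho hw
  · intro x hx hfx
    rw [link_free_iff hzo] at hfx
    have h1 := h.root_of_free x hx hfx.1
    simp only [h1]
    rw [if_neg]
    exact fun e => hfx.2.2 (hO x hx o ho e)
  · intro v hv
    have key : ∀ u, U u → ρ u ≠ vert o →
        W (ρ u) ∨ ∃ x ∈ O, PaperCM.link f z o x = x ∧ vert x = ρ u := by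
      intro u hu hne'
      refine (h.root_mem u hu).imp_right ?_
      rintro ⟨x, hx, hfx, hxa⟩
      refine ⟨x, hx, (link_free_iff hzo).2 ⟨hfx, ?_, ?_⟩, hxa⟩
      · rintro rfl; exact Finset.disjoint_left.1 hOZ hx hz
      · rintro rfl; exact hne' hxa.symm
    split_ifs with h1
    · exact key _ (hZU z hz) hne
    · exact key v hv h1
  · intro v
    split_ifs with h1
    · have h2 := (h.joined v).mono hE
      rw [h1] at h2
      refine h2.trans ?_
      have h3 := joined_apply vert (PaperCM.link f z o) o
      rw [link_right] at h3
      exact h3.trans ((h.joined _).mono hE)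
    · exact (h.joined v).mono hE
  · intro x hx hfx
    have h1 : x ≠ z := by rintro rfl; exact Finset.disjoint_left.1 hOZ hx hz
    by_cases h2 : x = o
    · subst h2
      rw [link_right, if_neg hne, if_pos hro]; omega
    · rw [link_of_ne h1 h2] at hfx ⊢
      have := h.rank_lt x hx hfx
      simp only [h.root_apply]
      split_ifs <;> omega

variable [Fintype H]

/-- Matching up `O` with `Z` so as to produce a rooted forest. -/
theorem factorial_mul_le_numExt {vert : H → V} {O Z : Finset H} {U W : V → Prop}
    (hOZ : Disjoint O Z) (hO : ∀ x ∈ O, ∀ y ∈ O, vert x = vert y → x = y)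
    (hOW : ∀ x ∈ O, ¬ W (vert x)) (hZU : ∀ x ∈ Z, U (vert x)) {P : (H → H) → Prop} {b k : ℕ}
    (hb : ∀ f ρ r, IsForest vert O Z U W f ρ r → (∀ x ∈ O, f x ≠ x) → (∀ x ∈ Z, f x ≠ x) →
      b ≤ numExt P f)
    {f : H → H} {ρ : V → V} {r : V → ℕ} (h : IsForest vert O Z U W f ρ r)
    (hkO : (O.filter fun x => f x = x).card = k) (hkZ : (Z.filter fun x => f x = x).card = k)
    (hk : k = 0 ∨ ∃ z ∈ Z, f z = z ∧ W (ρ (vert z))) :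
    (k - 1).factorial * b ≤ numExt P f := by
  classical
  induction k generalizing f ρ r with
  | zero =>
    rw [Finset.card_eq_zero] at hkO hkZ
    rw [Nat.zero_sub, Nat.factorial_zero, one_mul]
    refine hb f ρ r h (fun x hx hfx => ?_) (fun x hx hfx => ?_)
    · exact Finset.notMem_empty x (hkO ▸ Finset.mem_filter.2 ⟨hx, hfx⟩)
    · exact Finset.notMem_empty x (hkZ ▸ Finset.mem_filter.2 ⟨hx, hfx⟩)
  | succ k ih =>
    obtain ⟨z₀, hz₀, hfz₀, hW₀⟩ := hk.resolve_left (Nat.succ_ne_zero k)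
    have step : ∀ z ∈ Z, f z = z →
        (k = 0 ∨ ∃ z' ∈ Z, f z' = z' ∧ z' ≠ z ∧ W (ρ (vert z'))) →
        ∀ o ∈ O, f o = o → ρ (vert z) ≠ vert o →
        (k - 1).factorial * b ≤ numExt P (link f z o) := by
      intro z hz hfz hk' o ho hfo hne
      have hzo : z ≠ o := fun e => Finset.disjoint_left.1 hOZ ho (e ▸ hz)
      refine ih (h.link hOZ hO hOW hZU hz ho hfz hfo hne) ?_ ?_ ?_
      · have : (O.filter fun x => PaperCM.link f z o x = x) =
            (O.filter fun x => f x = x).erase o := by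
          ext x
          simp only [Finset.mem_filter, link_free_iff hzo, Finset.mem_erase]
          constructor
          · tauto
          · rintro ⟨h1, h2, h3⟩
            exact ⟨h2, h3, fun e => Finset.disjoint_left.1 hOZ h2 (e ▸ hz), h1⟩
        rw [this, Finset.card_erase_of_mem (by simp [ho, hfo]), hkO]; rfl
      · have : (Z.filter fun x => PaperCM.link f z o x = x) =
            (Z.filter fun x => f x = x).erase z := by
          ext x
          simp only [Finset.mem_filter, link_free_iff hzo, Finset.mem_erase]
          constructor
          · tauto
          · rintro ⟨h1, h2, h3⟩
            exact ⟨h2, h3, h1, fun e => Finset.disjoint_left.1 hOZ ho (e ▸ h2)⟩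
        rw [this, Finset.card_erase_of_mem (by simp [hz, hfz]), hkZ]; rfl
      · refine hk'.imp_right ?_
        rintro ⟨z', hz', hfz', hzz', hW'⟩
        refine ⟨z', hz', (link_free_iff hzo).2 ⟨hfz', hzz', ?_⟩, ?_⟩
        · rintro rfl; exact Finset.disjoint_left.1 hOZ ho hz'
        · rwa [if_neg]
          intro e; exact hOW o ho (e ▸ hW')
    by_cases hnW : ∃ z ∈ Z, f z = z ∧ ¬ W (ρ (vert z))
    · obtain ⟨z, hz, hfz, hWz⟩ := hnW
      obtain ⟨x₀, hx₀, hfx₀, hx₀z⟩ := (h.root_mem _ (hZU z hz)).resolve_left hWz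
      have hzz₀ : z₀ ≠ z := by rintro rfl; exact hWz hW₀
      have hk1 : 1 ≤ k := by
        have : ({z₀, z} : Finset H) ⊆ Z.filter fun x => f x = x := by
          intro x hx
          simp only [Finset.mem_insert, Finset.mem_singleton] at hx
          rcases hx with rfl | rfl <;> simp [*]
        have := Finset.card_le_card this
        rw [Finset.card_pair hzz₀, hkZ] at this
        omega
      have := mul_le_numExt (P := P) (b := (k - 1).factorial * b) hfz
        ((O.filter fun x => f x = x).erase x₀) (fun y hy => by
          simp only [Finset.mem_erase, Finset.mem_filter] at hy
          exact ⟨hy.2.2, fun e => Finset.disjoint_left.1 hOZ hy.2.1 (e ▸ hz)⟩) (fun y hy => by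
          simp only [Finset.mem_erase, Finset.mem_filter] at hy
          refine step z hz hfz (Or.inr ⟨z₀, hz₀, hfz₀, hzz₀, hW₀⟩) y hy.2.1 hy.2.2 ?_
          intro e
          exact hy.1 (hO y hy.2.1 x₀ hx₀ (by rw [hx₀z, e])))
      rw [Finset.card_erase_of_mem (by simp [hx₀, hfx₀]), hkO] at this
      obtain ⟨j, rfl⟩ : ∃ j, k = j + 1 := ⟨k - 1, by omega⟩
      refine le_trans (le_of_eq ?_) this
      simp only [Nat.add_sub_cancel]
      rw [Nat.factorial_succ, mul_assoc]
    · push Not at hnW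
      have := mul_le_numExt (P := P) (b := (k - 1).factorial * b) hfz₀
        (O.filter fun x => f x = x) (fun y hy => by
          rw [Finset.mem_filter] at hy
          exact ⟨hy.2, fun e => Finset.disjoint_left.1 hOZ hy.1 (e ▸ hz₀)⟩) (fun y hy => by
          rw [Finset.mem_filter] at hy
          refine step z₀ hz₀ hfz₀ ?_ y hy.1 hy.2 (fun e => hOW y hy.1 (e ▸ hW₀))
          rcases Nat.eq_zero_or_pos k with h0 | h0
          · exact Or.inl h0
          · right
            obtain ⟨z', hz'⟩ : ((Z.filter fun x => f x = x).erase z₀).Nonempty := by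
              rw [← Finset.card_pos, Finset.card_erase_of_mem (by simp [hz₀, hfz₀])]
              omega
            simp only [Finset.mem_erase, Finset.mem_filter] at hz'
            exact ⟨z', hz'.2.1, hz'.2.2, hz'.1, hnW z' hz'.2.1 hz'.2.2⟩)
      rw [hkO] at this
      refine le_trans ?_ this
      rcases Nat.eq_zero_or_pos k with h0 | h0
      · subst h0; simp
      · obtain ⟨j, rfl⟩ : ∃ j, k = j + 1 := ⟨k - 1, by omega⟩
        simp only [Nat.add_sub_cancel]
        rw [Nat.factorial_succ, mul_assoc]
        exact Nat.mul_le_mul_right _ (by omega)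

end Forests

section Patterns

variable {H V : Type*}

/-- `x` is the only element of `S` at its vertex. -/
def Alone (vert : H → V) (S : Finset H) (x : H) : Prop :=
  x ∈ S ∧ ∀ y ∈ S, vert y = vert x → y = x

/-- The matching `F` follows the pattern `S` off the reserved half-edges `R`: a half-edge belongs
to `S` exactly if its partner is reserved or its partner's vertex carries another element of `S`,
and the half-edges which are alone in `S` point towards vertices of lower rank. -/
def Follows (vert : H → V) (R S : Finset H) (F : H → H) : Prop :=
  (∀ x, x ∉ R → F x ∈ R → x ∈ S) ∧
  (∀ x, x ∉ R → F x ∉ R → (x ∈ S ↔ ∃ y ∈ S, vert y = vert (F x) ∧ y ≠ F x)) ∧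
  ∃ r : V → ℕ, ∀ x, Alone vert S x → F x ∉ R → r (vert (F x)) < r (vert x)

/-- A pattern selects a nonempty set of half-edges at every vertex with unreserved half-edges. -/
def IsPattern (vert : H → V) (R S : Finset H) : Prop :=
  (∀ x ∈ S, x ∉ R) ∧ ∀ x, x ∉ R → ∃ y ∈ S, vert y = vert x

theorem Follows.subset {vert : H → V} {R S S' : Finset H} {F : H → H}
    (hF : Function.Involutive F) (hS : IsPattern vert R S) (hS' : IsPattern vert R S')
    (h : Follows vert R S F) (h' : Follows vert R S' F) : S' ⊆ S := by
  classical
  obtain ⟨h1, h2, r, hr⟩ := h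
  by_contra hcon
  obtain ⟨x₀, hx₀⟩ : (S' \ S).Nonempty := by
    rw [Finset.nonempty_iff_ne_empty, Ne, Finset.sdiff_eq_empty_iff_subset]; exact hcon
  obtain ⟨x, hx, hmax⟩ := Finset.exists_max_image (S' \ S) (fun x => r (vert x)) ⟨x₀, hx₀⟩
  rw [Finset.mem_sdiff] at hx
  have hxR := hS'.1 x hx.1
  have hFx : F x ∉ R := fun e => hx.2 (h1 x hxR e)
  have h3 : ∀ y ∈ S, vert y = vert (F x) → y = F x := by
    intro y hy hv
    by_contra hne
    exact hx.2 ((h2 x hxR hFx).2 ⟨y, hy, hv, hne⟩)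
  obtain ⟨w, hw, hwv⟩ := hS.2 _ hFx
  have h4 := h3 w hw hwv
  subst h4
  have h5 := hr (F x) ⟨hw, h3⟩ (by rwa [hF x])
  rw [hF x] at h5
  obtain ⟨y, hy, hyv, hne⟩ := (h'.2.1 x hxR hFx).1 hx.1
  have h6 := hmax y (Finset.mem_sdiff.2 ⟨hy, fun hyS => hne (h3 y hyS hyv)⟩)
  rw [hyv] at h6
  exact absurd h5 (not_lt.2 h6)

theorem Follows.unique {vert : H → V} {R S S' : Finset H} {F : H → H}
    (hF : Function.Involutive F) (hS : IsPattern vert R S) (hS' : IsPattern vert R S')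
    (h : Follows vert R S F) (h' : Follows vert R S' F) : S = S' :=
  Finset.Subset.antisymm (h'.subset hF hS' hS h) (h.subset hF hS hS' h')

variable [DecidableEq H] [Fintype H] [DecidableEq V]

open Classical in
/-- The half-edges which are alone in the pattern. -/
noncomputable def aloneSet (vert : H → V) (S : Finset H) : Finset H := S.filter (Alone vert S)

open Classical in
/-- The half-edges of the pattern which are not alone. -/
noncomputable def crowdSet (vert : H → V) (S : Finset H) : Finset H :=
  S.filter fun x => ¬ Alone vert S x

theorem factorial_mul_doubleFactorial_le {vert : H → V} {R S : Finset H}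
    (hR : ∀ x ∈ R, ∀ y, vert x = vert y → x = y) {M : ℕ} (hM : M + M * M ≤ R.card)
    (hS : IsPattern vert R S) {N t j h : ℕ}
    (hO : (aloneSet vert S).card = N) (hZ : ((Finset.univ \ R) \ S).card = N)
    (hz : ∃ z, z ∉ R ∧ z ∉ S ∧ ∃ x ∈ crowdSet vert S, vert x = vert z)
    (hdeg : ∀ x ∈ crowdSet vert S, (Finset.univ.filter fun y => vert y = vert x).card ≤ M)
    (hW : ((crowdSet vert S).image vert).card = t + 1)
    (hC : (crowdSet vert S).card = R.card + 2 * j + 2 * t)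
    (h0 : 0 < h) (hh : (crowdSet vert S).card ≤ h) :
    N.factorial * Nat.doubleFactorial (crowdSet vert S).card ≤
      numExt (fun F => (IsMatching F ∧ SimpleMatching vert F ∧ (∀ x ∈ R, F x ∉ R) ∧
        ∀ u v, (∃ x, x ∉ R ∧ vert x = u) → (∃ x, x ∉ R ∧ vert x = v) → Joined vert F u v) ∧
        Follows vert R S F) id * ((t + 1) * h ^ R.card * N) := by
  classical
  set O := aloneSet vert S with hOdef
  set C := crowdSet vert S with hCdef
  set Z := (Finset.univ \ R) \ S with hZdef
  have memO : ∀ x, x ∈ O ↔ Alone vert S x := fun x => by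
    simp only [hOdef, aloneSet, Finset.mem_filter, and_iff_right_iff_imp]; exact fun h => h.1
  have memC : ∀ x, x ∈ C ↔ x ∈ S ∧ ¬ Alone vert S x := fun x => by
    simp only [hCdef, crowdSet, Finset.mem_filter]
  have memZ : ∀ x, x ∈ Z ↔ x ∉ R ∧ x ∉ S := fun x => by simp [hZdef]
  have hOZ : Disjoint O Z :=
    Finset.disjoint_left.2 fun x hx hx' => ((memZ x).1 hx').2 ((memO x).1 hx).1
  have hOinj : ∀ x ∈ O, ∀ y ∈ O, vert x = vert y → x = y := fun x hx y hy hv =>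
    ((memO y).1 hy).2 x ((memO x).1 hx).1 hv
  set U : V → Prop := fun v => ∃ x, x ∉ R ∧ vert x = v with hU
  set W : V → Prop := fun v => ∃ x ∈ C, vert x = v with hWdef
  have hOW : ∀ x ∈ O, ¬ W (vert x) := by
    rintro x hx ⟨y, hy, hv⟩
    have := ((memO x).1 hx).2 y ((memC y).1 hy).1 hv
    subst this
    exact ((memC y).1 hy).2 ((memO y).1 hx)
  have hUW : ∀ v, U v → W v ∨ ∃ x ∈ O, vert x = v := by
    rintro v ⟨x, hx, rfl⟩
    obtain ⟨y, hy, hv⟩ := hS.2 x hx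
    by_cases ha : Alone vert S y
    · exact Or.inr ⟨y, (memO y).2 ha, hv⟩
    · exact Or.inl ⟨y, (memC y).2 ⟨hy, ha⟩, hv⟩
  have hZU : ∀ x ∈ Z, U (vert x) := fun x hx => ⟨x, ((memZ x).1 hx).1, rfl⟩
  set m := (t + 1) * h ^ R.card with hm
  have hm0 : 0 < m := by positivity
  set c := Nat.doubleFactorial C.card with hc
  set b := (c + m - 1) / m with hbdef
  set P : (H → H) → Prop := fun F =>
    (IsMatching F ∧ SimpleMatching vert F ∧ (∀ x ∈ R, F x ∉ R) ∧
        ∀ u v, U u → U v → Joined vert F u v) ∧ Follows vert R S F with hP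
  have hcb : c ≤ b * m := by
    have := Nat.lt_div_mul_add (a := c + m - 1) hm0
    rw [← hbdef] at this
    generalize b * m = q at *
    omega
  have hend : ∀ f ρ r, IsForest vert O Z U W f ρ r → (∀ x ∈ O, f x ≠ x) → (∀ x ∈ Z, f x ≠ x) →
      b ≤ numExt P f := by
    intro f ρ r hf hfO hfZ
    have hfree : ∀ x, f x = x ↔ x ∈ R ∨ x ∈ C := by
      intro x
      constructor
      · intro hx
        by_contra! hcon
        by_cases hxS : x ∈ S
        · refine hfO x ?_ hx
          rw [memO]
          by_contra ha
          exact hcon.2 ((memC x).2 ⟨hxS, ha⟩)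
        · exact hfZ x ((memZ x).2 ⟨hcon.1, hxS⟩) hx
      · intro hx
        by_contra hne
        have h1 : x ∈ Z ∨ x ∈ O := (hf.cross x hne).imp And.left And.left
        rcases hx with hx | hx <;> rcases h1 with h1 | h1
        · exact ((memZ x).1 h1).1 hx
        · exact hS.1 x ((memO x).1 h1).1 hx
        · exact ((memZ x).1 h1).2 ((memC x).1 hx).1
        · exact ((memC x).1 hx).2 ((memO x).1 h1)
    have hfR : free f \ R = C := by
      ext x
      rw [Finset.mem_sdiff, mem_free, hfree]
      constructor
      · rintro ⟨h1 | h1, h2⟩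
        · exact absurd h1 h2
        · exact h1
      · exact fun hx => ⟨Or.inr hx, hS.1 x ((memC x).1 hx).1⟩
    have hrZ : ∀ x ∈ Z, f x ∈ O ∧ r (vert x) < r (vert (f x)) := by
      intro x hx
      have h1 : f x ∈ O := by
        rcases hf.cross x (hfZ x hx) with h1 | h1
        · exact h1.2
        · exact absurd hx (Finset.disjoint_left.1 hOZ h1.1)
      have := hf.rank_lt _ h1 (hfO _ h1)
      rw [hf.involutive x] at this
      exact ⟨h1, this⟩
    have hOZf : ∀ x ∈ O, f x ∈ Z := by
      intro x hx
      rcases hf.cross x (hfO x hx) with h1 | h1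
      · exact absurd h1.1 (Finset.disjoint_left.1 hOZ hx)
      · exact h1.2
    have hnonfree : ∀ x, f x ≠ x → x ∈ O ∨ x ∈ Z := fun x hx =>
      (hf.cross x hx).symm.imp And.left And.left
    have hsimple : SimpleMatching vert f := by
      constructor
      · intro x hx e
        rcases hnonfree x hx with h1 | h1
        · exact (hf.rank_lt x h1 hx).ne (by rw [e])
        · exact (hrZ x h1).2.ne (by rw [e])
      · intro x y hx hy hv hfv
        rcases hnonfree x hx with h1 | h1 <;> rcases hnonfree y hy with h2 | h2
        · exact hOinj x h1 y h2 hv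
        · have h3 := hf.rank_lt x h1 hx
          have h4 := (hrZ y h2).2
          rw [hv, hfv] at h3; omega
        · have h3 := hf.rank_lt y h2 hy
          have h4 := (hrZ x h1).2
          rw [hv, hfv] at h4; omega
        · exact hf.involutive.injective
            (hOinj _ (hrZ x h1).1 _ (hrZ y h2).1 hfv)
    have hp2 := doubleFactorial_le_numExt_joined hR hM (j := j) (h := h) (t := t) (U := U)
      (fun x hx => ⟨x, hx, rfl⟩) (κ := ρ) (J := C.image vert) hf.involutive hsimple
      (fun x hx => mem_free.2 ((hfree x).2 (Or.inl hx))) (by rw [hfR]; exact hdeg)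
      hf.root_apply (fun v hv => by
        rcases hf.root_mem v hv with ⟨x, hx, h1⟩ | ⟨x, hx, h1, _⟩
        · exact Finset.mem_image.2 ⟨x, hx, h1⟩
        · exact absurd h1 (hfO x hx))
      (fun u v _ _ e => (hf.joined u).trans (e ▸ (hf.joined v).symm))
      (fun l hl => by
        rw [hfR]
        obtain ⟨x, hx, rfl⟩ := Finset.mem_image.1 hl
        obtain ⟨hxS, hxa⟩ := (memC x).1 hx
        obtain ⟨y, hyS, hyv, hyx⟩ : ∃ y ∈ S, vert y = vert x ∧ y ≠ x := by
          by_contra! hcon; exact hxa ⟨hxS, hcon⟩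
        have hy : y ∈ C := (memC y).2 ⟨hyS, fun ha => hyx (ha.2 x hxS hyv.symm).symm⟩
        rw [← Finset.card_pair hyx]
        refine Finset.card_le_card fun z hz => ?_
        rw [Finset.mem_insert, Finset.mem_singleton] at hz
        have hρ : ρ (vert x) = vert x := hf.root_of_mem _ ⟨x, hx, rfl⟩
        rcases hz with rfl | rfl
        · exact Finset.mem_filter.2 ⟨hy, by rw [hyv, hρ]⟩
        · exact Finset.mem_filter.2 ⟨hx, hρ⟩)
      hW (by rw [hfR]; exact hC) h0 (by rw [hfR]; exact hh)
    rw [hfR, mul_assoc] at hp2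
    have hmono : numExt (fun F => IsMatching F ∧ SimpleMatching vert F ∧ (∀ x ∈ R, F x ∉ R) ∧
        ∀ u v, U u → U v → Joined vert F u v) f ≤ numExt P f := by
      refine numExt_mono fun F hE hF => ⟨hF, ?_, ?_, r, ?_⟩
      · intro x hx hFx
        by_contra hxS
        have hxZ := (memZ x).2 ⟨hx, hxS⟩
        rw [hE x (hfZ x hxZ)] at hFx
        exact hS.1 _ ((memO _).1 (hrZ x hxZ).1).1 hFx
      · intro x hx hFx
        by_cases hxS : x ∈ S
        · simp only [hxS, true_iff]
          by_cases ha : x ∈ O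
          · rw [hE x (hfO x ha)] at hFx ⊢
            have h1 := (memZ _).1 (hOZf x ha)
            obtain ⟨y, hy, hv⟩ := hS.2 _ hFx
            exact ⟨y, hy, hv, fun e => h1.2 (e ▸ hy)⟩
          · have h1 : f (F x) = F x := Extends.free_of_free hf.involutive hF.1.1 hE
              ((hfree x).2 (Or.inr ((memC x).2 ⟨hxS, fun h => ha ((memO x).2 h)⟩)))
            have h2 := (memC _).1 (((hfree _).1 h1).resolve_left hFx)
            by_contra! hcon
            exact h2.2 ⟨h2.1, hcon⟩
        · simp only [hxS, false_iff]
          have hxZ := (memZ x).2 ⟨hx, hxS⟩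
          rintro ⟨y, hy, hv, hne⟩
          rw [hE x (hfZ x hxZ)] at hv hne
          exact hne (((memO _).1 (hrZ x hxZ).1).2 y hy hv)
      · intro x ha _
        have hx := (memO x).2 ha
        rw [hE x (hfO x hx)]
        exact hf.rank_lt x hx (hfO x hx)
    have h3 : c ≤ numExt P f * m := hp2.trans (Nat.mul_le_mul_right _ hmono)
    rw [hbdef, Nat.div_le_iff_le_mul hm0]
    omega
  obtain ⟨z, hzR, hzS, hzW⟩ := hz
  have hzZ : z ∈ Z := (memZ z).2 ⟨hzR, hzS⟩
  have hN : 0 < N := by rw [← hZ]; exact Finset.card_pos.2 ⟨z, hzZ⟩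
  have key := factorial_mul_le_numExt hOZ hOinj hOW hZU hend (isForest_id hUW)
    (k := N) (by simpa using hO) (by simpa using hZ)
    (Or.inr ⟨z, hzZ, rfl, hzW⟩)
  calc N.factorial * c ≤ N.factorial * (b * m) := Nat.mul_le_mul_left _ hcb
    _ = ((N - 1).factorial * b) * (m * N) := by
      rw [← Nat.mul_factorial_pred hN.ne']; ring
    _ ≤ _ := Nat.mul_le_mul_right _ key

open Classical in
/-- The number of matchings of half-edges whose induced multigraph is simple and connected. -/
noncomputable def numConn (vert : H → V) : ℕ :=
  (Finset.univ.filter fun F : H → H =>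
    IsMatching F ∧ SimpleMatching vert F ∧ ∀ u v, Joined vert F u v).card

/-- Different patterns are followed by different matchings. -/
theorem card_mul_le_numConn {vert : H → V} (hvert : Function.Surjective vert) {R : Finset H}
    (𝒮 : Finset (Finset H)) (h𝒮 : ∀ S ∈ 𝒮, IsPattern vert R S) {b : ℕ}
    (hb : ∀ S ∈ 𝒮, b ≤ numExt (fun F => (IsMatching F ∧ SimpleMatching vert F ∧
        (∀ x ∈ R, F x ∉ R) ∧ ∀ u v, (∃ x, x ∉ R ∧ vert x = u) → (∃ x, x ∉ R ∧ vert x = v) →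
        Joined vert F u v) ∧ Follows vert R S F) id) :
    𝒮.card * b ≤ numConn vert := by
  classical
  rw [← smul_eq_mul]
  refine (Finset.card_nsmul_le_sum 𝒮 _ _ hb).trans ?_
  unfold numExt
  rw [← Finset.card_biUnion]
  · refine Finset.card_le_card fun F hF => ?_
    simp only [Finset.mem_biUnion, Finset.mem_filter, Finset.mem_univ, true_and] at hF ⊢
    obtain ⟨S, hS, ⟨⟨h1, h2, h3, h4⟩, h5⟩, -⟩ := hF
    refine ⟨h1, h2, ?_⟩
    have key : ∀ x, ∃ y, y ∉ R ∧ Joined vert F (vert x) (vert y) := by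
      intro x
      by_cases hx : x ∈ R
      · exact ⟨F x, h3 x hx, joined_apply _ _ _⟩
      · exact ⟨x, hx, Joined.refl _ _ _⟩
    intro u v
    obtain ⟨x, rfl⟩ := hvert u
    obtain ⟨y, rfl⟩ := hvert v
    obtain ⟨x', hx', hxx'⟩ := key x
    obtain ⟨y', hy', hyy'⟩ := key y
    exact (hxx'.trans (h4 _ _ ⟨x', hx', rfl⟩ ⟨y', hy', rfl⟩)).trans hyy'.symm
  · intro S hS S' hS' hne
    refine Finset.disjoint_left.2 fun F hF hF' => ?_
    simp only [Finset.mem_filter, Finset.mem_univ, true_and] at hF hF'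
    exact hne (hF.1.2.unique hF.1.1.1.1 (h𝒮 S hS) (h𝒮 S' hS') hF'.1.2)

end Patterns

section Graphs

variable {H V : Type*}

/-- The graph on the vertices induced by a matching of the half-edges. -/
def graphOf (vert : H → V) (F : H → H) : SimpleGraph V :=
  SimpleGraph.fromRel fun u v => ∃ x, vert x = u ∧ vert (F x) = v

theorem graphOf_adj {vert : H → V} {F : H → H} (hF : IsMatching F) (hs : SimpleMatching vert F)
    {u v : V} : (graphOf vert F).Adj u v ↔ ∃ x, vert x = u ∧ vert (F x) = v := by
  rw [graphOf, SimpleGraph.fromRel_adj]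
  constructor
  · rintro ⟨-, h | ⟨x, h1, h2⟩⟩
    · exact h
    · exact ⟨F x, h2, by rw [hF.1 x, h1]⟩
  · rintro ⟨x, rfl, rfl⟩
    exact ⟨fun e => hs.1 x (hF.2 x) e.symm, Or.inl ⟨x, rfl, rfl⟩⟩

theorem graphOf_connected_iff [Nonempty V] {vert : H → V} {F : H → H} (hF : IsMatching F)
    (hs : SimpleMatching vert F) :
    (graphOf vert F).Connected ↔ ∀ u v, Joined vert F u v := by
  constructor
  · intro h u v
    obtain ⟨w⟩ := h.preconnected u v
    induction w with
    | nil => exact Joined.refl _ _ _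
    | cons hadj _ ih =>
      obtain ⟨x, rfl, rfl⟩ := (graphOf_adj hF hs).1 hadj
      exact (joined_apply _ _ _).trans ih
  · intro h
    refine SimpleGraph.Connected.mk fun u v => ?_
    refine (h u v (fun w => (graphOf vert F).Reachable u w) fun x => ?_).1
      (SimpleGraph.Reachable.refl _)
    have hadj : (graphOf vert F).Adj (vert x) (vert (F x)) := (graphOf_adj hF hs).2 ⟨x, rfl, rfl⟩
    exact ⟨fun h => h.trans hadj.reachable, fun h => h.trans hadj.symm.reachable⟩

end Graphs

section Counting

variable {V : Type*} [Fintype V] [DecidableEq V] (d : V → ℕ)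

open Classical in
theorem card_filter_graphOf_eq (G : SimpleGraph V) (hG : ∀ v, (G.neighborSet v).ncard = d v) :
    (Finset.univ.filter fun F : (Σ v, Fin (d v)) → Σ v, Fin (d v) =>
      (IsMatching F ∧ SimpleMatching Sigma.fst F) ∧ graphOf Sigma.fst F = G).card =
      ∏ v, (d v).factorial := by
  have hcard : Fintype.card (∀ v, Fin (d v) ≃ G.neighborSet v) = ∏ v, (d v).factorial := by
    rw [Fintype.card_pi]
    refine Finset.prod_congr rfl fun v _ => ?_
    have : Fintype.card (Fin (d v)) = Fintype.card (G.neighborSet v) := by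
      rw [Fintype.card_fin, ← Nat.card_eq_fintype_card]
      exact (hG v).symm
    rw [Fintype.card_equiv (Fintype.equivOfCardEq this), Fintype.card_fin]
  rw [← hcard, ← Fintype.card_subtype]
  refine Fintype.card_congr (Equiv.ofBijective (fun F v => Equiv.ofBijective
    (fun i => ⟨(F.1 ⟨v, i⟩).1, ?_⟩) ⟨?_, ?_⟩) ⟨?_, ?_⟩)
  · obtain ⟨F, ⟨hF, hs⟩, rfl⟩ := F
    exact (graphOf_adj hF hs).2 ⟨_, rfl, rfl⟩
  · obtain ⟨F, ⟨hF, hs⟩, rfl⟩ := F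
    intro i j hij
    have := hs.2 ⟨v, i⟩ ⟨v, j⟩ (hF.2 _) (hF.2 _) rfl (congrArg Subtype.val hij)
    simpa using this
  · obtain ⟨F, ⟨hF, hs⟩, rfl⟩ := F
    rintro ⟨w, hw⟩
    obtain ⟨⟨v', i⟩, rfl, h2⟩ := (graphOf_adj hF hs).1 hw
    exact ⟨i, Subtype.ext h2⟩
  · rintro ⟨F, ⟨hF, hs⟩, hFG⟩ ⟨F', ⟨hF', hs'⟩, hFG'⟩ h
    rw [Subtype.mk.injEq]
    have key : ∀ x, (F x).1 = (F' x).1 := by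
      rintro ⟨v, i⟩
      have := congrArg Subtype.val (DFunLike.congr_fun (congrFun h v) i)
      exact this
    funext x
    refine hs'.2 _ _ (hF'.2 _) (hF'.2 _) (key x) ?_
    rw [← key (F x), hF.1 x, hF'.1 x]
  · intro e
    have h1 : ∀ x : Σ v, Fin (d v), ∃ y : Σ v, Fin (d v),
        y.1 = (e x.1 x.2 : V) ∧ (e y.1 y.2 : V) = x.1 := by
      intro x
      have hadj : G.Adj x.1 (e x.1 x.2) := (e x.1 x.2).2
      exact ⟨⟨_, (e _).symm ⟨x.1, hadj.symm⟩⟩, rfl, by simp⟩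
    have h2 : ∀ x y : Σ v, Fin (d v), x.1 = y.1 → (e x.1 x.2 : V) = e y.1 y.2 → x = y := by
      rintro ⟨v, i⟩ ⟨w, j⟩ hvw hij
      obtain rfl : v = w := hvw
      have := (e v).injective (Subtype.ext hij)
      exact congrArg _ this
    choose F hF1 hF2 using h1
    have hinv : Function.Involutive F := fun x => h2 _ _ (by rw [hF1, hF2])
      (by rw [hF2, hF1])
    have hne : ∀ x, (F x).1 ≠ x.1 := fun x => by
      rw [hF1]
      exact (G.ne_of_adj (e x.1 x.2).2).symm
    have hM : IsMatching F := ⟨hinv, fun x h => hne x (by rw [h])⟩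
    have hS : SimpleMatching Sigma.fst F := by
      refine ⟨fun x _ => hne x, fun x y _ _ hv hfv => h2 x y hv ?_⟩
      rw [← hF1, ← hF1, hfv]
    refine ⟨⟨F, ⟨hM, hS⟩, ?_⟩, ?_⟩
    · ext u v
      rw [graphOf_adj hM hS]
      constructor
      · rintro ⟨x, rfl, rfl⟩
        rw [hF1]; exact (e x.1 x.2).2
      · intro h
        refine ⟨⟨u, (e u).symm ⟨v, h⟩⟩, rfl, ?_⟩
        rw [hF1]; simp
    · funext v
      refine Equiv.ext fun i => Subtype.ext ?_
      exact hF1 ⟨v, i⟩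

open Classical in
theorem ncard_neighborSet_graphOf {F : (Σ v, Fin (d v)) → Σ v, Fin (d v)} (hF : IsMatching F)
    (hs : SimpleMatching Sigma.fst F) (v : V) :
    ((graphOf Sigma.fst F).neighborSet v).ncard = d v := by
  have : (graphOf Sigma.fst F).neighborSet v =
      (Finset.univ.image fun i : Fin (d v) => (F ⟨v, i⟩).1 : Finset V) := by
    ext w
    rw [SimpleGraph.mem_neighborSet, graphOf_adj hF hs]
    simp only [Finset.coe_image, Finset.coe_univ, Set.image_univ, Set.mem_range]
    constructor
    · rintro ⟨⟨v', i⟩, rfl, h⟩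
      exact ⟨i, h⟩
    · rintro ⟨i, h⟩
      exact ⟨⟨v, i⟩, rfl, h⟩
  rw [this, Set.ncard_coe_finset, Finset.card_image_of_injective, Finset.card_univ,
    Fintype.card_fin]
  intro i j hij
  have := hs.2 ⟨v, i⟩ ⟨v, j⟩ (hF.2 _) (hF.2 _) rfl hij
  simpa using this

open Classical in
/-- Every graph with degrees `d` arises from `∏ v, (d v)!` simple configurations. -/
theorem card_simpleMatching_eq (Q : SimpleGraph V → Prop) :
    (Finset.univ.filter fun F : (Σ v, Fin (d v)) → Σ v, Fin (d v) =>
      (IsMatching F ∧ SimpleMatching Sigma.fst F) ∧ Q (graphOf Sigma.fst F)).card =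
      {G : SimpleGraph V | (∀ v, (G.neighborSet v).ncard = d v) ∧ Q G}.ncard *
        ∏ v, (d v).factorial := by
  rw [Set.ncard_eq_toFinset_card' ]
  rw [Finset.card_eq_sum_card_fiberwise (f := graphOf Sigma.fst)
    (t := {G : SimpleGraph V | (∀ v, (G.neighborSet v).ncard = d v) ∧ Q G}.toFinset)]
  · rw [← smul_eq_mul, ← Finset.sum_const]
    refine Finset.sum_congr rfl fun G hG => ?_
    rw [Set.mem_toFinset] at hG
    rw [← card_filter_graphOf_eq d G hG.1, Finset.filter_filter]
    congr 1
    ext F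
    simp only [Finset.mem_filter, Finset.mem_univ, true_and]
    constructor
    · exact fun h => ⟨h.1.1, h.2⟩
    · rintro ⟨h, rfl⟩
      exact ⟨⟨h, hG.2⟩, rfl⟩
  · intro F hF
    simp only [Finset.coe_filter, Finset.mem_univ, true_and, Set.mem_ofPred_eq] at hF
    simp only [Set.coe_toFinset, Set.mem_ofPred_eq]
    exact ⟨ncard_neighborSet_graphOf d hF.1.1 hF.1.2, hF.2⟩

theorem numConn_eq [Nonempty V] : numConn (Sigma.fst : (Σ v, Fin (d v)) → V) =
    {G : SimpleGraph V | (∀ v, (G.neighborSet v).ncard = d v) ∧ G.Connected}.ncard *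
      ∏ v, (d v).factorial := by
  classical
  rw [← card_simpleMatching_eq, numConn]
  congr 1
  ext F
  simp only [Finset.mem_filter, Finset.mem_univ, true_and]
  constructor
  · rintro ⟨h1, h2, h3⟩
    exact ⟨⟨h1, h2⟩, (graphOf_connected_iff h1 h2).2 h3⟩
  · rintro ⟨⟨h1, h2⟩, h3⟩
    exact ⟨h1, h2, (graphOf_connected_iff h1 h2).1 h3⟩

open Classical in
/-- The number of simple matchings. -/
noncomputable def numSimple {H V : Type*} [Fintype H] (vert : H → V) : ℕ :=
  (Finset.univ.filter fun F : H → H => IsMatching F ∧ SimpleMatching vert F).card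

theorem numSimple_eq : numSimple (Sigma.fst : (Σ v, Fin (d v)) → V) =
    {G : SimpleGraph V | ∀ v, (G.neighborSet v).ncard = d v}.ncard *
      ∏ v, (d v).factorial := by
  classical
  have := card_simpleMatching_eq d (fun _ => True)
  simp only [and_true] at this
  rw [← this]
  unfold numSimple
  convert rfl

end Counting

section UpperBound

theorem card_perm_preserving {α ι : Type*} [Fintype α] [DecidableEq α] [DecidableEq ι] (f : α → ι)
    (T : Finset ι) (hT : ∀ a, f a ∈ T) :
    (Finset.univ.filter fun σ : Equiv.Perm α => ∀ a, f (σ a) = f a).card =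
      ∏ i ∈ T, ((Finset.univ.filter fun a => f a = i).card).factorial := by
  have h1 : (Finset.univ.filter fun σ : Equiv.Perm α => ∀ a, f (σ a) = f a).card =
      Fintype.card {σ : Equiv.Perm α // f ∘ σ = f} := by
    rw [Fintype.card_subtype]
    congr 1
    ext σ
    simp [funext_iff]
  rw [h1, DomMulAct.stabilizer_card']
  have h2 : ∏ i ∈ Finset.univ.image f, (Fintype.card {a // f a = i}).factorial =
      ∏ i ∈ Finset.univ.image f, ((Finset.univ.filter fun a => f a = i).card).factorial :=
    Finset.prod_congr rfl fun i _ => by rw [Fintype.card_subtype]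
  rw [h2]
  refine Finset.prod_subset (fun i hi => ?_) fun i _ hi => ?_
  · obtain ⟨a, -, rfl⟩ := Finset.mem_image.1 hi
    exact hT a
  · rw [Finset.filter_eq_empty_iff.2, Finset.card_empty, Nat.factorial_zero]
    exact fun a _ h => hi (Finset.mem_image.2 ⟨a, Finset.mem_univ _, h⟩)

variable {V E : Type*} (d : V → ℕ) (e : E → ℕ)

/-- The half-edges of a disjoint union. -/
def sumHalfEdges : (Σ v, Fin (Sum.elim d e v)) ≃ (Σ v, Fin (d v)) ⊕ Σ v, Fin (e v) :=
  Equiv.sumSigmaDistrib fun v => Fin (Sum.elim d e v)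

/-- The action of a degree preserving permutation of the vertices on the half-edges. -/
def permHalfEdges (σ : Equiv.Perm (V ⊕ E)) (hσ : ∀ v, Sum.elim d e (σ v) = Sum.elim d e v) :
    Equiv.Perm (Σ v, Fin (Sum.elim d e v)) :=
  Equiv.sigmaCongr σ fun v => finCongr (hσ v).symm

/-- The disjoint union of two matchings, relabelled by `σ`. -/
def transport (σ : Equiv.Perm (V ⊕ E)) (hσ : ∀ v, Sum.elim d e (σ v) = Sum.elim d e v)
    (f : (Σ v, Fin (d v)) → Σ v, Fin (d v)) (g : (Σ v, Fin (e v)) → Σ v, Fin (e v)) :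
    (Σ v, Fin (Sum.elim d e v)) → Σ v, Fin (Sum.elim d e v) :=
  fun x => permHalfEdges d e σ hσ ((sumHalfEdges d e).symm
    (Sum.map f g (sumHalfEdges d e ((permHalfEdges d e σ hσ).symm x))))

theorem transport_inl (σ : Equiv.Perm (V ⊕ E)) (hσ : ∀ v, Sum.elim d e (σ v) = Sum.elim d e v)
    (f : (Σ v, Fin (d v)) → Σ v, Fin (d v)) (g : (Σ v, Fin (e v)) → Σ v, Fin (e v))
    (x : Σ v, Fin (d v)) :
    transport d e σ hσ f g (permHalfEdges d e σ hσ ((sumHalfEdges d e).symm (Sum.inl x))) =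
      permHalfEdges d e σ hσ ((sumHalfEdges d e).symm (Sum.inl (f x))) := by
  simp [transport]

theorem transport_inr (σ : Equiv.Perm (V ⊕ E)) (hσ : ∀ v, Sum.elim d e (σ v) = Sum.elim d e v)
    (f : (Σ v, Fin (d v)) → Σ v, Fin (d v)) (g : (Σ v, Fin (e v)) → Σ v, Fin (e v))
    (x : Σ v, Fin (e v)) :
    transport d e σ hσ f g (permHalfEdges d e σ hσ ((sumHalfEdges d e).symm (Sum.inr x))) =
      permHalfEdges d e σ hσ ((sumHalfEdges d e).symm (Sum.inr (g x))) := by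
  simp [transport]

theorem fst_inl (σ : Equiv.Perm (V ⊕ E)) (hσ : ∀ v, Sum.elim d e (σ v) = Sum.elim d e v)
    (x : Σ v, Fin (d v)) :
    (permHalfEdges d e σ hσ ((sumHalfEdges d e).symm (Sum.inl x))).1 = σ (Sum.inl x.1) := rfl

theorem fst_inr (σ : Equiv.Perm (V ⊕ E)) (hσ : ∀ v, Sum.elim d e (σ v) = Sum.elim d e v)
    (x : Σ v, Fin (e v)) :
    (permHalfEdges d e σ hσ ((sumHalfEdges d e).symm (Sum.inr x))).1 = σ (Sum.inr x.1) := rfl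

theorem exists_half_edge (σ : Equiv.Perm (V ⊕ E))
    (hσ : ∀ v, Sum.elim d e (σ v) = Sum.elim d e v) (y : Σ v, Fin (Sum.elim d e v)) :
    (∃ x, y = permHalfEdges d e σ hσ ((sumHalfEdges d e).symm (Sum.inl x))) ∨
      ∃ x, y = permHalfEdges d e σ hσ ((sumHalfEdges d e).symm (Sum.inr x)) := by
  rcases h : sumHalfEdges d e ((permHalfEdges d e σ hσ).symm y) with x | x
  · exact Or.inl ⟨x, by rw [← h]; simp⟩
  · exact Or.inr ⟨x, by rw [← h]; simp⟩

theorem isMatching_transport (σ : Equiv.Perm (V ⊕ E))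
    (hσ : ∀ v, Sum.elim d e (σ v) = Sum.elim d e v)
    {f : (Σ v, Fin (d v)) → Σ v, Fin (d v)} {g : (Σ v, Fin (e v)) → Σ v, Fin (e v)}
    (hf : IsMatching f) (hg : IsMatching g) : IsMatching (transport d e σ hσ f g) := by
  constructor
  · intro y
    rcases exists_half_edge d e σ hσ y with ⟨x, rfl⟩ | ⟨x, rfl⟩
    · rw [transport_inl, transport_inl, hf.1]
    · rw [transport_inr, transport_inr, hg.1]
  · intro y
    rcases exists_half_edge d e σ hσ y with ⟨x, rfl⟩ | ⟨x, rfl⟩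
    · rw [transport_inl]; simpa using hf.2 x
    · rw [transport_inr]; simpa using hg.2 x

theorem transport_injective (σ : Equiv.Perm (V ⊕ E))
    (hσ : ∀ v, Sum.elim d e (σ v) = Sum.elim d e v)
    {f f' : (Σ v, Fin (d v)) → Σ v, Fin (d v)} {g g' : (Σ v, Fin (e v)) → Σ v, Fin (e v)}
    (h : transport d e σ hσ f g = transport d e σ hσ f' g') : f = f' ∧ g = g' := by
  constructor
  · funext x
    have := congrFun h (permHalfEdges d e σ hσ ((sumHalfEdges d e).symm (Sum.inl x)))
    rw [transport_inl, transport_inl] at this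
    simpa using this
  · funext x
    have := congrFun h (permHalfEdges d e σ hσ ((sumHalfEdges d e).symm (Sum.inr x)))
    rw [transport_inr, transport_inr] at this
    simpa using this

/-- The component of the image of `V` in the relabelled union is the image of `V`. -/
theorem joined_transport_iff (σ : Equiv.Perm (V ⊕ E))
    (hσ : ∀ v, Sum.elim d e (σ v) = Sum.elim d e v)
    {f : (Σ v, Fin (d v)) → Σ v, Fin (d v)} {g : (Σ v, Fin (e v)) → Σ v, Fin (e v)}
    (hf : ∀ u v, Joined Sigma.fst f u v) (v₀ : V) (w : V ⊕ E) :
    Joined Sigma.fst (transport d e σ hσ f g) (σ (Sum.inl v₀)) w ↔ (σ.symm w).isLeft := by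
  constructor
  · intro h
    have := h (fun u => (σ.symm u).isLeft = true) fun y => ?_
    · exact this.1 (by simp)
    · rcases exists_half_edge d e σ hσ y with ⟨x, rfl⟩ | ⟨x, rfl⟩
      · rw [transport_inl, fst_inl, fst_inl]; simp
      · rw [transport_inr, fst_inr, fst_inr]; simp
  · intro h
    rw [Sum.isLeft_iff] at h
    obtain ⟨v, hv⟩ := h
    obtain rfl : w = σ (Sum.inl v) := by rw [← hv]; simp
    intro c hc
    refine hf v₀ v (fun u => c (σ (Sum.inl u))) fun x => ?_
    have := hc (permHalfEdges d e σ hσ ((sumHalfEdges d e).symm (Sum.inl x)))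
    rwa [transport_inl, fst_inl, fst_inl] at this

open Classical in
theorem card_filter_isMatching {X : Type*} [Fintype X] (c : X → ℕ) (hc : Even (∑ v, c v)) :
    (Finset.univ.filter fun F : (Σ v, Fin (c v)) → Σ v, Fin (c v) => IsMatching F).card =
      Nat.doubleFactorial (∑ v, c v - 1) := by
  have h1 : Fintype.card (Σ v, Fin (c v)) = ∑ v, c v := by simp
  have := ncard_isMatching (H := Σ v, Fin (c v)) (by rwa [h1])
  rw [h1, Set.ncard_eq_toFinset_card'] at this
  rw [← this]
  congr 1
  ext; simp

variable [Fintype V] [DecidableEq V] [Fintype E] [DecidableEq E]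

open Classical in
/-- Upper bound for the number of connected matchings, obtained by planting them as a component of
a matching on a larger vertex set. -/
theorem numConn_mul_le (v₀ : V) {ℓ ℓ' : ℕ} (hℓ : ∑ v, d v = ℓ) (hℓ' : ∑ v, e v = ℓ')
    (hev : Even ℓ) (hev' : Even ℓ') {K : ℕ} (hd : ∀ v, d v < K) (he : ∀ v, e v < K) :
    numConn (Sigma.fst : (Σ v, Fin (d v)) → V) * Nat.doubleFactorial (ℓ' - 1) *
      ∏ k ∈ Finset.range K, ((Finset.univ.filter fun v => d v = k).card +
        (Finset.univ.filter fun v => e v = k).card).factorial ≤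
    (∏ k ∈ Finset.range K, (Finset.univ.filter fun v => d v = k).card.factorial *
        (Finset.univ.filter fun v => e v = k).card.factorial) *
      (Nat.doubleFactorial (ℓ + ℓ' - 1) * (Fintype.card V + Fintype.card E)) := by
  set D := Sum.elim d e with hD
  set Γ := Finset.univ.filter fun σ : Equiv.Perm (V ⊕ E) => ∀ v, D (σ v) = D v with hΓ
  set Γ₀ := Finset.univ.filter fun σ : Equiv.Perm (V ⊕ E) =>
    ∀ v, (D (σ v), (σ v).isLeft) = (D v, v.isLeft) with hΓ₀
  have hcount : ∀ k, (Finset.univ.filter fun v => D v = k).card =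
      (Finset.univ.filter fun v => d v = k).card + (Finset.univ.filter fun v => e v = k).card := by
    intro k
    rw [Finset.card_filter, Fintype.sum_sum_type]
    simp [hD]
  have hcountl : ∀ k, (Finset.univ.filter fun v : V ⊕ E => (D v, v.isLeft) = (k, true)).card =
      (Finset.univ.filter fun v => d v = k).card := by
    intro k
    rw [Finset.card_filter, Fintype.sum_sum_type]
    simp [hD]
  have hcountr : ∀ k, (Finset.univ.filter fun v : V ⊕ E => (D v, v.isLeft) = (k, false)).card =
      (Finset.univ.filter fun v => e v = k).card := by
    intro k
    rw [Finset.card_filter, Fintype.sum_sum_type]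
    simp [hD]
  have hDK : ∀ v, D v < K := by rintro (v | v); exacts [hd v, he v]
  have hΓc : Γ.card = ∏ k ∈ Finset.range K, ((Finset.univ.filter fun v => d v = k).card +
        (Finset.univ.filter fun v => e v = k).card).factorial := by
    rw [hΓ, card_perm_preserving D (Finset.range K) fun v => Finset.mem_range.2 (hDK v)]
    exact Finset.prod_congr rfl fun k _ => by rw [hcount]
  have hΓ₀c : Γ₀.card = ∏ k ∈ Finset.range K, (Finset.univ.filter fun v => d v = k).card.factorial *
        (Finset.univ.filter fun v => e v = k).card.factorial := by
    rw [hΓ₀, card_perm_preserving (fun v : V ⊕ E => (D v, v.isLeft))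
      (Finset.range K ×ˢ Finset.univ) fun v => by
        rw [Finset.mem_product]; exact ⟨Finset.mem_range.2 (hDK v), Finset.mem_univ _⟩]
    rw [Finset.prod_product]
    refine Finset.prod_congr rfl fun k _ => ?_
    rw [Fintype.prod_bool, hcountl, hcountr]
  set A := Finset.univ.filter fun F : (Σ v, Fin (d v)) → Σ v, Fin (d v) =>
    IsMatching F ∧ SimpleMatching Sigma.fst F ∧ ∀ u v, Joined Sigma.fst F u v with hA
  set B := Finset.univ.filter fun F : (Σ v, Fin (e v)) → Σ v, Fin (e v) => IsMatching F with hB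
  set C := Finset.univ.filter fun F : (Σ v, Fin (D v)) → Σ v, Fin (D v) => IsMatching F with hC
  have hnum : numConn (Sigma.fst : (Σ v, Fin (d v)) → V) = A.card := by
    unfold numConn; rw [hA]; convert rfl
  have hBc : B.card = Nat.doubleFactorial (ℓ' - 1) := by
    rw [hB, ← hℓ']; convert card_filter_isMatching e (by rwa [hℓ'])
  have hsum : ∑ v, D v = ℓ + ℓ' := by rw [Fintype.sum_sum_type, ← hℓ, ← hℓ']; rfl
  have hCc : C.card = Nat.doubleFactorial (ℓ + ℓ' - 1) := by
    rw [hC, ← hsum]; convert card_filter_isMatching D (by rw [hsum]; exact hev.add hev')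
  have hΓmem : ∀ {σ}, σ ∈ Γ → ∀ v, D (σ v) = D v := fun h => by simpa [hΓ] using h
  let Φ : (((Σ v, Fin (d v)) → Σ v, Fin (d v)) × ((Σ v, Fin (e v)) → Σ v, Fin (e v))) ×
      Equiv.Perm (V ⊕ E) → ((Σ v, Fin (D v)) → Σ v, Fin (D v)) × (V ⊕ E) :=
    fun T => (if h : ∀ v, D (T.2 v) = D v then transport d e T.2 h T.1.1 T.1.2 else id,
      T.2 (Sum.inl v₀))
  have hΦ : ∀ {f g σ} (h : σ ∈ Γ),
      Φ ((f, g), σ) = (transport d e σ (hΓmem h) f g, σ (Sum.inl v₀)) := by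
    intro f g σ h
    simp only [Φ]
    rw [dif_pos (hΓmem h)]
  have key := Finset.card_le_mul_card_image_of_maps_to (s := (A ×ˢ B) ×ˢ Γ) (t := C ×ˢ Finset.univ)
    (f := Φ) (fun T hT => by
        simp only [Finset.mem_product, hA, hB, Finset.mem_filter, Finset.mem_univ,
          true_and] at hT
        simp only [Finset.mem_product, Finset.mem_univ, and_true, hC, Finset.mem_filter, true_and]
        obtain ⟨⟨f, g⟩, σ⟩ := T
        rw [hΦ hT.2]
        exact isMatching_transport d e _ _ hT.1.1.1 hT.1.2) Γ₀.card (fun b _ => by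
    rcases Finset.eq_empty_or_nonempty (((A ×ˢ B) ×ˢ Γ).filter fun T => Φ T = b)
      with h0 | ⟨⟨⟨f₀, g₀⟩, σ₀⟩, h0⟩
    · rw [h0]; simp
    · simp only [Finset.mem_filter, Finset.mem_product] at h0
      obtain ⟨⟨⟨hf₀, hg₀⟩, hσ₀⟩, hb₀⟩ := h0
      rw [hΦ hσ₀] at hb₀
      refine Finset.card_le_card_of_injOn (fun T => σ₀⁻¹ * T.2) ?_ ?_
      · rintro ⟨⟨f, g⟩, σ⟩ hT
        simp only [Finset.coe_filter, Finset.mem_product, Set.mem_ofPred_eq] at hT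
        obtain ⟨⟨⟨hf, hg⟩, hσ⟩, hb⟩ := hT
        rw [hΦ hσ] at hb
        simp only [hΓ₀, Finset.coe_filter, Finset.mem_univ, true_and, Set.mem_ofPred_eq]
        intro v
        rw [Prod.mk.injEq]
        constructor
        · rw [Equiv.Perm.mul_apply, ← hΓmem hσ₀,
            show σ₀ (σ₀⁻¹ (σ v)) = σ v from σ₀.apply_symm_apply _, hΓmem hσ]
        · have h1 := joined_transport_iff d e σ (hΓmem hσ) (f := f) (g := g)
            (by simp only [hA, Finset.mem_filter] at hf; exact hf.2.2.2) v₀ (σ v)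
          have h2 := joined_transport_iff d e σ₀ (hΓmem hσ₀) (f := f₀) (g := g₀)
            (by simp only [hA, Finset.mem_filter] at hf₀; exact hf₀.2.2.2) v₀ (σ v)
          rw [Prod.ext_iff] at hb hb₀
          simp only at hb hb₀
          rw [hb.1, hb.2] at h1
          rw [hb₀.1, hb₀.2, h1, Equiv.symm_apply_apply] at h2
          rw [Equiv.Perm.mul_apply, Bool.eq_iff_iff, h2]
          rfl
      · rintro ⟨⟨f, g⟩, σ⟩ hT ⟨⟨f', g'⟩, σ'⟩ hT' h
        simp only [Finset.coe_filter, Finset.mem_product, Set.mem_ofPred_eq] at hT hT'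
        obtain rfl : σ = σ' := mul_left_cancel h
        obtain ⟨⟨⟨hf, hg⟩, hσ⟩, hb⟩ := hT
        have hb' := hT'.2
        rw [hΦ hσ] at hb hb'
        rw [← hb'] at hb
        obtain ⟨rfl, rfl⟩ := transport_injective d e σ _ (Prod.ext_iff.1 hb).1
        rfl)
  rw [Finset.card_product, Finset.card_product, Finset.card_product, Finset.card_univ,
    Fintype.card_sum, hΓc, hΓ₀c, hBc, hCc, ← hnum] at key
  exact key

end UpperBound

section SimpleLowerBound

theorem doubleFactorial_add_le (n q : ℕ) :
    Nat.doubleFactorial (n + 2 * q) ≤ Nat.doubleFactorial n * (n + 2 * q) ^ q := by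
  induction q with
  | zero => simp
  | succ q ih =>
    rw [show n + 2 * (q + 1) = n + 2 * q + 2 by ring, Nat.doubleFactorial_add_two, pow_succ]
    calc (n + 2 * q + 2) * Nat.doubleFactorial (n + 2 * q)
        ≤ (n + 2 * q + 2) * (Nat.doubleFactorial n * (n + 2 * q) ^ q) := by gcongr
      _ ≤ (n + 2 * q + 2) * (Nat.doubleFactorial n * (n + 2 * q + 2) ^ q) := by
        exact Nat.mul_le_mul_left _ (Nat.mul_le_mul_left _ (Nat.pow_le_pow_left (by omega) q))
      _ = _ := by ring

variable {H V : Type*} [DecidableEq H] [Fintype H]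

theorem pow_mul_le_numExt {vert : H → V} {B T : Finset H}
    (hBT : ∀ x ∈ B, ∀ y ∈ T, vert x ≠ vert y) (hT : ∀ x ∈ T, ∀ y ∈ T, vert x = vert y → x = y)
    {P : (H → H) → Prop} {b c k : ℕ}
    (hb : ∀ f, Function.Involutive f → SimpleMatching vert f →
      (∀ x, f x ≠ x → (x ∈ B ∧ f x ∈ T) ∨ (x ∈ T ∧ f x ∈ B)) → (∀ x ∈ B, f x ≠ x) →
      b ≤ numExt P f)
    {f : H → H} (hf : Function.Involutive f) (hs : SimpleMatching vert f)
    (hc : ∀ x, f x ≠ x → (x ∈ B ∧ f x ∈ T) ∨ (x ∈ T ∧ f x ∈ B))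
    (hk : (B.filter fun x => f x = x).card = k)
    (hcard : k + c ≤ (T.filter fun x => f x = x).card) :
    c ^ k * b ≤ numExt P f := by
  induction k generalizing f with
  | zero =>
    rw [pow_zero, one_mul]
    refine hb f hf hs hc fun x hx hfx => ?_
    rw [Finset.card_eq_zero] at hk
    exact Finset.notMem_empty x (hk ▸ Finset.mem_filter.2 ⟨hx, hfx⟩)
  | succ k ih =>
    obtain ⟨x, hx⟩ : (B.filter fun x => f x = x).Nonempty := by
      rw [← Finset.card_pos]; omega
    rw [Finset.mem_filter] at hx
    obtain ⟨hxB, hfx⟩ := hx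
    have hYne : ∀ y ∈ T, y ≠ x := fun y hy e => hBT x hxB y hy (by rw [e])
    have := mul_le_numExt (P := P) (b := c ^ k * b) hfx (T.filter fun x => f x = x)
      (fun y hy => by
        rw [Finset.mem_filter] at hy
        exact ⟨hy.2, hYne y hy.1⟩) (fun y hy => by
        rw [Finset.mem_filter] at hy
        obtain ⟨hyT, hfy⟩ := hy
        have hxy : x ≠ y := (hYne y hyT).symm
        refine ih (link_involutive hf hfx hfy) (hs.link hf hfx hfy (hBT x hxB y hyT) ?_) ?_ ?_ ?_
        · intro z hz hzx hzy
          rcases hc z hz with h1 | h1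
          · have := hT _ h1.2 _ hyT hzy
            have h2 : z = y := by rw [← hf z, this, hfy]
            exact hz (this.trans h2.symm)
          · exact hBT x hxB z h1.1 hzx.symm
        · intro z hz
          by_cases h1 : z = x
          · subst h1; rw [link_left]; exact Or.inl ⟨hxB, hyT⟩
          by_cases h2 : z = y
          · subst h2; rw [link_right]; exact Or.inr ⟨hyT, hxB⟩
          · rw [link_of_ne h1 h2] at hz ⊢; exact hc z hz
        · have : (B.filter fun z => link f x y z = z) = (B.filter fun z => f z = z).erase x := by
            ext z
            simp only [Finset.mem_filter, link_free_iff hxy, Finset.mem_erase]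
            constructor
            · tauto
            · rintro ⟨h1, h2, h3⟩
              exact ⟨h2, h3, h1, fun e => hBT z h2 y hyT (by rw [e])⟩
          rw [this, Finset.card_erase_of_mem (by simp [hxB, hfx]), hk]; rfl
        · have : (T.filter fun z => link f x y z = z) = (T.filter fun z => f z = z).erase y := by
            ext z
            simp only [Finset.mem_filter, link_free_iff hxy, Finset.mem_erase]
            constructor
            · tauto
            · rintro ⟨h1, h2, h3⟩
              exact ⟨h2, h3, hYne z h2, h1⟩
          rw [this, Finset.card_erase_of_mem (by simp [hyT, hfy])]
          omega)
    refine le_trans ?_ this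
    rw [pow_succ, mul_comm (c ^ k) c, mul_assoc]
    exact Nat.mul_le_mul_right _ (by omega)

/-- Lower bound for the number of simple matchings. -/
theorem pow_mul_doubleFactorial_le_numSimple [DecidableEq V] {vert : H → V} {R B T : Finset H}
    (hR : ∀ x ∈ R, ∀ y, vert x = vert y → x = y) {M : ℕ} (hM : M + M * M ≤ R.card)
    (hBT : ∀ x ∈ B, ∀ y ∈ T, vert x ≠ vert y) (hT : ∀ x ∈ T, ∀ y ∈ T, vert x = vert y → x = y)
    (hRB : ∀ x ∈ R, x ∉ B) (hRT : ∀ x ∈ R, x ∉ T)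
    (hdeg : ∀ x, x ∉ R → x ∉ B → (Finset.univ.filter fun y => vert y = vert x).card ≤ M)
    {c j : ℕ} (hcard : Fintype.card H = 2 * B.card + 2 * R.card + 2 * j)
    (hc : B.card + c ≤ T.card) :
    c ^ B.card * Nat.doubleFactorial (2 * j) ≤ numSimple vert := by
  classical
  have h1 : numExt (fun F => IsMatching F ∧ SimpleMatching vert F ∧ ∀ x ∈ R, F x ∉ R) id ≤
      numSimple vert := by
    unfold numSimple numExt
    refine Finset.card_le_card_of_injOn id (fun F hF => ?_) Function.injective_id.injOn
    simp only [Finset.coe_filter, Finset.mem_univ, true_and, Set.mem_ofPred_eq, id] at hF ⊢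
    exact ⟨hF.1.1, hF.1.2.1⟩
  refine le_trans ?_ h1
  refine pow_mul_le_numExt hBT hT ?_ (fun _ => rfl) ⟨fun x hx => absurd rfl hx,
    fun x _ hx => absurd rfl hx⟩ (fun x hx => absurd rfl hx) (by simp) (by simpa using hc)
  intro f hf hs hcr hfB
  have hRf : R ⊆ free f := by
    intro x hx
    rw [mem_free]
    by_contra hne
    rcases hcr x hne with h | h
    · exact hRB x hx h.1
    · exact hRT x hx h.1
  refine doubleFactorial_le_numExt_simple hR hM hf hs hRf ?_ ?_
  · intro x hx
    rw [Finset.mem_sdiff, mem_free] at hx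
    exact hdeg x hx.2 fun hxB => hfB x hxB hx.1
  · have h2 : (free f)ᶜ = B ∪ B.image f := by
      ext x
      simp only [Finset.mem_compl, mem_free, Finset.mem_union, Finset.mem_image]
      constructor
      · intro hx
        rcases hcr x hx with h | h
        · exact Or.inl h.1
        · exact Or.inr ⟨f x, h.2, hf x⟩
      · rintro (h | ⟨y, hy, rfl⟩)
        · exact hfB x h
        · rw [hf y]; exact (hfB y hy).symm
    have h3 : (free f)ᶜ.card = 2 * B.card := by
      rw [h2, Finset.card_union_of_disjoint, Finset.card_image_of_injective _ hf.injective]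
      · ring
      · refine Finset.disjoint_left.2 fun x hx hx' => ?_
        obtain ⟨y, hy, rfl⟩ := Finset.mem_image.1 hx'
        rcases hcr y (hfB y hy) with h | h
        · exact hBT _ hx _ h.2 rfl
        · exact hBT _ hy _ h.1 rfl
    have h4 := Finset.card_add_card_compl (free f)
    rw [Finset.card_sdiff_of_subset hRf]
    omega

end SimpleLowerBound

section FactorialAsymptotics
open Filter Topology

theorem le_log_factorial (m : ℕ) : m * Real.log m - m ≤ Real.log (m.factorial : ℝ) := by
  induction m with
  | zero => simp
  | succ m ih =>
    rw [Nat.factorial_succ, Nat.cast_mul, Real.log_mul (by positivity) (by positivity)]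
    rcases Nat.eq_zero_or_pos m with rfl | hm
    · simp
    · have hm' : (0 : ℝ) < m := by exact_mod_cast hm
      have h := Real.log_le_sub_one_of_pos (x := ((m : ℝ) + 1) / m) (by positivity)
      rw [Real.log_div (by positivity) (by positivity)] at h
      have h2 : (m : ℝ) * ((m + 1) / m - 1) = 1 := by field_simp; ring
      have h3 := mul_le_mul_of_nonneg_left h hm'.le
      push_cast
      nlinarith

theorem log_factorial_le (m : ℕ) :
    Real.log (m.factorial : ℝ) ≤ m * Real.log m - m + (Real.log (m + 1) + 1) := by
  have key : ∀ k : ℕ, Real.log ((k + 1).factorial : ℝ) ≤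
      (k + 1) * Real.log (k + 1) - (k + 1) + (Real.log (k + 1) + 1) := by
    intro k
    induction k with
    | zero => simp
    | succ k ih =>
      rw [Nat.factorial_succ, Nat.cast_mul, Real.log_mul (by positivity) (by positivity)]
      have h := Real.one_sub_inv_le_log_of_pos (x := ((k : ℝ) + 2) / (k + 1)) (by positivity)
      rw [Real.log_div (by positivity) (by positivity), inv_div] at h
      have h2 : ((k : ℝ) + 2) * (1 - (k + 1) / (k + 2)) = 1 := by field_simp; ring
      have h3 := mul_le_mul_of_nonneg_left h (by positivity : (0 : ℝ) ≤ (k : ℝ) + 2)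
      push_cast
      rw [show (k : ℝ) + 1 + 1 = k + 2 by ring]
      nlinarith
  rcases m with _ | k
  · simp
  · refine (key k).trans ?_
    push_cast
    have : Real.log ((k : ℝ) + 1) ≤ Real.log (k + 1 + 1) :=
      Real.log_le_log (by positivity) (by linarith)
    linarith

theorem tendsto_log_div {a : ℕ → ℕ} {α : ℝ}
    (ha : Tendsto (fun n => (a n : ℝ) / n) atTop (𝓝 α)) :
    Tendsto (fun n : ℕ => Real.log (a n + 1) / n) atTop (𝓝 0) := by
  have h0 : Tendsto (fun n : ℕ => (n : ℝ)⁻¹) atTop (𝓝 0) := tendsto_inv_atTop_nhds_zero_nat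
  have hlog : Tendsto (fun n : ℕ => Real.log n / n) atTop (𝓝 0) :=
    (Real.isLittleO_log_id_atTop.tendsto_div_nhds_zero).comp tendsto_natCast_atTop_atTop
  have hub : Tendsto (fun n : ℕ => ((a n : ℝ) / n + (n : ℝ)⁻¹) * (n : ℝ)⁻¹ + Real.log n / n) atTop
      (𝓝 0) := by
    simpa using ((ha.add h0).mul h0).add hlog
  refine squeeze_zero' (Eventually.of_forall fun n => ?_) ?_ hub
  · exact div_nonneg (Real.log_nonneg (by linarith [(Nat.cast_nonneg (a n) : (0 : ℝ) ≤ a n)]))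
      (Nat.cast_nonneg n)
  · filter_upwards [eventually_gt_atTop 0] with n hn
    have hn' : (0 : ℝ) < n := by exact_mod_cast hn
    have h := Real.log_le_sub_one_of_pos (x := ((a n : ℝ) + 1) / n) (by positivity)
    rw [Real.log_div (by positivity) (by positivity)] at h
    have h2 : Real.log ((a n : ℝ) + 1) ≤ ((a n : ℝ) / n + (n : ℝ)⁻¹) + Real.log n := by
      rw [add_div, one_div] at h; linarith
    rw [← div_eq_mul_inv, ← add_div]
    gcongr

theorem tendsto_log_factorial {a : ℕ → ℕ} {α : ℝ}
    (ha : Tendsto (fun n => (a n : ℝ) / n) atTop (𝓝 α)) :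
    Tendsto (fun n : ℕ => (Real.log ((a n).factorial : ℝ) - a n * Real.log n) / n) atTop
      (𝓝 (α * Real.log α - α)) := by
  have h1 : Tendsto (fun n : ℕ => (a n : ℝ) / n * Real.log ((a n : ℝ) / n) - (a n : ℝ) / n) atTop
      (𝓝 (α * Real.log α - α)) :=
    ((Real.continuous_mul_log.tendsto α).comp ha).sub ha
  have h2 : Tendsto (fun n : ℕ => (Real.log (a n + 1) + 1) / n) atTop (𝓝 0) := by
    have := (tendsto_log_div ha).add (tendsto_one_div_atTop_nhds_zero_nat (𝕜 := ℝ))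
    simpa [add_div] using this
  have heq : ∀ n : ℕ, 0 < n → (a n : ℝ) / n * Real.log ((a n : ℝ) / n) - (a n : ℝ) / n =
      ((a n * Real.log (a n) - a n) - a n * Real.log n) / n := by
    intro n hn
    have hn' : (0 : ℝ) < n := by exact_mod_cast hn
    rcases Nat.eq_zero_or_pos (a n) with h | h
    · simp [h]
    · have h' : (0 : ℝ) < a n := by exact_mod_cast h
      rw [Real.log_div h'.ne' hn'.ne']
      field_simp
      ring
  refine tendsto_of_tendsto_of_tendsto_of_le_of_le' h1 (by simpa using h1.add h2) ?_ ?_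
  · filter_upwards [eventually_gt_atTop 0] with n hn
    rw [heq n hn]
    have := le_log_factorial (a n)
    gcongr
  · filter_upwards [eventually_gt_atTop 0] with n hn
    rw [heq n hn, ← add_div]
    have := log_factorial_le (a n)
    gcongr
    linarith

theorem tendsto_log_doubleFactorial {a : ℕ → ℕ} {α : ℝ} (hev : ∀ n, Even (a n))
    (ha : Tendsto (fun n => (a n : ℝ) / n) atTop (𝓝 α)) :
    Tendsto (fun n : ℕ =>
        (Real.log (Nat.doubleFactorial (a n - 1) : ℝ) - (a n : ℝ) / 2 * Real.log n) / n) atTop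
      (𝓝 ((α * Real.log α - α) / 2)) := by
  have hα : 0 ≤ α := ge_of_tendsto' ha fun n => by positivity
  have ha2 : Tendsto (fun n => ((a n / 2 : ℕ) : ℝ) / n) atTop (𝓝 (α / 2)) := by
    refine (ha.div_const 2).congr fun n => ?_
    rw [Nat.cast_div_charZero (hev n).two_dvd]
    push_cast; ring
  have h := ((tendsto_log_factorial ha).sub (tendsto_log_factorial ha2)).sub
    (ha2.mul_const (Real.log 2))
  have hlim : α * Real.log α - α - (α / 2 * Real.log (α / 2) - α / 2) - α / 2 * Real.log 2 =
      (α * Real.log α - α) / 2 := by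
    rcases hα.eq_or_lt with rfl | hα
    · simp
    · rw [Real.log_div hα.ne' (by norm_num)]; ring
  rw [hlim] at h
  refine h.congr fun n => ?_
  have hfac : Nat.factorial (a n) =
      Nat.doubleFactorial (a n - 1) * (2 ^ (a n / 2) * Nat.factorial (a n / 2)) := by
    obtain ⟨m, hm⟩ := hev n
    have hm2 : a n / 2 = m := by omega
    rw [hm2, ← Nat.doubleFactorial_two_mul, show 2 * m = a n by omega]
    rcases Nat.eq_zero_or_pos (a n) with h0 | h0
    · simp [h0]
    · obtain ⟨k, hk⟩ : ∃ k, a n = k + 1 := ⟨a n - 1, by omega⟩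
      rw [hk, Nat.factorial_eq_mul_doubleFactorial, Nat.add_sub_cancel, mul_comm]
  have hpos := Nat.doubleFactorial_pos (a n - 1)
  rw [hfac]
  push_cast
  rw [Real.log_mul (by positivity) (by positivity), Real.log_mul (by positivity) (by positivity),
    Real.log_pow, Nat.cast_div_charZero (hev n).two_dvd]
  push_cast
  ring

theorem tendsto_of_forall_approx {F : ℕ → ℝ} {L : ℝ}
    (h : ∀ ε > 0, ∃ (G : ℕ → ℝ) (g : ℝ), Tendsto G atTop (𝓝 g) ∧ |g - L| ≤ ε ∧
      ∀ᶠ n in atTop, |F n - G n| ≤ ε) : Tendsto F atTop (𝓝 L) := by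
  rw [Metric.tendsto_atTop']
  intro ε hε
  obtain ⟨G, g, hG, hg, hF⟩ := h (ε / 4) (by positivity)
  have h1 := (Metric.tendsto_nhds.1 hG) (ε / 4) (by positivity)
  obtain ⟨N, hN⟩ := eventually_atTop.1 (h1.and hF)
  refine ⟨N, fun n hn => ?_⟩
  obtain ⟨h2, h3⟩ := hN n hn.le
  rw [Real.dist_eq] at h2 ⊢
  rw [abs_lt] at h2 ⊢
  rw [abs_le] at h3 hg
  constructor <;> linarith

end FactorialAsymptotics

section DegreeSums
open Filter Topology

/-- A degree sequence with total degree even, limiting degree distribution `p` and convergent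
mean degree, where `p` puts mass on `1` and has mean greater than `2`. -/
structure DegreeLimit (d : (n : ℕ) → Fin n → ℕ) (p : ℕ → ℝ) : Prop where
  pos : ∀ n j, 0 < d n j
  even : ∀ n, Even (∑ j, d n j)
  zero : p 0 = 0
  nonneg : ∀ i, 0 ≤ p i
  sum : HasSum p 1
  tendsto : ∀ i : ℕ, Tendsto (fun n : ℕ =>
    ((Finset.univ.filter fun j => d n j = i).card : ℝ) / n) atTop (𝓝 (p i))
  summable : Summable fun i : ℕ => (i : ℝ) * p i
  tendsto_mean : Tendsto (fun n : ℕ => ((∑ j, d n j : ℕ) : ℝ) / n) atTop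
    (𝓝 (∑' i : ℕ, (i : ℝ) * p i))
  one : 0 < p 1
  two : 2 < ∑' i : ℕ, (i : ℝ) * p i

variable {d : (n : ℕ) → Fin n → ℕ} {p : ℕ → ℝ}

theorem sum_filter_lt_eq (δ : ∀ {n : ℕ}, Fin n → ℕ) (n : ℕ) (h : ℕ → ℝ) (M : ℕ) :
    ∑ v : Fin n with δ v < M, h (δ v) =
      ∑ k ∈ Finset.range M, ((Finset.univ.filter fun j : Fin n => δ j = k).card : ℝ) * h k := by
  rw [← Finset.sum_fiberwise_of_maps_to (s := Finset.univ.filter fun v : Fin n => δ v < M)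
    (t := Finset.range M) (g := δ) (by simp)]
  refine Finset.sum_congr rfl fun k hk => ?_
  rw [Finset.mem_range] at hk
  rw [Finset.filter_filter, Finset.sum_congr rfl (g := fun _ => h k)
    (fun v hv => by rw [(Finset.mem_filter.1 hv).2.2]), Finset.sum_const, nsmul_eq_mul]
  congr 3
  ext v
  simp only [Finset.mem_filter, Finset.mem_univ, true_and]
  exact ⟨fun h => h.2, fun h => ⟨h ▸ hk, h⟩⟩

theorem DegreeLimit.tendsto_sum (D : DegreeLimit d p) {h : ℕ → ℝ} {C : ℝ}
    (hC : ∀ k, |h k| ≤ C * k) :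
    Tendsto (fun n : ℕ => (∑ v, h (d n v)) / n) atTop (𝓝 (∑' k, p k * h k)) := by
  have hC0 : 0 ≤ C := by
    have := (abs_nonneg _).trans (hC 1); simpa using this
  set μ := ∑' i : ℕ, (i : ℝ) * p i with hμ
  have hsum : Summable fun k => p k * h k := by
    refine Summable.of_norm_bounded (g := fun k => C * ((k : ℝ) * p k)) (D.summable.mul_left C)
      fun k => ?_
    rw [Real.norm_eq_abs, abs_mul, abs_of_nonneg (D.nonneg k)]
    calc p k * |h k| ≤ p k * (C * k) := mul_le_mul_of_nonneg_left (hC k) (D.nonneg k)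
      _ = _ := by ring
  refine tendsto_of_forall_approx fun ε hε => ?_
  have t1 : Tendsto (fun M => C * (μ - ∑ k ∈ Finset.range M, (k : ℝ) * p k)) atTop (𝓝 0) := by
    have := (D.summable.hasSum.tendsto_sum_nat.const_sub μ).const_mul C
    simpa [← hμ] using this
  have t2 : Tendsto (fun M => ∑ k ∈ Finset.range M, p k * h k) atTop (𝓝 (∑' k, p k * h k)) :=
    hsum.hasSum.tendsto_sum_nat
  obtain ⟨M, hM1, hM2⟩ := ((t1.eventually (gt_mem_nhds hε)).and
    ((Metric.tendsto_nhds.1 t2) ε hε)).exists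
  refine ⟨fun n => ∑ k ∈ Finset.range M,
    ((Finset.univ.filter fun j => d n j = k).card : ℝ) / n * h k, _,
    tendsto_finsetSum _ fun k _ => (D.tendsto k).mul_const (h k), ?_, ?_⟩
  · rw [← Real.dist_eq]; exact hM2.le
  · have t3 : Tendsto (fun n : ℕ => C * (((∑ j, d n j : ℕ) : ℝ) / n - ∑ k ∈ Finset.range M,
        ((Finset.univ.filter fun j => d n j = k).card : ℝ) / n * k)) atTop
        (𝓝 (C * (μ - ∑ k ∈ Finset.range M, p k * k))) :=
      (D.tendsto_mean.sub (tendsto_finsetSum _ fun k _ => (D.tendsto k).mul_const _)).const_mul C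
    have hlt : C * (μ - ∑ k ∈ Finset.range M, p k * k) < ε := by
      simpa only [mul_comm (p _)] using hM1
    filter_upwards [t3.eventually (gt_mem_nhds hlt)] with n hn
    refine le_trans ?_ hn.le
    have e1 : ∀ g : ℕ → ℝ, ∑ k ∈ Finset.range M,
        ((Finset.univ.filter fun j => d n j = k).card : ℝ) / n * g k =
        (∑ v with d n v < M, g (d n v)) / n := by
      intro g
      have := sum_filter_lt_eq (fun {m} v => d m v) n g M
      rw [this, Finset.sum_div]
      exact Finset.sum_congr rfl fun k _ => by ring
    have e2 : ∀ g : ℕ → ℝ, (∑ v, g (d n v)) / n - (∑ v with d n v < M, g (d n v)) / n =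
        (∑ v with ¬ d n v < M, g (d n v)) / n := by
      intro g
      rw [← sub_div, ← Finset.sum_filter_add_sum_filter_not Finset.univ (fun v => d n v < M)]
      congr 1; ring
    rw [e1, e1, e2, Nat.cast_sum, e2 (fun k => (k : ℝ)), abs_div, Nat.abs_cast, ← mul_div_assoc,
      Finset.mul_sum]
    gcongr
    refine (Finset.abs_sum_le_sum_abs _ _).trans (Finset.sum_le_sum fun v _ => hC _)

end DegreeSums

section FixedPoint
open Filter Topology Set

variable {d : (n : ℕ) → Fin n → ℕ} {p : ℕ → ℝ}

/-- The right-hand side of the fixed-point equation, extended continuously to `[0, 1]`. -/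
noncomputable def fixedPointSeries (p : ℕ → ℝ) (b : ℝ) : ℝ :=
  ∑' k : ℕ, (k : ℝ) * p k * ((1 + b) / ∑ i ∈ Finset.range k, b ^ i)

theorem one_le_geom_sum {b : ℝ} (hb : 0 ≤ b) {k : ℕ} (hk : k ≠ 0) :
    1 ≤ ∑ i ∈ Finset.range k, b ^ i := by
  obtain ⟨m, rfl⟩ := Nat.exists_eq_succ_of_ne_zero hk
  rw [Finset.sum_range_succ', pow_zero]
  exact le_add_of_nonneg_left (Finset.sum_nonneg fun i _ => pow_nonneg hb _)

theorem geom_sum_mul_one_sub (b : ℝ) (k : ℕ) :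
    (∑ i ∈ Finset.range k, b ^ i) * (1 - b) = 1 - b ^ k := by
  have := geom_sum_mul b k
  linarith

theorem norm_fixedPointSeries_term_le (hp : ∀ i, 0 ≤ p i) {b : ℝ} (hb : b ∈ Icc (0 : ℝ) 1)
    (k : ℕ) : ‖(k : ℝ) * p k * ((1 + b) / ∑ i ∈ Finset.range k, b ^ i)‖ ≤ 2 * ((k : ℝ) * p k) := by
  rcases eq_or_ne k 0 with rfl | hk
  · simp
  · have h := one_le_geom_sum hb.1 hk
    have h0 := hb.1
    rw [Real.norm_of_nonneg (mul_nonneg (mul_nonneg (Nat.cast_nonneg k) (hp k)) (by positivity)),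
      mul_comm 2]
    refine mul_le_mul_of_nonneg_left ?_ (mul_nonneg (Nat.cast_nonneg k) (hp k))
    rw [div_le_iff₀ (by positivity)]
    linarith [hb.2]

theorem fixedPointSeries_eq {b : ℝ} (hb : b ∈ Ioo (0 : ℝ) 1) :
    fixedPointSeries p b = (1 - b ^ 2) * ∑' k : ℕ, (k : ℝ) * p k / (1 - b ^ k) := by
  rw [fixedPointSeries, ← tsum_mul_left]
  refine tsum_congr fun k => ?_
  rcases eq_or_ne k 0 with rfl | hk
  · simp
  · have h := one_le_geom_sum hb.1.le hk
    have h1 : 0 < 1 - b := sub_pos.2 hb.2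
    rw [← geom_sum_mul_one_sub b k]
    have h2 : ∑ i ∈ Finset.range k, b ^ i ≠ 0 := by positivity
    field_simp
    ring

theorem continuousOn_fixedPointSeries (D : DegreeLimit d p) :
    ContinuousOn (fixedPointSeries p) (Icc 0 1) := by
  refine continuousOn_tsum (fun k => ?_) (D.summable.mul_left 2)
    fun k b hb => norm_fixedPointSeries_term_le D.nonneg hb k
  rcases eq_or_ne k 0 with rfl | hk
  · simpa using continuousOn_const
  · refine continuousOn_const.mul (ContinuousOn.div (by fun_prop) (by fun_prop) fun b hb => ?_)
    have := one_le_geom_sum hb.1 hk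
    positivity

theorem fixedPointSeries_one (D : DegreeLimit d p) : fixedPointSeries p 1 = 2 := by
  have : fixedPointSeries p 1 = ∑' k, p k * 2 := by
    refine tsum_congr fun k => ?_
    rcases eq_or_ne k 0 with rfl | hk
    · simp [D.zero]
    · have : (k : ℝ) ≠ 0 := by exact_mod_cast hk
      simp
      field_simp
      norm_num
  rw [this, tsum_mul_right, D.sum.tsum_eq, one_mul]

theorem lt_fixedPointSeries (D : DegreeLimit d p) {b : ℝ} (hb0 : 0 < b)
    (hb : b < p 1 / ∑' k : ℕ, (k : ℝ) * p k) :
    ∑' k : ℕ, (k : ℝ) * p k < fixedPointSeries p b := by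
  set μ := ∑' k : ℕ, (k : ℝ) * p k with hμ
  have hμ0 : 0 < μ := by linarith [D.two]
  have hpμ : p 1 ≤ μ := by
    have := D.summable.le_tsum 1 fun k _ => mul_nonneg (Nat.cast_nonneg k) (D.nonneg k)
    simpa using this
  have hb1 : b < 1 := hb.trans_le ((div_le_one hμ0).2 hpμ)
  rw [lt_div_iff₀ hμ0] at hb
  have hs : Summable fun k : ℕ => (k : ℝ) * p k * ((1 + b) / ∑ i ∈ Finset.range k, b ^ i) :=
    Summable.of_norm_bounded (D.summable.mul_left 2)
      fun k => norm_fixedPointSeries_term_le D.nonneg ⟨hb0.le, hb1.le⟩ k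
  have hle : ∀ k : ℕ, (k : ℝ) * p k * (1 - b ^ 2) + (if k = 1 then p 1 * (b + b ^ 2) else 0) ≤
      (k : ℝ) * p k * ((1 + b) / ∑ i ∈ Finset.range k, b ^ i) := by
    intro k
    by_cases h1 : k = 1
    · subst h1; simp; nlinarith
    rw [if_neg h1, add_zero]
    rcases eq_or_ne k 0 with rfl | hk
    · simp
    refine mul_le_mul_of_nonneg_left ?_ (mul_nonneg (Nat.cast_nonneg k) (D.nonneg k))
    have h := one_le_geom_sum hb0.le hk
    rw [le_div_iff₀ (by positivity), show 1 - b ^ 2 = (1 + b) * (1 - b) by ring, mul_assoc,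
      mul_comm (1 - b), geom_sum_mul_one_sub]
    have : 0 ≤ b ^ k := by positivity
    nlinarith
  have hs1 : Summable fun k : ℕ => (k : ℝ) * p k * (1 - b ^ 2) := D.summable.mul_right _
  have hs2 : HasSum (fun k : ℕ => if k = 1 then p 1 * (b + b ^ 2) else 0) (p 1 * (b + b ^ 2)) :=
    hasSum_ite_eq 1 _
  have h3 := (hs1.hasSum.add hs2).tsum_eq ▸ (hs1.add hs2.summable).tsum_le_tsum hle hs
  rw [tsum_mul_right, ← hμ] at h3
  refine lt_of_lt_of_le ?_ h3
  nlinarith [mul_pos hb0 D.one]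

theorem betaOf_spec (D : DegreeLimit d p) : betaOf p ∈ Ioo (0 : ℝ) 1 ∧
    ∑' k : ℕ, (k : ℝ) * p k =
      (1 - betaOf p ^ 2) * ∑' k : ℕ, (k : ℝ) * p k / (1 - betaOf p ^ k) := by
  set μ := ∑' k : ℕ, (k : ℝ) * p k with hμ
  have hμ0 : 0 < μ := by linarith [D.two]
  have hpμ : p 1 ≤ μ := by
    have := D.summable.le_tsum 1 fun k _ => mul_nonneg (Nat.cast_nonneg k) (D.nonneg k)
    simpa using this
  set b₀ := p 1 / μ with hb₀
  have hb₀0 : 0 < b₀ := div_pos D.one hμ0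
  have hb₀1 : b₀ ≤ 1 := (div_le_one hμ0).2 hpμ
  have hset : {β : ℝ | β ∈ Ioo 0 1 ∧
      ∑' k : ℕ, (k : ℝ) * p k = (1 - β ^ 2) * ∑' k : ℕ, (k : ℝ) * p k / (1 - β ^ k)} =
      Icc b₀ 1 ∩ fixedPointSeries p ⁻¹' {μ} := by
    ext b
    simp only [mem_ofPred_eq, mem_inter_iff, mem_preimage, mem_singleton_iff]
    constructor
    · rintro ⟨hb, h⟩
      rw [← fixedPointSeries_eq hb, ← hμ] at h
      refine ⟨⟨?_, hb.2.le⟩, h.symm⟩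
      by_contra hlt
      exact (lt_fixedPointSeries D hb.1 (not_le.1 hlt)).ne h
    · rintro ⟨hb, h⟩
      have hb1 : b ≠ 1 := by
        rintro rfl
        rw [fixedPointSeries_one D] at h
        linarith [D.two]
      have hb' : b ∈ Ioo (0 : ℝ) 1 := ⟨hb₀0.trans_le hb.1, lt_of_le_of_ne hb.2 hb1⟩
      exact ⟨hb', by rw [← fixedPointSeries_eq hb', h]⟩
  have hcl : IsClosed (Icc b₀ 1 ∩ fixedPointSeries p ⁻¹' {μ}) :=
    ((continuousOn_fixedPointSeries D).mono
      (Icc_subset_Icc_left hb₀0.le)).preimage_isClosed_of_isClosed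
      isClosed_Icc isClosed_singleton
  have hne : (Icc b₀ 1 ∩ fixedPointSeries p ⁻¹' {μ}).Nonempty := by
    rw [← hset]
    have hc : ContinuousOn (fixedPointSeries p) (Icc (b₀ / 2) 1) :=
      (continuousOn_fixedPointSeries D).mono (Icc_subset_Icc_left (by positivity))
    have h1 := lt_fixedPointSeries D (half_pos hb₀0) (half_lt_self hb₀0)
    have h2 : fixedPointSeries p 1 < μ := by rw [fixedPointSeries_one D]; exact D.two
    obtain ⟨b, hb, hbμ⟩ := intermediate_value_Ioo' (by linarith) hc ⟨h2, h1⟩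
    have hb' : b ∈ Ioo (0 : ℝ) 1 := ⟨(half_pos hb₀0).trans hb.1, hb.2⟩
    exact ⟨b, hb', by rw [← fixedPointSeries_eq hb', hbμ]⟩
  have hmem := hcl.csInf_mem hne ⟨b₀, fun b hb => hb.1.1⟩
  rw [← hset] at hmem
  exact hmem

end FixedPoint

section UpperBound
open Filter Topology

theorem numConn_mul_prod_le {V : Type*} [Fintype V] [DecidableEq V] (d : V → ℕ) (v₀ : V)
    (c : ℕ → ℕ) (M : ℕ) (hd : Even (∑ v, d v)) (hc : Even (∑ k ∈ Finset.range M, k * c k)) :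
    numConn (Sigma.fst : (Σ v, Fin (d v)) → V) *
        Nat.doubleFactorial (∑ k ∈ Finset.range M, k * c k - 1) *
        ∏ k ∈ Finset.range M, ((Finset.univ.filter fun v => d v = k).card + c k).factorial ≤
      (∏ k ∈ Finset.range M, (Finset.univ.filter fun v => d v = k).card.factorial *
        (c k).factorial) * (Nat.doubleFactorial (∑ v, d v + ∑ k ∈ Finset.range M, k * c k - 1) *
        (Fintype.card V + ∑ k ∈ Finset.range M, c k)) := by
  classical
  let e : (Σ k : Fin M, Fin (c k)) → ℕ := fun x => x.1
  have he : ∑ x, e x = ∑ k ∈ Finset.range M, k * c k := by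
    rw [Fintype.sum_sigma, ← Fin.sum_univ_eq_sum_range (fun k => k * c k)]
    simp [e, mul_comm]
  have hcard : Fintype.card (Σ k : Fin M, Fin (c k)) = ∑ k ∈ Finset.range M, c k := by
    rw [← Fin.sum_univ_eq_sum_range (fun k => c k)]; simp
  have hcount : ∀ k, (Finset.univ.filter fun x => e x = k).card = if k < M then c k else 0 := by
    intro k
    rw [Finset.card_filter, Fintype.sum_sigma]
    have h : ∀ x : Fin M, (∑ y : Fin (c x), if e ⟨x, y⟩ = k then 1 else 0) =
        if (x : ℕ) = k then c x else 0 := fun x => by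
      simp only [e]
      split_ifs <;> simp
    rw [Finset.sum_congr rfl fun x _ => h x,
      Fin.sum_univ_eq_sum_range (fun i => if i = k then c i else 0), Finset.sum_ite_eq']
    simp
  have hdlt : ∀ v, d v < M + (∑ v, d v + 1) := fun v => by
    have := Finset.single_le_sum (f := d) (fun _ _ => Nat.zero_le _) (Finset.mem_univ v)
    omega
  have helt : ∀ x, e x < M + (∑ v, d v + 1) := fun x => by
    have := x.1.2
    simp only [e]; omega
  have key := numConn_mul_le d e v₀ rfl he hd hc hdlt helt
  rw [Finset.prod_range_add _ M (∑ v, d v + 1), Finset.prod_range_add _ M (∑ v, d v + 1),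
    hcard] at key
  have e1 : ∏ k ∈ Finset.range M, ((Finset.univ.filter fun v => d v = k).card +
      (Finset.univ.filter fun x => e x = k).card).factorial =
      ∏ k ∈ Finset.range M, ((Finset.univ.filter fun v => d v = k).card + c k).factorial :=
    Finset.prod_congr rfl fun k hk => by rw [hcount, if_pos (Finset.mem_range.1 hk)]
  have e2 : ∏ k ∈ Finset.range M, (Finset.univ.filter fun v => d v = k).card.factorial *
      (Finset.univ.filter fun x => e x = k).card.factorial =
      ∏ k ∈ Finset.range M, (Finset.univ.filter fun v => d v = k).card.factorial *
        (c k).factorial :=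
    Finset.prod_congr rfl fun k hk => by rw [hcount, if_pos (Finset.mem_range.1 hk)]
  have e3 : ∀ k, (Finset.univ.filter fun x => e x = M + k).card = 0 := fun k => by
    rw [hcount, if_neg (by omega)]
  simp only [e3, add_zero, Nat.factorial_zero, mul_one] at key
  rw [e1, e2] at key
  have hpos : 0 < ∏ k ∈ Finset.range (∑ v, d v + 1),
      (Finset.univ.filter fun v => d v = M + k).card.factorial :=
    Finset.prod_pos fun _ _ => Nat.factorial_pos _
  refine Nat.le_of_mul_le_mul_right (c := ∏ k ∈ Finset.range (∑ v, d v + 1),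
      (Finset.univ.filter fun v => d v = M + k).card.factorial) ?_ hpos
  calc _ = _ := by rw [mul_assoc]
    _ ≤ _ := key
    _ = _ := by ring

theorem log_numConn_le {V : Type*} [Fintype V] [DecidableEq V] (d : V → ℕ) (v₀ : V)
    (c : ℕ → ℕ) (M : ℕ) (hd : Even (∑ v, d v)) (hc : Even (∑ k ∈ Finset.range M, k * c k))
    (hpos : 0 < numConn (Sigma.fst : (Σ v, Fin (d v)) → V)) :
    Real.log (numConn (Sigma.fst : (Σ v, Fin (d v)) → V)) ≤
      Real.log (Nat.doubleFactorial (∑ v, d v + ∑ k ∈ Finset.range M, k * c k - 1)) -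
        Real.log (Nat.doubleFactorial (∑ k ∈ Finset.range M, k * c k - 1)) -
      ∑ k ∈ Finset.range M,
        (Real.log ((Finset.univ.filter fun v => d v = k).card + c k).factorial -
          Real.log (Finset.univ.filter fun v => d v = k).card.factorial -
          Real.log (c k).factorial) +
      Real.log ((Fintype.card V + ∑ k ∈ Finset.range M, c k : ℕ) + 1) := by
  have h : ((_ : ℕ) : ℝ) ≤ ((_ : ℕ) : ℝ) := Nat.cast_le.2 (numConn_mul_prod_le d v₀ c M hd hc)
  have hV : 0 < Fintype.card V := Fintype.card_pos_iff.2 ⟨v₀⟩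
  have h1 := Nat.doubleFactorial_pos (∑ k ∈ Finset.range M, k * c k - 1)
  have h2 := Nat.doubleFactorial_pos (∑ v, d v + ∑ k ∈ Finset.range M, k * c k - 1)
  have h3 : ∀ k ∈ Finset.range M,
      (((Finset.univ.filter fun v => d v = k).card + c k).factorial : ℝ) ≠ 0 := fun k _ => by
    positivity
  have h4 : ∀ k ∈ Finset.range M,
      ((Finset.univ.filter fun v => d v = k).card.factorial * (c k).factorial : ℝ) ≠ 0 :=
    fun k _ => by positivity
  rw [Nat.cast_mul, Nat.cast_mul, Nat.cast_mul, Nat.cast_prod, Nat.cast_prod, Nat.cast_mul] at h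
  push_cast only [Nat.cast_mul] at h
  have h5 := Real.log_le_log (mul_pos (by positivity) (by positivity)) h
  have hNpos : (0 : ℝ) < (Fintype.card V + ∑ k ∈ Finset.range M, c k : ℕ) := by
    exact_mod_cast (by omega)
  rw [Real.log_mul (by positivity) (Finset.prod_ne_zero_iff.2 h3),
    Real.log_mul (by positivity) (by positivity), Real.log_prod h3,
    Real.log_mul (Finset.prod_ne_zero_iff.2 h4) (by positivity), Real.log_prod h4,
    Real.log_mul (by positivity) hNpos.ne'] at h5
  have h6 : ∑ k ∈ Finset.range M, Real.log
      ((Finset.univ.filter fun v => d v = k).card.factorial * (c k).factorial) =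
      ∑ k ∈ Finset.range M, (Real.log (Finset.univ.filter fun v => d v = k).card.factorial +
        Real.log (c k).factorial) :=
    Finset.sum_congr rfl fun k _ => Real.log_mul (by positivity) (by positivity)
  rw [h6, Finset.sum_add_distrib] at h5
  rw [Finset.sum_sub_distrib, Finset.sum_sub_distrib]
  have h7 := Real.log_le_log hNpos (le_add_of_nonneg_right zero_le_one)
  linarith

end UpperBound

section UpperBoundLimit
open Filter Topology

variable {d : (n : ℕ) → Fin n → ℕ} {p : ℕ → ℝ}

theorem tendsto_two_mul_floor_half {x : ℕ → ℝ} {α : ℝ} (hx : ∀ n, 0 ≤ x n)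
    (h : Tendsto (fun n => x n / n) atTop (𝓝 α)) :
    Tendsto (fun n : ℕ => ((2 * ⌊x n / 2⌋₊ : ℕ) : ℝ) / n) atTop (𝓝 α) := by
  have h0 : Tendsto (fun n : ℕ => x n / n - 2 * (1 / (n : ℝ))) atTop (𝓝 α) := by
    simpa using h.sub ((tendsto_one_div_atTop_nhds_zero_nat (𝕜 := ℝ)).const_mul 2)
  refine tendsto_of_tendsto_of_tendsto_of_le_of_le h0 h (fun n => ?_) fun n => ?_
  · have := Nat.lt_floor_add_one (x n / 2)
    simp only
    rw [mul_one_div, ← sub_div]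
    gcongr
    push_cast
    linarith
  · have := Nat.floor_le (div_nonneg (hx n) (zero_le_two (α := ℝ)))
    simp only
    gcongr
    push_cast
    linarith

theorem mul_log_split {q b : ℝ} (p : ℝ) (hq : 0 ≤ q) (hb : 0 < b) (k : ℕ) (h : q = p / (1 - b ^ k))
    (hk : b ^ k < 1) :
    q * Real.log q - p * Real.log p - p * b ^ k / (1 - b ^ k) *
      Real.log (p * b ^ k / (1 - b ^ k)) =
    -(p * Real.log (1 - b ^ k)) - k * (p * b ^ k / (1 - b ^ k)) * Real.log b := by
  have h1 : 0 < 1 - b ^ k := sub_pos.2 hk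
  rcases eq_or_ne p 0 with rfl | hp
  · subst h; simp
  · have hbk : b ^ k ≠ 0 := by positivity
    rw [h, Real.log_div (mul_ne_zero hp hbk) h1.ne', Real.log_div hp h1.ne',
      Real.log_mul hp hbk, Real.log_pow]
    field_simp
    ring

/-- The extra mass `Σ_{k < M} k p_k b^k / (1 - b^k)` added to the total degree. -/
noncomputable def extraMass (p : ℕ → ℝ) (b : ℝ) (M : ℕ) : ℝ :=
  ∑ k ∈ Finset.range M, (k : ℝ) * (p k * b ^ k / (1 - b ^ k))

theorem DegreeLimit.numConn_le_exp_aux (D : DegreeLimit d p) {b : ℝ} (hb : b ∈ Set.Ioo (0 : ℝ) 1)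
    (M : ℕ) {ε : ℝ} (hε : 0 < ε) {μ : ℝ} (hμ : μ = ∑' k : ℕ, (k : ℝ) * p k) :
    ∀ᶠ n in atTop, (numConn (Sigma.fst : (Σ v, Fin (d n v)) → Fin n) : ℝ) ≤
      Nat.doubleFactorial (∑ v, d n v - 1) * Real.exp (n * (
        ((μ + extraMass p b M) * Real.log (μ + extraMass p b M) -
          extraMass p b M * Real.log (extraMass p b M) - μ * Real.log μ) / 2 +
        ∑ k ∈ Finset.range M, p k * Real.log (1 - b ^ k) + extraMass p b M * Real.log b + ε)) := by
  set ν := extraMass p b M with hν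
  set r : ℕ → ℝ := fun k => b ^ k / (1 - b ^ k) with hr
  have hr0 : ∀ k, 0 ≤ r k := fun k =>
    div_nonneg (pow_nonneg hb.1.le k) (sub_nonneg.2 (pow_le_one₀ hb.1.le hb.2.le))
  set N : ℕ → ℕ → ℕ := fun n k => (Finset.univ.filter fun v => d n v = k).card with hN
  set c : ℕ → ℕ → ℕ := fun n k => 2 * ⌊(N n k * r k) / 2⌋₊ with hc
  have hNt : ∀ k, Tendsto (fun n => (N n k : ℝ) / n) atTop (𝓝 (p k)) := D.tendsto
  have hct : ∀ k, Tendsto (fun n => (c n k : ℝ) / n) atTop (𝓝 (p k * r k)) := fun k =>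
    tendsto_two_mul_floor_half (fun n => mul_nonneg (Nat.cast_nonneg _) (hr0 k))
      (by simpa only [mul_div_right_comm] using (hNt k).mul_const (r k))
  have hadd : ∀ {f g : ℕ → ℕ} {a b : ℝ}, Tendsto (fun n => (f n : ℝ) / n) atTop (𝓝 a) →
      Tendsto (fun n => (g n : ℝ) / n) atTop (𝓝 b) →
      Tendsto (fun n => ((f n + g n : ℕ) : ℝ) / n) atTop (𝓝 (a + b)) := by
    intro f g a b hf hg
    simpa only [Nat.cast_add, add_div] using hf.add hg
  have hℓ := D.tendsto_mean
  rw [← hμ] at hℓ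
  have hℓ' : Tendsto (fun n => ((∑ k ∈ Finset.range M, k * c n k : ℕ) : ℝ) / n) atTop (𝓝 ν) := by
    have : ν = ∑ k ∈ Finset.range M, (k : ℝ) * (p k * r k) :=
      Finset.sum_congr rfl fun k _ => by rw [mul_div_assoc]
    rw [this]
    refine (tendsto_finsetSum _ fun k _ => (hct k).const_mul (k : ℝ)).congr fun n => ?_
    push_cast
    rw [Finset.sum_div]
    exact Finset.sum_congr rfl fun k _ => by ring
  have hE : Tendsto (fun n => ((Fintype.card (Fin n) + ∑ k ∈ Finset.range M, c n k : ℕ) : ℝ) / n)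
      atTop (𝓝 (1 + ∑ k ∈ Finset.range M, p k * r k)) := by
    refine hadd ?_ ?_
    · refine tendsto_const_nhds.congr' ?_
      filter_upwards [eventually_gt_atTop 0] with n hn
      rw [Fintype.card_fin, div_self (by positivity)]
    · refine (tendsto_finsetSum _ fun k _ => hct k).congr fun n => ?_
      push_cast
      rw [Finset.sum_div]
  have hev : ∀ n, Even (∑ k ∈ Finset.range M, k * c n k) := fun n =>
    Finset.even_sum _ fun k _ => (even_two_mul _).mul_left k
  have L1 := tendsto_log_doubleFactorial (fun n => (D.even n).add (hev n)) (hadd hℓ hℓ')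
  have L2 := tendsto_log_doubleFactorial hev hℓ'
  have L3 := tendsto_log_doubleFactorial D.even hℓ
  have L4 : ∀ k, _ := fun k => tendsto_log_factorial (hadd (hNt k) (hct k))
  have L5 : ∀ k, _ := fun k => tendsto_log_factorial (hNt k)
  have L6 : ∀ k, _ := fun k => tendsto_log_factorial (hct k)
  have L7 := tendsto_log_div hE
  have T := (((L1.sub L2).sub L3).sub
    (tendsto_finsetSum (Finset.range M) fun k _ => ((L4 k).sub (L5 k)).sub (L6 k))).add L7
  have hsum : ∑ k ∈ Finset.range M,
      ((p k + p k * r k) * Real.log (p k + p k * r k) - (p k + p k * r k) -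
        (p k * Real.log (p k) - p k) - (p k * r k * Real.log (p k * r k) - p k * r k)) =
      -(∑ k ∈ Finset.range M, p k * Real.log (1 - b ^ k)) - ν * Real.log b := by
    rw [hν, extraMass, Finset.sum_mul, ← Finset.sum_neg_distrib, ← Finset.sum_sub_distrib]
    refine Finset.sum_congr rfl fun k _ => ?_
    rcases eq_or_ne k 0 with rfl | hk
    · simp [D.zero]
    · have hbk : b ^ k < 1 := pow_lt_one₀ hb.1.le hb.2 hk
      have h1 : 0 < 1 - b ^ k := sub_pos.2 hbk
      have := mul_log_split (p k) (div_nonneg (D.nonneg k) h1.le) hb.1 k rfl hbk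
      rw [← this]
      have h2 : p k + p k * r k = p k / (1 - b ^ k) := by
        rw [hr]; field_simp; ring
      rw [h2, show p k * r k = p k * b ^ k / (1 - b ^ k) by rw [hr]; ring]
      have h3 : p k / (1 - b ^ k) - p k - p k * b ^ k / (1 - b ^ k) = 0 := by
        field_simp; ring
      linarith
  rw [hsum] at T
  have hlt : ((μ + ν) * Real.log (μ + ν) - (μ + ν)) / 2 - (ν * Real.log ν - ν) / 2 -
      (μ * Real.log μ - μ) / 2 - (-(∑ k ∈ Finset.range M, p k * Real.log (1 - b ^ k)) -
      ν * Real.log b) + 0 < ((μ + ν) * Real.log (μ + ν) - ν * Real.log ν - μ * Real.log μ) / 2 +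
        ∑ k ∈ Finset.range M, p k * Real.log (1 - b ^ k) + ν * Real.log b + ε := by linarith
  filter_upwards [T.eventually (gt_mem_nhds hlt), eventually_gt_atTop 0] with n hn hn0
  have hn0' : (0 : ℝ) < n := by exact_mod_cast hn0
  rcases Nat.eq_zero_or_pos (numConn (Sigma.fst : (Σ v, Fin (d n v)) → Fin n)) with h0 | h0
  · rw [h0, Nat.cast_zero]; exact mul_nonneg (Nat.cast_nonneg _) (Real.exp_pos _).le
  have hpos := Nat.doubleFactorial_pos (∑ v, d n v - 1)
  rw [← Real.log_le_log_iff (by exact_mod_cast h0) (by positivity),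
    Real.log_mul (by positivity) (Real.exp_pos _).ne', Real.log_exp]
  have key := log_numConn_le (d n) ⟨0, hn0⟩ (c n) M (D.even n) (hev n) h0
  have hn' := mul_lt_mul_of_pos_left hn hn0'
  refine key.trans ?_
  have hid : ∑ k ∈ Finset.range M,
      ((Real.log ((N n k + c n k : ℕ).factorial) - ((N n k + c n k : ℕ) : ℝ) * Real.log n) / n -
        (Real.log ((N n k).factorial) - (N n k : ℝ) * Real.log n) / n -
        (Real.log ((c n k).factorial) - (c n k : ℝ) * Real.log n) / n) =
      (∑ k ∈ Finset.range M, (Real.log (N n k + c n k).factorial -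
          Real.log (N n k).factorial - Real.log (c n k).factorial)) / n := by
    rw [Finset.sum_div]
    refine Finset.sum_congr rfl fun k _ => ?_
    push_cast
    ring
  rw [hid] at hn'
  refine le_trans (le_of_eq ?_) (add_le_add_right hn'.le _)
  push_cast
  field_simp
  ring

theorem summable_mul_div (D : DegreeLimit d p) {b : ℝ} (hb : b ∈ Set.Ioo (0 : ℝ) 1) :
    Summable fun k : ℕ => (k : ℝ) * p k / (1 - b ^ k) := by
  refine Summable.of_norm_bounded (D.summable.mul_right (1 - b)⁻¹) fun k => ?_
  have h0 : 0 ≤ (k : ℝ) * p k := mul_nonneg (Nat.cast_nonneg k) (D.nonneg k)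
  rcases eq_or_ne k 0 with rfl | hk
  · simp
  have h1 : 0 < 1 - b := sub_pos.2 hb.2
  have h2 : b ^ k ≤ b := pow_le_of_le_one hb.1.le hb.2.le hk
  rw [div_eq_mul_inv, Real.norm_of_nonneg
    (mul_nonneg h0 (inv_nonneg.2 (by linarith)))]
  gcongr

theorem summable_mul_log (D : DegreeLimit d p) {b : ℝ} (hb : b ∈ Set.Ioo (0 : ℝ) 1) :
    Summable fun k : ℕ => p k * Real.log (1 - b ^ k) := by
  refine Summable.of_norm_bounded (D.sum.summable.mul_right |Real.log (1 - b)|) fun k => ?_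
  rcases eq_or_ne k 0 with rfl | hk
  · simp [D.zero]
  have h1 : 0 < 1 - b := sub_pos.2 hb.2
  have h2 : b ^ k ≤ b := pow_le_of_le_one hb.1.le hb.2.le hk
  have h3 : 0 < b ^ k := pow_pos hb.1 k
  rw [norm_mul, Real.norm_of_nonneg (D.nonneg k), Real.norm_eq_abs]
  refine mul_le_mul_of_nonneg_left ?_ (D.nonneg k)
  rw [abs_of_nonpos (Real.log_nonpos (by linarith) (by linarith)),
    abs_of_nonpos (Real.log_nonpos (by linarith) (by linarith)), neg_le_neg_iff]
  exact Real.log_le_log h1 (by linarith)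

theorem hasSum_extraMass (D : DegreeLimit d p) {b : ℝ} (hb : b ∈ Set.Ioo (0 : ℝ) 1)
    (h : ∑' k : ℕ, (k : ℝ) * p k = (1 - b ^ 2) * ∑' k : ℕ, (k : ℝ) * p k / (1 - b ^ k)) :
    HasSum (fun k : ℕ => (k : ℝ) * (p k * b ^ k / (1 - b ^ k)))
      ((∑' k : ℕ, (k : ℝ) * p k) * b ^ 2 / (1 - b ^ 2)) := by
  have h1 : 0 < 1 - b ^ 2 := sub_pos.2 (pow_lt_one₀ hb.1.le hb.2 two_ne_zero)
  have h2 := (summable_mul_div D hb).hasSum.sub D.summable.hasSum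
  have h3 : (∑' k : ℕ, (k : ℝ) * p k) * b ^ 2 / (1 - b ^ 2) =
      ∑' k : ℕ, (k : ℝ) * p k / (1 - b ^ k) - ∑' k : ℕ, (k : ℝ) * p k := by
    rw [h]; field_simp; ring
  rw [h3]
  refine h2.congr_fun fun k => ?_
  rcases eq_or_ne k 0 with rfl | hk
  · simp
  have h4 : 1 - b ^ k ≠ 0 := (sub_pos.2 (pow_lt_one₀ hb.1.le hb.2 hk)).ne'
  field_simp
  ring

/-- Upper bound for the number of simple connected matchings. -/
theorem DegreeLimit.numConn_le_exp (D : DegreeLimit d p) {ε : ℝ} (hε : 0 < ε) :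
    ∀ᶠ n in atTop, (numConn (Sigma.fst : (Σ v, Fin (d n v)) → Fin n) : ℝ) ≤
      Nat.doubleFactorial (∑ v, d n v - 1) * Real.exp (n * (-Kof p + ε)) := by
  obtain ⟨hb, hfix⟩ := betaOf_spec D
  set b := betaOf p with hbdef
  set μ := ∑' k : ℕ, (k : ℝ) * p k with hμ
  have hμ0 : 0 < μ := by linarith [D.two]
  set ν := μ * b ^ 2 / (1 - b ^ 2) with hν
  have h1 : 0 < 1 - b ^ 2 := sub_pos.2 (pow_lt_one₀ hb.1.le hb.2 two_ne_zero)
  have hb0 : b ≠ 0 := hb.1.ne'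
  have t1 : Tendsto (extraMass p b) atTop (𝓝 ν) := (hasSum_extraMass D hb hfix).tendsto_sum_nat
  have t2 := (summable_mul_log D hb).hasSum.tendsto_sum_nat
  have φ := Real.continuous_mul_log
  have t3 := ((((φ.tendsto _).comp (t1.const_add μ)).sub ((φ.tendsto _).comp t1)).sub_const
    (μ * Real.log μ)).div_const 2
  have t4 := (t3.add t2).add (t1.mul_const (Real.log b))
  have hval : ((μ + ν) * Real.log (μ + ν) - ν * Real.log ν - μ * Real.log μ) / 2 +
      ∑' k, p k * Real.log (1 - b ^ k) + ν * Real.log b = -Kof p := by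
    have h2 : μ + ν = μ / (1 - b ^ 2) := by rw [hν]; field_simp; ring
    have h3 := mul_log_split μ (q := μ / (1 - b ^ 2)) (by positivity) hb.1 2 rfl (by linarith)
    rw [Kof, h2, ← hbdef, ← hμ]
    rw [← hν] at h3
    push_cast at h3
    linarith
  simp only [Function.comp_apply] at t4
  rw [hval] at t4
  obtain ⟨M, hM⟩ := (t4.eventually (gt_mem_nhds (show -Kof p < -Kof p + ε / 2 by linarith))).exists
  filter_upwards [D.numConn_le_exp_aux hb M (half_pos hε) hμ] with n hn
  refine hn.trans (mul_le_mul_of_nonneg_left (Real.exp_le_exp.2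
    (mul_le_mul_of_nonneg_left ?_ (Nat.cast_nonneg n))) (Nat.cast_nonneg _))
  linarith

end UpperBoundLimit

section SimpleLimit
open Filter Topology

theorem card_filter_sigma {V : Type*} [Fintype V] (d : V → ℕ) (P : (Σ v, Fin (d v)) → Prop)
    [DecidablePred P] : (Finset.univ.filter P).card =
      ∑ v, (Finset.univ.filter fun i : Fin (d v) => P ⟨v, i⟩).card := by
  simp only [Finset.card_filter, Fintype.sum_sigma]

theorem card_filter_fst {V : Type*} [Fintype V] (d : V → ℕ) (P : V → Prop) [DecidablePred P] :
    (Finset.univ.filter fun x : Σ v, Fin (d v) => P x.1).card = ∑ v with P v, d v := by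
  rw [card_filter_sigma, Finset.sum_filter]
  refine Finset.sum_congr rfl fun v _ => ?_
  by_cases h : P v <;> simp [h]

theorem card_filter_fst_eq {V : Type*} [Fintype V] [DecidableEq V] (d : V → ℕ) (w : V) :
    (Finset.univ.filter fun x : Σ v, Fin (d v) => x.1 = w).card = d w := by
  rw [card_filter_fst d fun v => v = w, Finset.filter_eq', if_pos (Finset.mem_univ w),
    Finset.sum_singleton]

theorem card_filter_first {V : Type*} [Fintype V] (d : V → ℕ) (hd : ∀ v, 0 < d v) (P : V → Prop)
    [DecidablePred P] :
    (Finset.univ.filter fun x : Σ v, Fin (d v) => P x.1 ∧ x.2.val = 0).card =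
      (Finset.univ.filter P).card := by
  rw [card_filter_sigma, Finset.card_filter]
  refine Finset.sum_congr rfl fun v _ => ?_
  by_cases h : P v
  · rw [if_pos h, Finset.card_eq_one]
    refine ⟨⟨0, hd v⟩, ?_⟩
    ext i
    simp [h, Fin.ext_iff]
  · simp [h]

theorem sigma_leaf_unique {V : Type*} {d : V → ℕ} {x y : Σ v, Fin (d v)} (hx : d x.1 = 1)
    (h : x.1 = y.1) : x = y := by
  obtain ⟨v, i⟩ := x
  obtain ⟨w, j⟩ := y
  obtain rfl : v = w := h
  have := i.2
  have := j.2
  simp only at hx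
  have : i = j := Fin.ext (by omega)
  rw [this]

theorem doubleFactorial_mul_pow_le_numSimple {V : Type*} [Fintype V] [DecidableEq V] (d : V → ℕ)
    (hd : ∀ v, 0 < d v) (heven : Even (∑ v, d v)) {M k c : ℕ} {R₀ : Finset V}
    (hR₀ : ∀ v ∈ R₀, d v = 1) (hM0 : 0 < M) (hRcard : R₀.card = M + M * M)
    (hk : ∑ v with M < d v, d v = k) (hc : 2 * k + c + 2 * R₀.card ≤ Fintype.card V) :
    Nat.doubleFactorial (∑ v, d v - 1) * c ^ k ≤
      numSimple (Sigma.fst : (Σ v, Fin (d v)) → V) * (∑ v, d v) ^ (k + R₀.card) := by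
  classical
  set R := Finset.univ.filter fun x : Σ v, Fin (d v) => x.1 ∈ R₀ with hR
  set B := Finset.univ.filter fun x : Σ v, Fin (d v) => M < d x.1 with hB
  set T := Finset.univ.filter fun x : Σ v, Fin (d v) =>
    (¬ M < d x.1 ∧ x.1 ∉ R₀) ∧ x.2.val = 0 with hT
  have hRc : R.card = R₀.card := by
    rw [hR, card_filter_fst d fun v => v ∈ R₀]
    simp only [Finset.filter_univ_mem]
    rw [Finset.sum_congr rfl hR₀]; simp
  have hBc : B.card = k := by rw [hB, card_filter_fst d fun v => M < d v, hk]
  have hbig : (Finset.univ.filter fun v => M < d v).card ≤ k := by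
    rw [← hk, Finset.card_eq_sum_ones]
    exact Finset.sum_le_sum fun v _ => hd v
  have hTc : B.card + c ≤ T.card := by
    rw [hT, card_filter_first d hd fun v => ¬ M < d v ∧ v ∉ R₀, hBc]
    have h1 : Finset.univ ⊆ (Finset.univ.filter fun v => M < d v) ∪ R₀ ∪
        Finset.univ.filter (fun v => ¬ M < d v ∧ v ∉ R₀) := by
      intro v _
      simp only [Finset.mem_union, Finset.mem_filter, Finset.mem_univ, true_and]
      tauto
    have h2 := Finset.card_le_card h1
    have h3 := Finset.card_union_le ((Finset.univ.filter fun v => M < d v) ∪ R₀)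
      (Finset.univ.filter (fun v => ¬ M < d v ∧ v ∉ R₀))
    have h4 := Finset.card_union_le (Finset.univ.filter fun v => M < d v) R₀
    rw [Finset.card_univ] at h2
    omega
  have hℓV : Fintype.card V ≤ ∑ v, d v := by
    rw [← Finset.card_univ, Finset.card_eq_sum_ones]
    exact Finset.sum_le_sum fun v _ => hd v
  have hHk : Fintype.card (Σ v, Fin (d v)) = ∑ v, d v := by simp
  obtain ⟨m, hm⟩ := heven
  obtain ⟨j, hj⟩ : ∃ j, ∑ v, d v = 2 * j + 2 * (k + R₀.card) := ⟨m - (k + R₀.card), by omega⟩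
  have key := pow_mul_doubleFactorial_le_numSimple
    (vert := (Sigma.fst : (Σ v, Fin (d v)) → V)) (R := R) (B := B) (T := T)
    (fun x hx y h => sigma_leaf_unique (hR₀ _ (Finset.mem_filter.1 hx).2) h)
    (M := M) (by omega)
    (fun x hx y hy h => (Finset.mem_filter.1 hy).2.1.1 (h ▸ (Finset.mem_filter.1 hx).2))
    (by
      rintro ⟨v, i⟩ hx ⟨w, j⟩ hy h
      obtain rfl : v = w := h
      have : i = j := Fin.ext ((Finset.mem_filter.1 hx).2.2.trans (Finset.mem_filter.1 hy).2.2.symm)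
      rw [this])
    (fun x hx hx' => by
      have h1 := hR₀ _ (Finset.mem_filter.1 hx).2
      have h3 := (Finset.mem_filter.1 hx').2
      omega)
    (fun x hx hx' => (Finset.mem_filter.1 hx').2.1.2 (Finset.mem_filter.1 hx).2)
    (fun x _ hx => by
      rw [card_filter_fst_eq]
      by_contra h
      exact hx (Finset.mem_filter.2 ⟨Finset.mem_univ _, not_le.1 h⟩))
    (c := c) (j := j) (by omega) hTc
  rw [hBc] at key
  calc Nat.doubleFactorial (∑ v, d v - 1) * c ^ k
      ≤ Nat.doubleFactorial (∑ v, d v) * c ^ k :=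
        Nat.mul_le_mul_right _ (doubleFactorial_mono (Nat.sub_le _ _))
    _ ≤ Nat.doubleFactorial (2 * j) * (∑ v, d v) ^ (k + R₀.card) * c ^ k := by
        refine Nat.mul_le_mul_right _ ?_
        rw [hj]; exact doubleFactorial_add_le _ _
    _ = c ^ k * Nat.doubleFactorial (2 * j) * (∑ v, d v) ^ (k + R₀.card) := by ring
    _ ≤ _ := Nat.mul_le_mul_right _ key

variable {d : (n : ℕ) → Fin n → ℕ} {p : ℕ → ℝ}

theorem DegreeLimit.exists_tail (D : DegreeLimit d p) {δ : ℝ} (hδ : 0 < δ) :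
    ∃ M₀ : ℕ, ∀ M ≥ M₀, ∀ᶠ n in atTop, ((∑ v with M < d n v, d n v : ℕ) : ℝ) ≤ δ * n := by
  have h1 : Tendsto (fun M : ℕ => ∑' k : ℕ, (k : ℝ) * p k -
      ∑ k ∈ Finset.range M, (k : ℝ) * p k) atTop (𝓝 0) := by
    simpa using D.summable.hasSum.tendsto_sum_nat.const_sub (∑' k : ℕ, (k : ℝ) * p k)
  obtain ⟨M₀, hM₀⟩ := eventually_atTop.1 (h1.eventually (gt_mem_nhds hδ))
  refine ⟨M₀, fun M hM => ?_⟩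
  have h2 := hM₀ (M + 1) (by omega)
  have h3 := D.tendsto_sum (h := fun k => if M < k then (k : ℝ) else 0) (C := 1) fun k => by
    split_ifs <;> simp
  have h4 : ∑' k, p k * (if M < k then (k : ℝ) else 0) =
      ∑' k : ℕ, (k : ℝ) * p k - ∑ k ∈ Finset.range (M + 1), (k : ℝ) * p k := by
    have hs := D.summable.hasSum.sub
      (hasSum_sum_of_ne_finset_zero (s := Finset.range (M + 1))
        (f := fun k => if k < M + 1 then (k : ℝ) * p k else 0)
        fun k hk => if_neg fun h => hk (Finset.mem_range.2 h))
    rw [Finset.sum_congr rfl (g := fun k : ℕ => (k : ℝ) * p k)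
      fun k hk => if_pos (Finset.mem_range.1 hk)] at hs
    rw [← hs.tsum_eq]
    refine tsum_congr fun k => ?_
    by_cases hk : M < k
    · rw [if_pos hk, if_neg (by omega)]; ring
    · rw [if_neg hk, if_pos (by omega)]; ring
  rw [h4] at h3
  filter_upwards [h3.eventually (gt_mem_nhds h2), eventually_gt_atTop 0] with n hn hn0
  have hn0' : (0 : ℝ) < n := by exact_mod_cast hn0
  rw [div_lt_iff₀ hn0', ← Finset.sum_filter] at hn
  push_cast
  exact hn.le

/-- Almost all matchings, on the exponential scale, are simple. -/
theorem DegreeLimit.exp_le_numSimple (D : DegreeLimit d p) {η : ℝ} (hη : 0 < η) :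
    ∀ᶠ n : ℕ in atTop, (Nat.doubleFactorial (∑ v, d n v - 1) : ℝ) * Real.exp (-(η * n)) ≤
      numSimple (Sigma.fst : (Σ v, Fin (d n v)) → Fin n) := by
  set μ := ∑' i : ℕ, (i : ℝ) * p i with hμ
  set C := μ + 1 with hC
  have hC0 : 3 < C := by linarith [D.two]
  have hlog : 0 < Real.log (8 * C) := Real.log_pos (by linarith)
  set δ := min (1 / 8) (η / (2 * Real.log (8 * C))) with hδ
  have hδ0 : 0 < δ := lt_min (by norm_num) (by positivity)
  obtain ⟨M₀, hM₀⟩ := D.exists_tail hδ0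
  set M := M₀ + 1 with hM
  set Q := M + M * M with hQ
  have h1 := (D.tendsto 1).eventually (lt_mem_nhds (half_lt_self D.one))
  have h2 := (tendsto_const_div_atTop_nhds_zero_nat (Q : ℝ)).eventually
    (gt_mem_nhds (half_pos D.one))
  have h3 := D.tendsto_mean.eventually (gt_mem_nhds (show μ < C by linarith))
  have h4 := ((tendsto_log_div D.tendsto_mean).const_mul (Q : ℝ)).eventually
    (gt_mem_nhds (show (Q : ℝ) * 0 < η / 2 by simpa using half_pos hη))
  filter_upwards [h1, h2, h3, h4, hM₀ M (by omega), eventually_ge_atTop (8 + 8 * Q)]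
    with n h1 h2 h3 h4 h5 hn
  have hn0 : (0 : ℝ) < n := by exact_mod_cast (by omega : 0 < n)
  set ℓ := ∑ v, d n v with hℓ
  set k := ∑ v with M < d n v, d n v with hk
  set c := n / 4 with hc
  obtain ⟨R₀, hR₀, hRc⟩ : ∃ R₀ ⊆ Finset.univ.filter fun v => d n v = 1, R₀.card = Q := by
    refine Finset.exists_subset_card_eq ?_
    have := h2.trans h1
    rw [div_lt_div_iff_of_pos_right hn0] at this
    exact_mod_cast this.le
  have hk8 : (k : ℝ) ≤ n / 8 := h5.trans (by
    rw [div_eq_inv_mul, ← one_div]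
    exact mul_le_mul_of_nonneg_right (min_le_left _ _) hn0.le)
  have hk8' : 8 * k ≤ n := by
    have : (8 * k : ℝ) ≤ n := by linarith
    exact_mod_cast this
  have hc8 : n ≤ 8 * c := by omega
  have hcpos : (0 : ℝ) < c := by exact_mod_cast (by omega : 0 < c)
  have hℓn : n ≤ ℓ := by
    calc n = ∑ v : Fin n, 1 := by simp
      _ ≤ ℓ := Finset.sum_le_sum fun v _ => D.pos n v
  have hℓ0 : (0 : ℝ) < ℓ := by exact_mod_cast (by omega : 0 < ℓ)
  have key := doubleFactorial_mul_pow_le_numSimple (d n) (D.pos n) (D.even n) (M := M) (c := c)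
    (R₀ := R₀) (fun v hv => (Finset.mem_filter.1 (hR₀ hv)).2) (by omega) (by rw [hRc]) rfl
    (by rw [hRc, Fintype.card_fin]; omega)
  rw [hRc] at key
  have key' : (Nat.doubleFactorial (ℓ - 1) : ℝ) * c ^ k ≤
      numSimple (Sigma.fst : (Σ v, Fin (d n v)) → Fin n) * ℓ ^ (k + Q) := by exact_mod_cast key
  have hexp : (ℓ : ℝ) ^ (k + Q) * Real.exp (-(η * n)) ≤ c ^ k := by
    rw [← Real.log_le_log_iff (by positivity) (by positivity),
      Real.log_mul (by positivity) (Real.exp_pos _).ne', Real.log_exp, Real.log_pow, Real.log_pow]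
    push_cast
    have e1 : Real.log ℓ ≤ Real.log (8 * C) + Real.log c := by
      rw [← Real.log_mul (by positivity) (by positivity)]
      refine Real.log_le_log hℓ0 ?_
      rw [div_lt_iff₀ hn0] at h3
      have : (n : ℝ) ≤ 8 * c := by exact_mod_cast hc8
      nlinarith
    have e2 : Real.log ℓ ≤ Real.log (ℓ + 1) := Real.log_le_log hℓ0 (by linarith)
    have e3 : (Q : ℝ) * Real.log (ℓ + 1) ≤ η / 2 * n := by
      rw [← mul_div_assoc, div_lt_iff₀ hn0] at h4; exact h4.le
    have e4 : (k : ℝ) * Real.log (8 * C) ≤ η / 2 * n := by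
      calc (k : ℝ) * Real.log (8 * C) ≤ (η / (2 * Real.log (8 * C)) * n) * Real.log (8 * C) := by
            refine mul_le_mul_of_nonneg_right (h5.trans ?_) hlog.le
            exact mul_le_mul_of_nonneg_right (min_le_right _ _) hn0.le
        _ = η / 2 * n := by field_simp
    have e5 := mul_le_mul_of_nonneg_left e1 (Nat.cast_nonneg (α := ℝ) k)
    have e6 := mul_le_mul_of_nonneg_left e2 (Nat.cast_nonneg (α := ℝ) Q)
    nlinarith
  have hpow : (0 : ℝ) < (ℓ : ℝ) ^ (k + Q) := by positivity
  refine le_of_mul_le_mul_right ?_ hpow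
  calc (Nat.doubleFactorial (ℓ - 1) : ℝ) * Real.exp (-(η * n)) * ℓ ^ (k + Q)
      = Nat.doubleFactorial (ℓ - 1) * (ℓ ^ (k + Q) * Real.exp (-(η * n))) := by ring
    _ ≤ Nat.doubleFactorial (ℓ - 1) * c ^ k :=
        mul_le_mul_of_nonneg_left hexp (Nat.cast_nonneg _)
    _ ≤ _ := key'

end SimpleLimit

section PatternFamily

variable {V : Type*} [Fintype V] {d : V → ℕ}

/-- A selection of half-edges at every vertex, empty exactly on `R₀`, of size `1` at vertices of
degree larger than `M`, full on `X₁`, with `σ` half-edges in total, `N` vertices with exactly one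
selected half-edge. -/
structure IsSelection (R₀ X₁ : Finset V) (M σ N : ℕ) (T : (v : V) → Finset (Fin (d v))) :
    Prop where
  empty_iff : ∀ v, T v = ∅ ↔ v ∈ R₀
  card_big : ∀ v, M < d v → (T v).card = 1
  full : ∀ v ∈ X₁, T v = Finset.univ
  card : ∑ v, (T v).card = σ
  single : (Finset.univ.filter fun v => (T v).card = 1).card = N

variable {R₀ X₁ : Finset V} {M σ N s : ℕ} {T : (v : V) → Finset (Fin (d v))}
  {E : Finset (Σ v, Fin (d v))}

theorem IsSelection.mem_of_mem (hT : IsSelection R₀ X₁ M σ N T)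
    (hE : ∀ x ∈ E, x.1 ∈ X₁ ∧ 2 ≤ x.2.val) {x : Σ v, Fin (d v)} (hx : x ∈ E) : x.2 ∈ T x.1 := by
  rw [hT.full _ (hE x hx).1]; exact Finset.mem_univ _

variable [DecidableEq V]

/-- The pattern consisting of the half-edges selected by `T` and not in `E`. -/
def patternOf (T : (v : V) → Finset (Fin (d v))) (E : Finset (Σ v, Fin (d v))) :
    Finset (Σ v, Fin (d v)) :=
  Finset.univ.filter fun x => x.2 ∈ T x.1 ∧ x ∉ E

/-- The half-edges of the vertices in `R₀`. -/
def halfEdgesOf (d : V → ℕ) (R₀ : Finset V) : Finset (Σ v, Fin (d v)) :=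
  Finset.univ.filter fun x => x.1 ∈ R₀

theorem mem_patternOf {x : Σ v, Fin (d v)} : x ∈ patternOf T E ↔ x.2 ∈ T x.1 ∧ x ∉ E := by
  simp [patternOf]

theorem mem_halfEdgesOf {x : Σ v, Fin (d v)} : x ∈ halfEdgesOf d R₀ ↔ x.1 ∈ R₀ := by
  simp [halfEdgesOf]

theorem IsSelection.alone_iff (hT : IsSelection R₀ X₁ M σ N T) (hX₁ : ∀ v ∈ X₁, 3 ≤ d v)
    (hE : ∀ x ∈ E, x.1 ∈ X₁ ∧ 2 ≤ x.2.val) (x : Σ v, Fin (d v)) :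
    Alone Sigma.fst (patternOf T E) x ↔ x ∈ patternOf T E ∧ (T x.1).card = 1 := by
  obtain ⟨v, i⟩ := x
  constructor
  · rintro ⟨hx, h⟩
    refine ⟨hx, ?_⟩
    by_cases hv : v ∈ X₁
    · exfalso
      have hd := hX₁ v hv
      have h1 : ∀ k : Fin (d v), k.val < 2 → k = i := fun k hk => by
        have := h ⟨v, k⟩ (mem_patternOf.2 ⟨by rw [hT.full v hv]; exact Finset.mem_univ _,
          fun hE' => by have := (hE _ hE').2; simp only at this; omega⟩) rfl
        simpa using this
      have h2 := (h1 ⟨0, by omega⟩ (by norm_num)).trans (h1 ⟨1, by omega⟩ (by norm_num)).symm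
      simp at h2
    · rw [Finset.card_eq_one]
      refine ⟨i, Finset.eq_singleton_iff_unique_mem.2 ⟨(mem_patternOf.1 hx).1, fun k hk => ?_⟩⟩
      have := h ⟨v, k⟩ (mem_patternOf.2 ⟨hk, fun hE' => hv (hE _ hE').1⟩) rfl
      simpa using this
  · rintro ⟨hx, h⟩
    refine ⟨hx, ?_⟩
    rintro ⟨w, k⟩ hy hvw
    obtain rfl : w = v := hvw
    obtain ⟨l, hl⟩ := Finset.card_eq_one.1 h
    have h1 := (mem_patternOf.1 hx).1
    have h2 := (mem_patternOf.1 hy).1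
    simp only at h1 h2 hl
    rw [hl, Finset.mem_singleton] at h1 h2
    rw [h1, h2]

theorem IsSelection.card_patternOf (hT : IsSelection R₀ X₁ M σ N T)
    (hE : ∀ x ∈ E, x.1 ∈ X₁ ∧ 2 ≤ x.2.val) : (patternOf T E).card + E.card = σ := by
  have h1 : patternOf T E = (Finset.univ.filter fun x : Σ v, Fin (d v) => x.2 ∈ T x.1) \ E := by
    ext x; simp [mem_patternOf]
  have h2 : E ⊆ Finset.univ.filter fun x : Σ v, Fin (d v) => x.2 ∈ T x.1 := fun x hx =>
    Finset.mem_filter.2 ⟨Finset.mem_univ _, hT.mem_of_mem hE hx⟩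
  rw [h1, Finset.card_sdiff_add_card_eq_card h2, card_filter_sigma, ← hT.card]
  refine Finset.sum_congr rfl fun v _ => ?_
  congr 1
  ext i
  simp

theorem IsSelection.card_aloneSet (hT : IsSelection R₀ X₁ M σ N T) (hX₁ : ∀ v ∈ X₁, 3 ≤ d v)
    (hE : ∀ x ∈ E, x.1 ∈ X₁ ∧ 2 ≤ x.2.val) : (aloneSet Sigma.fst (patternOf T E)).card = N := by
  have h1 : aloneSet Sigma.fst (patternOf T E) =
      Finset.univ.filter fun x : Σ v, Fin (d v) => x.2 ∈ T x.1 ∧ (T x.1).card = 1 := by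
    ext x
    simp only [aloneSet, Finset.mem_filter, Finset.mem_univ, true_and, hT.alone_iff hX₁ hE,
      mem_patternOf]
    constructor
    · tauto
    · rintro ⟨h1, h2⟩
      have : x ∉ E := fun hx => by
        have h3 := hE x hx
        have := hX₁ _ h3.1
        rw [hT.full _ h3.1, Finset.card_univ, Fintype.card_fin] at h2
        omega
      tauto
  rw [h1, card_filter_sigma, ← hT.single, Finset.card_filter]
  refine Finset.sum_congr rfl fun v _ => ?_
  by_cases h : (T v).card = 1
  · rw [if_pos h, ← h]
    congr 1
    ext x
    simp [h]
  · simp [h]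

theorem IsSelection.card_crowdSet (hT : IsSelection R₀ X₁ M σ N T) (hX₁ : ∀ v ∈ X₁, 3 ≤ d v)
    (hE : ∀ x ∈ E, x.1 ∈ X₁ ∧ 2 ≤ x.2.val) :
    (crowdSet Sigma.fst (patternOf T E)).card + N + E.card = σ := by
  classical
  rw [← hT.card_patternOf hE, ← hT.card_aloneSet hX₁ hE, crowdSet, aloneSet,
    add_comm (Finset.card _),
    Finset.card_filter_add_card_filter_not]

theorem IsSelection.mem_image_crowdSet (hT : IsSelection R₀ X₁ M σ N T)
    (hX₁ : ∀ v ∈ X₁, 3 ≤ d v) (hE : ∀ x ∈ E, x.1 ∈ X₁ ∧ 2 ≤ x.2.val) (v : V) :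
    v ∈ (crowdSet Sigma.fst (patternOf T E)).image Sigma.fst ↔ 2 ≤ (T v).card := by
  simp only [Finset.mem_image, crowdSet, Finset.mem_filter, hT.alone_iff hX₁ hE, mem_patternOf]
  constructor
  · rintro ⟨x, ⟨⟨h1, h2⟩, h3⟩, rfl⟩
    have : 0 < (T x.1).card := Finset.card_pos.2 ⟨_, h1⟩
    by_contra h4
    exact h3 ⟨⟨h1, h2⟩, by omega⟩
  · intro h
    by_cases hv : v ∈ X₁
    · have := hX₁ v hv
      refine ⟨⟨v, ⟨0, by omega⟩⟩, ⟨⟨?_, fun h => ?_⟩, fun h' => ?_⟩, rfl⟩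
      · rw [hT.full v hv]; exact Finset.mem_univ _
      · have := (hE _ h).2; simp at this
      · have := h'.2; simp only at this; omega
    · obtain ⟨i, hi⟩ := Finset.card_pos.1 (show 0 < (T v).card by omega)
      exact ⟨⟨v, i⟩, ⟨⟨hi, fun h => hv (hE _ h).1⟩, fun h' => by
        have := h'.2; simp only at this; omega⟩, rfl⟩

theorem card_mul_factorial_le_numConn {Q : ℕ} (hd : ∀ v, 0 < d v) (hR₀ : ∀ v ∈ R₀, d v = 1)
    (hQ : R₀.card = Q) (hM : M + M * M ≤ Q) (hQe : Even Q) (hℓe : Even (∑ v, d v))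
    (hX₁ : ∀ v ∈ X₁, 3 ≤ d v)
    (hE : ∀ x ∈ E, x.1 ∈ X₁ ∧ 2 ≤ x.2.val) (hE0 : 0 < E.card)
    (hbal : σ + N + Q = ∑ v, d v + E.card) (hℓV : 2 * Fintype.card V ≤ ∑ v, d v)
    {𝒯 : Finset ((v : V) → Finset (Fin (d v)))} (h𝒯 : ∀ T ∈ 𝒯, IsSelection R₀ X₁ M σ N T) :
    𝒯.card * (N.factorial * Nat.doubleFactorial (∑ v, d v - Q - 2 * N)) ≤
      numConn (Sigma.fst : (Σ v, Fin (d v)) → V) *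
        (Fintype.card V * (∑ v, d v) ^ Q * Fintype.card V) := by
  classical
  rcases 𝒯.eq_empty_or_nonempty with rfl | ⟨T₀, hT₀⟩
  · simp
  have hsel₀ := h𝒯 T₀ hT₀
  set ℓ := ∑ v, d v with hℓ
  set R := halfEdgesOf d R₀ with hR
  have hRc : R.card = Q := by
    rw [hR, halfEdgesOf, card_filter_fst d fun v => v ∈ R₀]
    simp only [Finset.filter_univ_mem]
    rw [Finset.sum_congr rfl hR₀]; simpa using hQ
  have hRS : ∀ T ∈ 𝒯, ∀ x ∈ patternOf T E, x ∉ R := fun T hT x hx hxR => by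
    have := ((h𝒯 T hT).empty_iff x.1).2 (mem_halfEdgesOf.1 hxR)
    have h2 := (mem_patternOf.1 hx).1
    rw [this] at h2
    exact Finset.notMem_empty _ h2
  have hcount : ∀ T ∈ 𝒯, ((crowdSet Sigma.fst (patternOf T E)).image Sigma.fst).card + N + Q =
      Fintype.card V := by
    intro T hT
    have hs := h𝒯 T hT
    have e1 : (crowdSet Sigma.fst (patternOf T E)).image Sigma.fst =
        Finset.univ.filter fun v => 2 ≤ (T v).card := by
      ext v; rw [hs.mem_image_crowdSet hX₁ hE]; simp
    have e2 : R₀ = Finset.univ.filter fun v => (T v).card = 0 := by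
      ext v; rw [← hs.empty_iff]; simp
    rw [e1, ← hs.single, ← hQ]
    conv_lhs => rw [e2]
    rw [Finset.card_filter, Finset.card_filter, Finset.card_filter, ← Finset.sum_add_distrib,
      ← Finset.sum_add_distrib, ← Finset.card_univ, Finset.card_eq_sum_ones]
    refine Finset.sum_congr rfl fun v _ => ?_
    split_ifs <;> omega
  have hcrowd : ∀ T ∈ 𝒯, (crowdSet Sigma.fst (patternOf T E)).card = ℓ - Q - 2 * N := by
    intro T hT
    have := (h𝒯 T hT).card_crowdSet hX₁ hE
    omega
  obtain ⟨z, hzE⟩ := Finset.card_pos.1 hE0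
  have hz : ∀ T ∈ 𝒯, ∃ z, z ∉ R ∧ z ∉ patternOf T E ∧
      ∃ x ∈ crowdSet Sigma.fst (patternOf T E), x.1 = z.1 := by
    intro T hT
    have hs := h𝒯 T hT
    refine ⟨z, fun hzR => ?_, fun hzS => (mem_patternOf.1 hzS).2 hzE, ?_⟩
    · have h1 := hX₁ _ (hE z hzE).1
      have h2 := hR₀ _ (mem_halfEdgesOf.1 hzR)
      omega
    · have := (hs.mem_image_crowdSet hX₁ hE z.1).2 (by
        rw [hs.full _ (hE z hzE).1, Finset.card_univ, Fintype.card_fin]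
        have := hX₁ _ (hE z hzE).1
        omega)
      simpa using this
  have hpat : ∀ T ∈ 𝒯, IsPattern Sigma.fst R (patternOf T E) := by
    intro T hT
    have hs := h𝒯 T hT
    refine ⟨hRS T hT, fun x hx => ?_⟩
    by_cases hv : x.1 ∈ X₁
    · have := hX₁ _ hv
      refine ⟨⟨x.1, ⟨0, by omega⟩⟩, mem_patternOf.2 ⟨?_, fun h => ?_⟩, rfl⟩
      · rw [hs.full _ hv]; exact Finset.mem_univ _
      · have := (hE _ h).2; simp at this
    · have h1 : T x.1 ≠ ∅ := fun h => hx (mem_halfEdgesOf.2 ((hs.empty_iff _).1 h))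
      obtain ⟨i, hi⟩ := Finset.nonempty_iff_ne_empty.2 h1
      exact ⟨⟨x.1, i⟩, mem_patternOf.2 ⟨hi, fun h => hv (hE _ h).1⟩, rfl⟩
  have hZ : ∀ T ∈ 𝒯, ((Finset.univ \ R) \ patternOf T E).card = N := by
    intro T hT
    have h1 := (h𝒯 T hT).card_patternOf hE
    have h2 : patternOf T E ⊆ Finset.univ \ R := fun x hx => by
      simpa using hRS T hT x hx
    have h3 := Finset.card_sdiff_add_card_eq_card h2
    have h4 := Finset.card_sdiff_add_card_eq_card (Finset.subset_univ R)
    rw [Finset.card_univ, Fintype.card_sigma] at h4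
    simp only [Fintype.card_fin] at h4
    omega
  have hNpos : 0 < N := by
    obtain ⟨z, h1, h2, _⟩ := hz T₀ hT₀
    rw [← hZ T₀ hT₀]
    exact Finset.card_pos.2 ⟨z, by simp [h1, h2]⟩
  obtain ⟨t, ht⟩ : ∃ t, t + 1 + N + Q = Fintype.card V := by
    have h1 := hcount T₀ hT₀
    obtain ⟨_, _, _, x, hx, _⟩ := hz T₀ hT₀
    have h2 : 0 < ((crowdSet Sigma.fst (patternOf T₀ E)).image Sigma.fst).card :=
      Finset.card_pos.2 ⟨x.1, Finset.mem_image_of_mem _ hx⟩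
    exact ⟨((crowdSet Sigma.fst (patternOf T₀ E)).image Sigma.fst).card - 1, by omega⟩
  have hle : Q + 2 * N ≤ ℓ := by omega
  obtain ⟨j, hj⟩ : ∃ j, ℓ - Q - 2 * N = Q + 2 * j + 2 * t := by
    obtain ⟨a, ha⟩ := hQe
    obtain ⟨b, hb⟩ := hℓe
    exact ⟨b - a - N - a - t, by omega⟩
  have hℓ0 : 0 < ℓ := by omega
  set m := (t + 1) * ℓ ^ Q * N with hm
  have hm0 : 0 < m := by positivity
  set b := (N.factorial * Nat.doubleFactorial (ℓ - Q - 2 * N) + (m - 1)) / m with hb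
  have hcb : N.factorial * Nat.doubleFactorial (ℓ - Q - 2 * N) ≤ b * m := by
    have := Nat.lt_div_mul_add hm0
      (a := N.factorial * Nat.doubleFactorial (ℓ - Q - 2 * N) + (m - 1))
    rw [← hb] at this
    omega
  have hnum : ∀ T ∈ 𝒯, b ≤ numExt (fun F => (IsMatching F ∧ SimpleMatching Sigma.fst F ∧
      (∀ x ∈ R, F x ∉ R) ∧ ∀ u v, (∃ x : Σ v, Fin (d v), x ∉ R ∧ x.1 = u) →
        (∃ x : Σ v, Fin (d v), x ∉ R ∧ x.1 = v) → Joined Sigma.fst F u v) ∧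
      Follows Sigma.fst R (patternOf T E) F) id := by
    intro T hT
    have hs := h𝒯 T hT
    have key := factorial_mul_doubleFactorial_le (vert := Sigma.fst) (R := R)
      (S := patternOf T E) (M := M) (N := N) (t := t) (j := j) (h := ℓ)
      (fun x hx y h => sigma_leaf_unique (hR₀ _ (mem_halfEdgesOf.1 hx)) h) (by rw [hRc]; exact hM)
      (hpat T hT) (hs.card_aloneSet hX₁ hE) (hZ T hT) (hz T hT) (by
        intro x hx
        have h1 := (hs.mem_image_crowdSet hX₁ hE x.1).1 (Finset.mem_image_of_mem _ hx)
        rw [card_filter_fst_eq]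
        by_contra h2
        have := hs.card_big x.1 (by omega)
        omega) (by have := hcount T hT; omega) (by rw [hcrowd T hT, hRc, hj]) hℓ0
      (by rw [hcrowd T hT]; omega)
    rw [hcrowd T hT, hRc, ← hm] at key
    rw [hb, Nat.div_le_iff_le_mul hm0]
    omega
  have hinj : Set.InjOn (fun T => patternOf T E) (𝒯 : Set ((v : V) → Finset (Fin (d v)))) := by
    intro T hT T' hT' h
    have hs := h𝒯 T hT
    have hs' := h𝒯 T' hT'
    funext v
    ext i
    have h1 := Finset.ext_iff.1 h ⟨v, i⟩
    simp only [mem_patternOf] at h1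
    by_cases hx : (⟨v, i⟩ : Σ v, Fin (d v)) ∈ E
    · have h2 := hs.mem_of_mem hE hx
      have h3 := hs'.mem_of_mem hE hx
      simp only at h2 h3
      tauto
    · tauto
  have hmain := card_mul_le_numConn (vert := (Sigma.fst : (Σ v, Fin (d v)) → V)) (R := R)
    (fun v => ⟨⟨v, 0, hd v⟩, rfl⟩) (𝒯.image fun T => patternOf T E) (fun S hS => by
      obtain ⟨T, hT, rfl⟩ := Finset.mem_image.1 hS
      exact hpat T hT) (b := b) (by
      intro S hS
      obtain ⟨T, hT, rfl⟩ := Finset.mem_image.1 hS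
      exact hnum T hT)
  rw [Finset.card_image_of_injOn hinj] at hmain
  calc 𝒯.card * (N.factorial * Nat.doubleFactorial (ℓ - Q - 2 * N)) ≤ 𝒯.card * (b * m) :=
        Nat.mul_le_mul_left _ hcb
    _ = 𝒯.card * b * m := by ring
    _ ≤ numConn (Sigma.fst : (Σ v, Fin (d v)) → V) * m := Nat.mul_le_mul_right _ hmain
    _ ≤ _ := by
        refine Nat.mul_le_mul_left _ ?_
        rw [hm]
        exact Nat.mul_le_mul (Nat.mul_le_mul_right _ (by omega)) (by omega)

end PatternFamily

section Chebyshev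

variable {ι : Type*} [Fintype ι] [DecidableEq ι] {α : ι → Type*} (A : (v : ι) → Finset (α v))
  (w g : (v : ι) → α v → ℝ)

theorem sum_piFinset_prod (hw : ∀ v, ∑ a ∈ A v, w v a = 1) :
    ∑ ω ∈ Fintype.piFinset A, ∏ v, w v (ω v) = 1 := by
  rw [← Finset.prod_univ_sum]
  simp [hw]

theorem sum_piFinset_prod_mul_mul
    (hg : ∀ v, ∑ a ∈ A v, w v a * g v a = 0) {u v : ι} (huv : u ≠ v) :
    ∑ ω ∈ Fintype.piFinset A, (∏ i, w i (ω i)) * (g u (ω u) * g v (ω v)) = 0 := by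
  have h : ∀ ω : (i : ι) → α i, (∏ i, w i (ω i)) * (g u (ω u) * g v (ω v)) =
      ∏ i, (w i (ω i) * ((if i = u then g i (ω i) else 1) * if i = v then g i (ω i) else 1)) := by
    intro ω
    rw [Finset.prod_mul_distrib, Finset.prod_mul_distrib, Finset.prod_ite_eq' Finset.univ u,
      Finset.prod_ite_eq' Finset.univ v]
    simp
  simp only [h]
  rw [← Finset.prod_univ_sum A (fun i a =>
    w i a * ((if i = u then g i a else 1) * if i = v then g i a else 1))]
  refine Finset.prod_eq_zero (Finset.mem_univ u) ?_
  simp [huv, hg]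

theorem sum_piFinset_prod_mul_sq_single (hw : ∀ v, ∑ a ∈ A v, w v a = 1)
    (hw0 : ∀ v, ∀ a ∈ A v, 0 ≤ w v a) {M : ℝ} (hM : ∀ v, ∀ a ∈ A v, |g v a| ≤ M) (u : ι) :
    ∑ ω ∈ Fintype.piFinset A, (∏ i, w i (ω i)) * (g u (ω u) * g u (ω u)) ≤ M ^ 2 := by
  calc _ ≤ ∑ ω ∈ Fintype.piFinset A, (∏ i, w i (ω i)) * M ^ 2 := by
        refine Finset.sum_le_sum fun ω hω => ?_
        rw [Fintype.mem_piFinset] at hω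
        refine mul_le_mul_of_nonneg_left ?_ (Finset.prod_nonneg fun i _ => hw0 i _ (hω i))
        rw [← sq, ← sq_abs]
        exact pow_le_pow_left₀ (abs_nonneg _) (hM u _ (hω u)) 2
    _ = M ^ 2 := by rw [← Finset.sum_mul, sum_piFinset_prod A w hw, one_mul]

theorem sum_piFinset_prod_mul_sq (hw : ∀ v, ∑ a ∈ A v, w v a = 1)
    (hw0 : ∀ v, ∀ a ∈ A v, 0 ≤ w v a) {M : ℝ} (hM : ∀ v, ∀ a ∈ A v, |g v a| ≤ M)
    (hg : ∀ v, ∑ a ∈ A v, w v a * g v a = 0) :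
    ∑ ω ∈ Fintype.piFinset A, (∏ i, w i (ω i)) * (∑ v, g v (ω v)) ^ 2 ≤
      Fintype.card ι * M ^ 2 := by
  have h : ∀ ω : (i : ι) → α i, (∏ i, w i (ω i)) * (∑ v, g v (ω v)) ^ 2 =
      ∑ u, ∑ v, (∏ i, w i (ω i)) * (g u (ω u) * g v (ω v)) := by
    intro ω
    rw [sq, Finset.sum_mul_sum, Finset.mul_sum]
    exact Finset.sum_congr rfl fun u _ => by rw [Finset.mul_sum]
  simp only [h]
  rw [Finset.sum_comm]
  calc _ ≤ ∑ _u : ι, M ^ 2 := by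
        refine Finset.sum_le_sum fun u _ => ?_
        rw [Finset.sum_comm, Finset.sum_eq_single u]
        · exact sum_piFinset_prod_mul_sq_single A w g hw hw0 hM u
        · intro v _ hvu
          exact sum_piFinset_prod_mul_mul A w g hg hvu.symm
        · simp
    _ = _ := by simp

theorem sum_piFinset_prod_filter_le (hw : ∀ v, ∑ a ∈ A v, w v a = 1)
    (hw0 : ∀ v, ∀ a ∈ A v, 0 ≤ w v a) {M δ : ℝ} (hM : ∀ v, ∀ a ∈ A v, |g v a| ≤ M)
    (hg : ∀ v, ∑ a ∈ A v, w v a * g v a = 0) (hδ : 0 < δ)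
    (hδM : 4 * (Fintype.card ι * M ^ 2) ≤ δ ^ 2) :
    ∑ ω ∈ Fintype.piFinset A with ¬ |∑ v, g v (ω v)| ≤ δ, ∏ i, w i (ω i) ≤ 1 / 4 := by
  have h1 := sum_piFinset_prod_mul_sq A w g hw hw0 hM hg
  have hnn : ∀ ω ∈ Fintype.piFinset A, 0 ≤ ∏ i, w i (ω i) := fun ω hω =>
    Finset.prod_nonneg fun i _ => hw0 i _ (Fintype.mem_piFinset.1 hω i)
  have h2 : (∑ ω ∈ Fintype.piFinset A with ¬ |∑ v, g v (ω v)| ≤ δ, ∏ i, w i (ω i)) * δ ^ 2 ≤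
      Fintype.card ι * M ^ 2 := by
    refine le_trans ?_ h1
    rw [Finset.sum_mul]
    refine le_trans (Finset.sum_le_sum fun ω hω => ?_)
      (Finset.sum_le_sum_of_subset_of_nonneg (Finset.filter_subset _ _) fun ω hω _ =>
        mul_nonneg (hnn ω hω) (sq_nonneg _))
    rw [Finset.mem_filter] at hω
    refine mul_le_mul_of_nonneg_left ?_ (hnn ω hω.1)
    rw [← sq_abs (∑ v, g v (ω v))]
    exact pow_le_pow_left₀ hδ.le (le_of_not_ge hω.2) 2
  have h3 : 0 < δ ^ 2 := by positivity
  rw [← mul_le_mul_iff_left₀ h3]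
  linarith

/-- Two sums of independent centred variables are simultaneously small with weight at least a
half. -/
theorem half_le_sum_piFinset_prod (f : (v : ι) → α v → ℝ) (hw : ∀ v, ∑ a ∈ A v, w v a = 1)
    (hw0 : ∀ v, ∀ a ∈ A v, 0 ≤ w v a) {M δ : ℝ}
    (hfM : ∀ v, ∀ a ∈ A v, |f v a| ≤ M) (hf : ∀ v, ∑ a ∈ A v, w v a * f v a = 0)
    (hgM : ∀ v, ∀ a ∈ A v, |g v a| ≤ M) (hg : ∀ v, ∑ a ∈ A v, w v a * g v a = 0)
    (hδ : 0 < δ) (hδM : 4 * (Fintype.card ι * M ^ 2) ≤ δ ^ 2) :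
    1 / 2 ≤ ∑ ω ∈ Fintype.piFinset A with |∑ v, f v (ω v)| ≤ δ ∧ |∑ v, g v (ω v)| ≤ δ,
      ∏ i, w i (ω i) := by
  have h0 := sum_piFinset_prod A w hw
  have h1 := sum_piFinset_prod_filter_le A w f hw hw0 hfM hf hδ hδM
  have h2 := sum_piFinset_prod_filter_le A w g hw hw0 hgM hg hδ hδM
  have hnn : ∀ ω ∈ Fintype.piFinset A, 0 ≤ ∏ i, w i (ω i) := fun ω hω =>
    Finset.prod_nonneg fun i _ => hw0 i _ (Fintype.mem_piFinset.1 hω i)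
  have h3 : ∑ ω ∈ Fintype.piFinset A, ∏ i, w i (ω i) ≤
      (∑ ω ∈ Fintype.piFinset A with |∑ v, f v (ω v)| ≤ δ ∧ |∑ v, g v (ω v)| ≤ δ,
        ∏ i, w i (ω i)) +
      (∑ ω ∈ Fintype.piFinset A with ¬ |∑ v, f v (ω v)| ≤ δ, ∏ i, w i (ω i)) +
      ∑ ω ∈ Fintype.piFinset A with ¬ |∑ v, g v (ω v)| ≤ δ, ∏ i, w i (ω i) := by
    rw [Finset.sum_filter, Finset.sum_filter, Finset.sum_filter, ← Finset.sum_add_distrib,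
      ← Finset.sum_add_distrib]
    refine Finset.sum_le_sum fun ω hω => ?_
    have := hnn ω hω
    by_cases ha : |∑ v, f v (ω v)| ≤ δ <;> by_cases hb : |∑ v, g v (ω v)| ≤ δ <;>
      simp [ha, hb, this]
  linarith

end Chebyshev

section Moments

theorem sum_finset_card_mul_pow (k : ℕ) (a b : ℝ) :
    ∑ S : Finset (Fin k), (S.card : ℝ) * (a ^ S.card * b ^ (k - S.card)) =
      k * a * (a + b) ^ (k - 1) := by
  rw [← Finset.powerset_univ, Finset.sum_powerset_apply_card
    (fun m => (m : ℝ) * (a ^ m * b ^ (k - m)))]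
  simp only [Finset.card_univ, Fintype.card_fin, nsmul_eq_mul]
  rcases k with _ | k
  · simp
  rw [Finset.sum_range_succ']
  simp only [Nat.add_sub_cancel, Nat.cast_zero, zero_mul, mul_zero, add_zero]
  rw [add_pow, Finset.mul_sum]
  refine Finset.sum_congr rfl fun m hm => ?_
  have h := Nat.add_one_mul_choose_eq k m
  have h' : ((k : ℝ) + 1) * (k.choose m) = ((k + 1).choose (m + 1)) * (m + 1) := by exact_mod_cast h
  rw [Nat.succ_sub_succ]
  push_cast
  rw [pow_succ]
  linear_combination (-(a ^ m * a * b ^ (k - m))) * h'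

theorem sum_finset_card_eq_one_pow (k : ℕ) (a b : ℝ) :
    ∑ S : Finset (Fin k), (if S.card = 1 then 1 else 0) * (a ^ S.card * b ^ (k - S.card)) =
      k * a * b ^ (k - 1) := by
  rw [← Finset.powerset_univ, Finset.sum_powerset_apply_card
    (fun m => (if m = 1 then 1 else 0) * (a ^ m * b ^ (k - m)))]
  simp only [Finset.card_univ, Fintype.card_fin, nsmul_eq_mul]
  rcases k with _ | k
  · simp
  rw [Finset.sum_eq_single 1]
  · simp; ring
  · intro m _ hm; simp [hm]
  · intro h; exact absurd (Finset.mem_range.2 (by omega)) h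

theorem sum_finset_pow (k : ℕ) (a b : ℝ) :
    ∑ S : Finset (Fin k), a ^ S.card * b ^ (k - S.card) = (a + b) ^ k := by
  simpa using Fintype.sum_pow_mul_eq_add_pow (Fin k) a b

end Moments

section Options

/-- The mean size of a uniform `β`-thinned set of `k` half-edges conditioned to be nonempty. -/
noncomputable def meanSize (β : ℝ) (k : ℕ) : ℝ := k * (1 - β) / (1 - β ^ k)

/-- The probability that a `β`-thinned set of `k` half-edges conditioned to be nonempty is a
singleton. -/
noncomputable def singleProb (β : ℝ) (k : ℕ) : ℝ := k * β ^ (k - 1) * (1 - β) / (1 - β ^ k)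

variable {β : ℝ}

theorem meanSize_nonneg (hβ : 0 < β) (hβ' : β < 1) (k : ℕ) : 0 ≤ meanSize β k :=
  div_nonneg (mul_nonneg k.cast_nonneg (by linarith)) (by
    have := pow_le_one₀ hβ.le hβ'.le (n := k); linarith)

theorem meanSize_le (hβ : 0 < β) (hβ' : β < 1) (k : ℕ) : meanSize β k ≤ k := by
  rcases Nat.eq_zero_or_pos k with rfl | hk
  · simp [meanSize]
  have h1 := pow_lt_one₀ hβ.le hβ' hk.ne'
  have h2 : β ^ k ≤ β := by simpa using pow_le_pow_of_le_one hβ.le hβ'.le hk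
  rw [meanSize, div_le_iff₀ (by linarith)]
  exact mul_le_mul_of_nonneg_left (by linarith) k.cast_nonneg

theorem singleProb_nonneg (hβ : 0 < β) (hβ' : β < 1) (k : ℕ) : 0 ≤ singleProb β k :=
  div_nonneg (mul_nonneg (by positivity) (by linarith)) (by
    have := pow_le_one₀ hβ.le hβ'.le (n := k); linarith)

theorem singleProb_le (hβ : 0 < β) (hβ' : β < 1) (k : ℕ) : singleProb β k ≤ k := by
  refine le_trans ?_ (meanSize_le hβ hβ' k)
  have h1 := pow_le_one₀ hβ.le hβ'.le (n := k)
  have h2 := pow_le_one₀ hβ.le hβ'.le (n := k - 1)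
  unfold singleProb meanSize
  refine div_le_div_of_nonneg_right ?_ (by linarith)
  refine mul_le_mul_of_nonneg_right ?_ (by linarith)
  exact mul_le_of_le_one_right k.cast_nonneg h2

variable {V : Type*} [DecidableEq V] (d : V → ℕ) (R₀ X₁ : Finset V) (M : ℕ)

/-- The vertices at which the selection is not prescribed. -/
def IsFree (v : V) : Prop := v ∉ R₀ ∧ v ∉ X₁ ∧ d v ≤ M

instance : DecidablePred (IsFree d R₀ X₁ M) := fun _ => inferInstanceAs (Decidable (_ ∧ _ ∧ _))

/-- The allowed selections at a vertex. -/
def options (v : V) : Finset (Finset (Fin (d v))) :=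
  if v ∈ R₀ then {∅} else if v ∈ X₁ then {Finset.univ} else
    if M < d v then {Finset.univ.filter fun i => i.val = 0} else Finset.univ.erase ∅

/-- The weight of a selection at a vertex. -/
noncomputable def optionWeight (β : ℝ) (v : V) (S : Finset (Fin (d v))) : ℝ :=
  if IsFree d R₀ X₁ M v then (1 - β) ^ S.card * β ^ (d v - S.card) / (1 - β ^ d v) else 1

/-- The mean size of a random selection at a vertex. -/
noncomputable def optionSize (β : ℝ) (v : V) : ℝ :=
  if v ∈ R₀ then 0 else if v ∈ X₁ then d v else if M < d v then 1 else meanSize β (d v)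

/-- The probability that a random selection at a vertex is a singleton. -/
noncomputable def optionSingle (β : ℝ) (v : V) : ℝ :=
  if v ∈ R₀ then 0 else if v ∈ X₁ then 0 else if M < d v then 1 else singleProb β (d v)

variable {d R₀ X₁ M}

theorem card_filter_val_eq_zero {k : ℕ} (hk : 0 < k) :
    (Finset.univ.filter fun i : Fin k => i.val = 0).card = 1 := by
  rw [Finset.card_eq_one]
  exact ⟨⟨0, hk⟩, by ext i; simp [Fin.ext_iff]⟩

theorem options_cases (hd : ∀ v, 0 < d v) (v : V) :
    (v ∈ R₀ ∧ ¬ IsFree d R₀ X₁ M v ∧ options d R₀ X₁ M v = {∅}) ∨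
    (v ∉ R₀ ∧ v ∈ X₁ ∧ ¬ IsFree d R₀ X₁ M v ∧ options d R₀ X₁ M v = {Finset.univ}) ∨
    (v ∉ R₀ ∧ v ∉ X₁ ∧ M < d v ∧ ¬ IsFree d R₀ X₁ M v ∧
      ∃ S, S.card = 1 ∧ options d R₀ X₁ M v = {S}) ∨
    (v ∉ R₀ ∧ v ∉ X₁ ∧ d v ≤ M ∧ IsFree d R₀ X₁ M v ∧
      options d R₀ X₁ M v = Finset.univ.erase ∅) := by
  by_cases h1 : v ∈ R₀
  · simp [h1, IsFree, options]
  by_cases h2 : v ∈ X₁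
  · simp [h1, h2, IsFree, options]
  by_cases h3 : M < d v
  · refine Or.inr (Or.inr (Or.inl ⟨h1, h2, h3, fun h => absurd h.2.2 (by omega),
      _, card_filter_val_eq_zero (hd v), by simp [h1, h2, h3, options]⟩))
  · exact Or.inr (Or.inr (Or.inr ⟨h1, h2, by omega, ⟨h1, h2, by omega⟩,
      by simp [h1, h2, h3, options]⟩))

theorem sum_optionWeight_mul (hd : ∀ v, 0 < d v) {v : V}
    (hv : IsFree d R₀ X₁ M v) (φ : ℕ → ℝ) :
    ∑ S ∈ options d R₀ X₁ M v, optionWeight d R₀ X₁ M β v S * φ S.card =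
      (∑ S : Finset (Fin (d v)), φ S.card * ((1 - β) ^ S.card * β ^ (d v - S.card)) -
        φ 0 * β ^ d v) / (1 - β ^ d v) := by
  have h1 : options d R₀ X₁ M v = Finset.univ.erase ∅ := by
    rcases options_cases (R₀ := R₀) (X₁ := X₁) (M := M) hd v with h | h | h | h
    · exact absurd hv h.2.1
    · exact absurd hv h.2.2.1
    · exact absurd hv h.2.2.2.1
    · exact h.2.2.2.2
  rw [h1, ← Finset.add_sum_erase Finset.univ _ (Finset.mem_univ (∅ : Finset (Fin (d v)))),
    Finset.card_empty]
  simp only [pow_zero, one_mul, Nat.sub_zero, add_sub_cancel_left, optionWeight, if_pos hv]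
  rw [Finset.sum_div]
  exact Finset.sum_congr rfl fun S _ => by ring

theorem sum_optionWeight (hβ : 0 < β) (hβ' : β < 1) (hd : ∀ v, 0 < d v) (v : V) :
    ∑ S ∈ options d R₀ X₁ M v, optionWeight d R₀ X₁ M β v S = 1 := by
  by_cases hv : IsFree d R₀ X₁ M v
  · have h := sum_optionWeight_mul (β := β) hd hv fun _ => 1
    simp only [mul_one, one_mul] at h
    have := pow_lt_one₀ hβ.le hβ' (hd v).ne'
    rw [h, sum_finset_pow, sub_add_cancel, one_pow, div_self (by linarith)]
  · rcases options_cases (R₀ := R₀) (X₁ := X₁) (M := M) hd v with h | h | ⟨_, _, _, _, S, _, h⟩ | h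
    · rw [h.2.2]; simp [optionWeight, hv]
    · rw [h.2.2.2]; simp [optionWeight, hv]
    · rw [h]; simp [optionWeight, hv]
    · exact absurd h.2.2.2.1 hv

theorem optionWeight_nonneg (hβ : 0 < β) (hβ' : β < 1) (v : V) (S : Finset (Fin (d v))) :
    0 ≤ optionWeight d R₀ X₁ M β v S := by
  have h1 := pow_le_one₀ hβ.le hβ'.le (n := d v)
  have : 0 ≤ 1 - β := by linarith
  have : 0 ≤ 1 - β ^ d v := by linarith
  unfold optionWeight
  split_ifs <;> positivity

theorem sum_optionWeight_mul_size (hβ : 0 < β) (hβ' : β < 1) (hd : ∀ v, 0 < d v) (v : V) :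
    ∑ S ∈ options d R₀ X₁ M v,
      optionWeight d R₀ X₁ M β v S * ((S.card : ℝ) - optionSize d R₀ X₁ M β v) = 0 := by
  rcases options_cases (R₀ := R₀) (X₁ := X₁) (M := M) hd v with
    h | h | ⟨h1, h2, h3, h4, S, hS, h⟩ | ⟨h1, h2, h3, hv, -⟩
  · rw [h.2.2]; simp [optionSize, h.1]
  · rw [h.2.2.2]; simp [optionSize, h.1, h.2.1]
  · rw [h]; simp [optionSize, h1, h2, h3, hS]
  · simp only [mul_sub, Finset.sum_sub_distrib]
    rw [← Finset.sum_mul, sum_optionWeight hβ hβ' hd, one_mul, sub_eq_zero,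
      sum_optionWeight_mul hd hv fun m => (m : ℝ), sum_finset_card_mul_pow]
    simp [optionSize, h1, h2, h3.not_gt, meanSize]

theorem sum_optionWeight_mul_single (hβ : 0 < β) (hβ' : β < 1) (hd : ∀ v, 0 < d v)
    (hX₁ : ∀ v ∈ X₁, 3 ≤ d v) (v : V) :
    ∑ S ∈ options d R₀ X₁ M v, optionWeight d R₀ X₁ M β v S *
      ((if S.card = 1 then (1 : ℝ) else 0) - optionSingle d R₀ X₁ M β v) = 0 := by
  rcases options_cases (R₀ := R₀) (X₁ := X₁) (M := M) hd v with
    h | h | ⟨h1, h2, h3, h4, S, hS, h⟩ | ⟨h1, h2, h3, hv, -⟩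
  · rw [h.2.2]; simp [optionSingle, h.1]
  · have := hX₁ v h.2.1
    rw [h.2.2.2]; simp [optionSingle, h.1, h.2.1, show d v ≠ 1 by omega]
  · rw [h]; simp [optionSingle, h1, h2, h3, hS]
  · simp only [mul_sub, Finset.sum_sub_distrib]
    rw [← Finset.sum_mul, sum_optionWeight hβ hβ' hd, one_mul, sub_eq_zero,
      sum_optionWeight_mul hd hv fun m => if m = 1 then (1 : ℝ) else 0,
      sum_finset_card_eq_one_pow]
    simp [optionSingle, h1, h2, h3.not_gt, singleProb]
    ring

theorem abs_size_sub_le (hβ : 0 < β) (hβ' : β < 1) (hd : ∀ v, 0 < d v) (v : V) :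
    ∀ S ∈ options d R₀ X₁ M v, |(S.card : ℝ) - optionSize d R₀ X₁ M β v| ≤ M := by
  intro T hT
  rcases options_cases (R₀ := R₀) (X₁ := X₁) (M := M) hd v with
    h | h | ⟨h1, h2, h3, h4, S, hS, h⟩ | ⟨h1, h2, h3, hv, -⟩
  · rw [h.2.2, Finset.mem_singleton] at hT; simp [optionSize, h.1, hT]
  · rw [h.2.2.2, Finset.mem_singleton] at hT; simp [optionSize, h.1, h.2.1, hT]
  · rw [h, Finset.mem_singleton] at hT; simp [optionSize, h1, h2, h3, hS, hT]
  · have h5 : T.card ≤ d v := by simpa using Finset.card_le_univ T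
    have h6 : (d v : ℝ) ≤ M := by exact_mod_cast h3
    have h7 : optionSize d R₀ X₁ M β v = meanSize β (d v) := by
      simp [optionSize, h1, h2, h3.not_gt]
    rw [h7]
    exact abs_sub_le_of_nonneg_of_le (Nat.cast_nonneg _) (le_trans (by exact_mod_cast h5) h6)
      (meanSize_nonneg hβ hβ' _) ((meanSize_le hβ hβ' _).trans h6)

theorem abs_single_sub_le (hβ : 0 < β) (hβ' : β < 1) (hd : ∀ v, 0 < d v)
    (hX₁ : ∀ v ∈ X₁, 3 ≤ d v) (v : V) :
    ∀ S ∈ options d R₀ X₁ M v,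
      |(if S.card = 1 then (1 : ℝ) else 0) - optionSingle d R₀ X₁ M β v| ≤ M := by
  intro T hT
  rcases options_cases (R₀ := R₀) (X₁ := X₁) (M := M) hd v with
    h | h | ⟨h1, h2, h3, h4, S, hS, h⟩ | ⟨h1, h2, h3, hv, -⟩
  · rw [h.2.2, Finset.mem_singleton] at hT; simp [optionSingle, h.1, hT]
  · have := hX₁ v h.2.1
    rw [h.2.2.2, Finset.mem_singleton] at hT
    simp [optionSingle, h.1, h.2.1, hT, show d v ≠ 1 by omega]
  · rw [h, Finset.mem_singleton] at hT; simp [optionSingle, h1, h2, h3, hS, hT]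
  · have h6 : (d v : ℝ) ≤ M := by exact_mod_cast h3
    have h7 : optionSingle d R₀ X₁ M β v = singleProb β (d v) := by
      simp [optionSingle, h1, h2, h3.not_gt]
    have h8 : (1 : ℝ) ≤ d v := by exact_mod_cast hd v
    rw [h7]
    exact abs_sub_le_of_nonneg_of_le (by split_ifs <;> norm_num)
      (by split_ifs <;> linarith)
      (singleProb_nonneg hβ hβ' _) ((singleProb_le hβ hβ' _).trans h6)

variable [Fintype V]

theorem isSelection_of_mem (hd : ∀ v, 0 < d v) (hX₁ : ∀ v ∈ X₁, d v ≤ M) (hR₀ : ∀ v ∈ R₀, d v ≤ M)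
    (hdis : ∀ v ∈ X₁, v ∉ R₀) {T : (v : V) → Finset (Fin (d v))}
    (hT : ∀ v, T v ∈ options d R₀ X₁ M v) :
    IsSelection R₀ X₁ M (∑ v, (T v).card) (Finset.univ.filter fun v => (T v).card = 1).card T := by
  refine ⟨fun v => ?_, fun v hv => ?_, fun v hv => ?_, rfl, rfl⟩
  · have hT := hT v
    rcases options_cases (R₀ := R₀) (X₁ := X₁) (M := M) hd v with
      h | h | ⟨h1, h2, h3, h4, S, hS, h⟩ | ⟨h1, h2, h3, hv, h⟩
    · rw [h.2.2, Finset.mem_singleton] at hT; simp [hT, h.1]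
    · rw [h.2.2.2, Finset.mem_singleton] at hT
      have : Nonempty (Fin (d v)) := ⟨⟨0, hd v⟩⟩
      simp [hT, h.1, Finset.univ_nonempty.ne_empty]
    · rw [h, Finset.mem_singleton] at hT
      have : S ≠ ∅ := by rintro rfl; simp at hS
      simp [hT, h1, this]
    · rw [h, Finset.mem_erase] at hT
      simp [hT.1, h1]
  · have hT := hT v
    rcases options_cases (R₀ := R₀) (X₁ := X₁) (M := M) hd v with
      h | h | ⟨h1, h2, h3, h4, S, hS, h⟩ | ⟨h1, h2, h3, hv, h⟩
    · have := hR₀ v h.1; omega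
    · have := hX₁ v h.2.1; omega
    · rw [h, Finset.mem_singleton] at hT; rw [hT, hS]
    · omega
  · have hT := hT v
    rcases options_cases (R₀ := R₀) (X₁ := X₁) (M := M) hd v with
      h | h | h | h
    · exact absurd h.1 (hdis v hv)
    · rw [h.2.2.2, Finset.mem_singleton] at hT; exact hT
    · exact absurd hv h.2.1
    · exact absurd hv h.2.1

theorem prod_optionWeight_mul_le (hβ : 0 < β) (hβ' : β < 1) (hd : ∀ v, 0 < d v)
    (T : (v : V) → Finset (Fin (d v))) :
    (∏ v, optionWeight d R₀ X₁ M β v (T v)) * ((∏ v, (1 - β ^ d v)) *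
      (β * (1 - β)) ^ (∑ v with ¬ IsFree d R₀ X₁ M v, d v)) ≤
      (1 - β) ^ (∑ v, (T v).card) * β ^ (∑ v, d v - ∑ v, (T v).card) := by
  have h1 : ∀ v, (T v).card ≤ d v := fun v => by simpa using Finset.card_le_univ (T v)
  have h0 : 0 < 1 - β := by linarith
  rw [← Finset.sum_tsub_distrib _ fun v _ => h1 v, ← Finset.prod_pow_eq_pow_sum,
    ← Finset.prod_pow_eq_pow_sum, ← Finset.prod_pow_eq_pow_sum, Finset.prod_filter,
    ← Finset.prod_mul_distrib, ← Finset.prod_mul_distrib, ← Finset.prod_mul_distrib]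
  refine Finset.prod_le_prod (fun v _ => ?_) fun v _ => ?_
  · have h2 := pow_lt_one₀ hβ.le hβ' (hd v).ne'
    have h3 : 0 ≤ 1 - β ^ d v := by linarith
    have := optionWeight_nonneg (R₀ := R₀) (X₁ := X₁) (M := M) hβ hβ' v (T v)
    split_ifs <;> positivity
  · have h2 := pow_lt_one₀ hβ.le hβ' (hd v).ne'
    by_cases hv : IsFree d R₀ X₁ M v
    · rw [optionWeight, if_pos hv, if_neg (not_not.2 hv), mul_one,
        div_mul_cancel₀ _ (by linarith)]
    · rw [optionWeight, if_neg hv, if_pos hv, one_mul, mul_pow]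
      have h3 : 0 < β ^ d v := by positivity
      calc (1 - β ^ d v) * (β ^ d v * (1 - β) ^ d v) ≤ 1 * (β ^ d v * (1 - β) ^ d v) :=
            mul_le_mul_of_nonneg_right (by linarith) (by positivity)
        _ = (1 - β) ^ d v * β ^ d v := by ring
        _ ≤ _ := mul_le_mul (pow_le_pow_of_le_one h0.le (by linarith) (h1 v))
            (pow_le_pow_of_le_one hβ.le hβ'.le (Nat.sub_le _ _)) h3.le (by positivity)

/-- Many selections share their total size and their number of singletons, both close to the
respective means. -/
theorem exists_many_selections (hβ : 0 < β) (hβ' : β < 1) (hd : ∀ v, 0 < d v)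
    (hX₁ : ∀ v ∈ X₁, 3 ≤ d v) (hX₁M : ∀ v ∈ X₁, d v ≤ M) (hR₀ : ∀ v ∈ R₀, d v ≤ M)
    (hdis : ∀ v ∈ X₁, v ∉ R₀) {δ : ℝ} (hδ : 0 < δ)
    (hδM : 4 * (Fintype.card V * (M : ℝ) ^ 2) ≤ δ ^ 2) :
    ∃ σ N : ℕ, ∃ 𝒯 : Finset ((v : V) → Finset (Fin (d v))),
      (∀ T ∈ 𝒯, IsSelection R₀ X₁ M σ N T) ∧ σ ≤ ∑ v, d v ∧
      |(σ : ℝ) - ∑ v, optionSize d R₀ X₁ M β v| ≤ δ ∧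
      |(N : ℝ) - ∑ v, optionSingle d R₀ X₁ M β v| ≤ δ ∧
      (∏ v, (1 - β ^ d v)) * (β * (1 - β)) ^ (∑ v with ¬ IsFree d R₀ X₁ M v, d v) ≤
        2 * ((∑ v, d v + 1) * (Fintype.card V + 1) : ℕ) * (𝒯.card *
          ((1 - β) ^ σ * β ^ (∑ v, d v - σ))) := by
  classical
  set w := optionWeight d R₀ X₁ M β with hw
  set Ω := (Fintype.piFinset (options d R₀ X₁ M)).filter fun T =>
    |∑ v, (((T v).card : ℝ) - optionSize d R₀ X₁ M β v)| ≤ δ ∧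
    |∑ v, ((if (T v).card = 1 then (1 : ℝ) else 0) - optionSingle d R₀ X₁ M β v)| ≤ δ with hΩ
  have hhalf : 1 / 2 ≤ ∑ T ∈ Ω, ∏ v, w v (T v) :=
    half_le_sum_piFinset_prod (options d R₀ X₁ M) w
      (fun v S => (if S.card = 1 then (1 : ℝ) else 0) - optionSingle d R₀ X₁ M β v)
      (fun v S => (S.card : ℝ) - optionSize d R₀ X₁ M β v)
      (sum_optionWeight hβ hβ' hd) (fun v S _ => optionWeight_nonneg hβ hβ' v S)
      (abs_size_sub_le hβ hβ' hd) (sum_optionWeight_mul_size hβ hβ' hd)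
      (abs_single_sub_le hβ hβ' hd hX₁) (sum_optionWeight_mul_single hβ hβ' hd hX₁) hδ hδM
  set stat : ((v : V) → Finset (Fin (d v))) → ℕ × ℕ := fun T =>
    (∑ v, (T v).card, (Finset.univ.filter fun v => (T v).card = 1).card) with hstat
  set I := Finset.range (∑ v, d v + 1) ×ˢ Finset.range (Fintype.card V + 1) with hI
  have hle : ∀ T : (v : V) → Finset (Fin (d v)), ∑ v, (T v).card ≤ ∑ v, d v := fun T =>
    Finset.sum_le_sum fun v _ => by simpa using Finset.card_le_univ (T v)
  have hmap : ∀ T ∈ Ω, stat T ∈ I := by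
    intro T _
    simp only [hI, hstat, Finset.mem_product, Finset.mem_range, Nat.lt_succ_iff]
    exact ⟨hle T, Finset.card_le_univ _⟩
  have hIc : I.card = (∑ v, d v + 1) * (Fintype.card V + 1) := by simp [hI]
  obtain ⟨c, -, hc⟩ := Finset.exists_le_sum_fiber_of_maps_to_of_nsmul_le_sum
    (s := Ω) (t := I) (f := stat) (w := fun T => ∏ v, w v (T v))
    (b := 1 / (2 * ((∑ v, d v + 1) * (Fintype.card V + 1) : ℕ)))
    hmap ⟨(0, 0), by simp [hI]⟩ (by
      rw [hIc, nsmul_eq_mul]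
      refine le_trans (le_of_eq ?_) hhalf
      have : (((∑ v, d v + 1) * (Fintype.card V + 1) : ℕ) : ℝ) ≠ 0 := by positivity
      field_simp)
  set 𝒯 := Ω.filter fun T => stat T = c with h𝒯
  have hpos : (0 : ℝ) < 2 * ((∑ v, d v + 1) * (Fintype.card V + 1) : ℕ) := by positivity
  have hne : 𝒯.Nonempty := by
    rw [Finset.nonempty_iff_ne_empty]
    intro h
    rw [h, Finset.sum_empty] at hc
    have : (0 : ℝ) < 1 / (2 * ((∑ v, d v + 1) * (Fintype.card V + 1) : ℕ)) := by positivity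
    linarith
  have hmem : ∀ T ∈ 𝒯, (∀ v, T v ∈ options d R₀ X₁ M v) ∧ ∑ v, (T v).card = c.1 ∧
      (Finset.univ.filter fun v => (T v).card = 1).card = c.2 := by
    intro T hT
    rw [h𝒯, Finset.mem_filter, hΩ, Finset.mem_filter, Fintype.mem_piFinset] at hT
    exact ⟨hT.1.1, congrArg Prod.fst hT.2, congrArg Prod.snd hT.2⟩
  obtain ⟨T₀, hT₀⟩ := hne
  obtain ⟨h1, h2, h3⟩ := hmem T₀ hT₀
  have hgood : T₀ ∈ Ω := (Finset.mem_filter.1 hT₀).1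
  rw [hΩ, Finset.mem_filter, Finset.sum_sub_distrib, Finset.sum_sub_distrib] at hgood
  refine ⟨c.1, c.2, 𝒯, fun T hT => ?_, ?_, ?_, ?_, ?_⟩
  · obtain ⟨h4, h5, h6⟩ := hmem T hT
    have := isSelection_of_mem hd hX₁M hR₀ hdis h4
    rwa [h5, h6] at this
  · rw [← h2]; exact hle T₀
  · rw [← h2]; push_cast; exact hgood.2.1
  · rw [← h3, Finset.card_filter]; push_cast; exact hgood.2.2
  · set P := (∏ v, (1 - β ^ d v)) * (β * (1 - β)) ^ (∑ v with ¬ IsFree d R₀ X₁ M v, d v) with hP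
    have hP0 : 0 ≤ P := by
      refine mul_nonneg (Finset.prod_nonneg fun v _ => ?_) (pow_nonneg (by nlinarith) _)
      have := pow_le_one₀ hβ.le hβ'.le (n := d v)
      linarith
    have h7 : (∑ T ∈ 𝒯, ∏ v, w v (T v)) * P ≤
        𝒯.card * ((1 - β) ^ c.1 * β ^ (∑ v, d v - c.1)) := by
      rw [Finset.sum_mul, ← nsmul_eq_mul]
      refine Finset.sum_le_card_nsmul _ _ _ fun T hT => ?_
      rw [← (hmem T hT).2.1]
      exact prod_optionWeight_mul_le hβ hβ' hd T
    have h8 := (mul_le_mul_of_nonneg_right hc hP0).trans h7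
    rw [one_div, inv_mul_le_iff₀ hpos] at h8
    exact h8

end Options

section NetGain

variable {β : ℝ}

/-- The expected number of selected half-edges plus selected singletons minus the degree. -/
noncomputable def netGain (β : ℝ) (k : ℕ) : ℝ := meanSize β k + singleProb β k - k

theorem netGain_one (hβ' : β < 1) : netGain β 1 = 1 := by
  have : 1 - β ≠ 0 := by linarith
  simp [netGain, meanSize, singleProb, this]

theorem abs_netGain_le (hβ : 0 < β) (hβ' : β < 1) (k : ℕ) : |netGain β k| ≤ k := by
  have h1 := meanSize_nonneg hβ hβ' k
  have h2 := meanSize_le hβ hβ' k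
  have h3 := singleProb_nonneg hβ hβ' k
  have h4 := singleProb_le hβ hβ' k
  unfold netGain
  rw [abs_le]
  constructor <;> linarith

theorem one_sub_pow_mul_netGain (hβ : 0 < β) (hβ' : β < 1) (m : ℕ) :
    (1 - β ^ (m + 2)) * netGain β (m + 2) = -((m + 2) * β * (1 - β ^ m)) := by
  have h := pow_lt_one₀ hβ.le hβ' (show m + 2 ≠ 0 by omega)
  have h' : 1 - β ^ (m + 2) ≠ 0 := by linarith
  unfold netGain meanSize singleProb
  rw [show m + 2 - 1 = m + 1 by omega]
  field_simp
  push_cast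
  ring

theorem one_sub_add_nonneg (hβ : 0 < β) (j : ℕ) :
    0 ≤ 1 - (j + 1) * β ^ j + j * β ^ (j + 1) := by
  induction j with
  | zero => simp
  | succ j ih =>
    have : 0 ≤ ((j : ℝ) + 1) * β ^ j * (1 - β) ^ 2 := by positivity
    push_cast
    linear_combination ih + this

theorem mul_one_sub_pow_lt (hβ : 0 < β) (hβ' : β < 1) (m : ℕ) :
    ((m + 1 : ℕ) + 2) * β * (1 - β ^ (m + 1)) < (m + 1 : ℕ) * (1 - β ^ (m + 3)) := by
  induction m with
  | zero =>
    have : 0 < (1 - β) ^ 3 := by have : 0 < 1 - β := by linarith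
                                 positivity
    push_cast
    linear_combination this
  | succ m ih =>
    have h1 := mul_nonneg (show 0 ≤ 1 - β by linarith) (one_sub_add_nonneg hβ (m + 2))
    push_cast at ih h1 ⊢
    linear_combination ih + h1

theorem neg_netGain_pos (hβ : 0 < β) (hβ' : β < 1) {k : ℕ} (hk : 3 ≤ k) : 0 < -netGain β k := by
  obtain ⟨m, rfl⟩ := Nat.exists_eq_add_of_le hk
  have h := pow_lt_one₀ hβ.le hβ' (show m + 1 + 2 ≠ 0 by omega)
  have h2 := pow_lt_one₀ hβ.le hβ' (show m + 1 ≠ 0 by omega)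
  have h3 := one_sub_pow_mul_netGain hβ hβ' (m + 1)
  have h4 : 0 < (1 - β ^ (m + 1 + 2)) * -netGain β (m + 1 + 2) := by
    rw [mul_neg, h3, neg_neg]
    have : 0 < 1 - β ^ (m + 1) := by linarith
    positivity
  rw [show 3 + m = m + 1 + 2 by omega]
  exact (mul_pos_iff_of_pos_left (by linarith)).1 h4

theorem neg_netGain_lt (hβ : 0 < β) (hβ' : β < 1) {k : ℕ} (hk : 3 ≤ k) :
    -netGain β k < k - 2 := by
  obtain ⟨m, rfl⟩ := Nat.exists_eq_add_of_le hk
  have h := pow_lt_one₀ hβ.le hβ' (show m + 1 + 2 ≠ 0 by omega)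
  have h3 := one_sub_pow_mul_netGain hβ hβ' (m + 1)
  have h4 := mul_one_sub_pow_lt hβ hβ' m
  have h5 : (1 - β ^ (m + 1 + 2)) * -netGain β (m + 1 + 2) <
      (1 - β ^ (m + 1 + 2)) * (m + 1 : ℕ) := by
    rw [mul_neg, h3, neg_neg, mul_comm (1 - _)]
    exact h4
  rw [show 3 + m = m + 1 + 2 by omega]
  have h6 := (mul_lt_mul_iff_right₀ (show 0 < 1 - β ^ (m + 1 + 2) by linarith)).1 h5
  push_cast at h6 ⊢
  linarith

variable {V : Type*} [DecidableEq V] [Fintype V] {d : V → ℕ} {R₀ X₁ : Finset V} {M : ℕ}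

theorem abs_sum_optionSize_sub_le (hβ : 0 < β) (hβ' : β < 1) (hd : ∀ v, 0 < d v) :
    |∑ v, optionSize d R₀ X₁ M β v - ∑ v, meanSize β (d v)| ≤
      (∑ v with ¬ IsFree d R₀ X₁ M v, d v : ℕ) := by
  rw [← Finset.sum_sub_distrib, Finset.sum_filter]
  push_cast
  refine (Finset.abs_sum_le_sum_abs _ _).trans (Finset.sum_le_sum fun v _ => ?_)
  have h1 := meanSize_nonneg hβ hβ' (d v)
  have h2 := meanSize_le hβ hβ' (d v)
  have h3 : (1 : ℝ) ≤ d v := by exact_mod_cast hd v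
  unfold optionSize
  by_cases hv : IsFree d R₀ X₁ M v
  · simp [hv, hv.1, hv.2.1, hv.2.2.not_gt]
  · have h4 : v ∉ R₀ → v ∉ X₁ → M < d v := fun h h' => by
      by_contra h''; exact hv ⟨h, h', by omega⟩
    rw [if_pos hv, abs_le]
    split_ifs
    · constructor <;> linarith
    · constructor <;> linarith
    · constructor <;> linarith
    · exact absurd (h4 ‹_› ‹_›) ‹_›

theorem abs_sum_optionSingle_sub_le (hβ : 0 < β) (hβ' : β < 1) (hd : ∀ v, 0 < d v) :
    |∑ v, optionSingle d R₀ X₁ M β v - ∑ v, singleProb β (d v)| ≤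
      (∑ v with ¬ IsFree d R₀ X₁ M v, d v : ℕ) := by
  rw [← Finset.sum_sub_distrib, Finset.sum_filter]
  push_cast
  refine (Finset.abs_sum_le_sum_abs _ _).trans (Finset.sum_le_sum fun v _ => ?_)
  have h1 := singleProb_nonneg hβ hβ' (d v)
  have h2 := singleProb_le hβ hβ' (d v)
  have h3 : (1 : ℝ) ≤ d v := by exact_mod_cast hd v
  unfold optionSingle
  by_cases hv : IsFree d R₀ X₁ M v
  · simp [hv, hv.1, hv.2.1, hv.2.2.not_gt]
  · have h4 : v ∉ R₀ → v ∉ X₁ → M < d v := fun h h' => by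
      by_contra h''; exact hv ⟨h, h', by omega⟩
    rw [if_pos hv, abs_le]
    split_ifs
    · constructor <;> linarith
    · constructor <;> linarith
    · constructor <;> linarith
    · exact absurd (h4 ‹_› ‹_›) ‹_›

theorem abs_sum_option_sub_le (hβ : 0 < β) (hβ' : β < 1) (hd : ∀ v, 0 < d v) {k₀ : ℕ}
    (hR₀ : ∀ v ∈ R₀, d v = 1) (hX₁ : ∀ v ∈ X₁, d v = k₀) (hdis : ∀ v ∈ X₁, v ∉ R₀) :
    |∑ v, (optionSize d R₀ X₁ M β v + optionSingle d R₀ X₁ M β v) + R₀.card - ∑ v, (d v : ℝ) -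
      (∑ v, netGain β (d v) + X₁.card * -netGain β k₀)| ≤
      R₀.card + 2 * (∑ v with M < d v, d v : ℕ) := by
  have hR : (R₀.card : ℝ) = ∑ v, if v ∈ R₀ then 1 else 0 := by simp
  have hX : (X₁.card : ℝ) * -netGain β k₀ = ∑ v, if v ∈ X₁ then -netGain β k₀ else 0 := by simp
  rw [hX, hR, Finset.sum_filter, ← Finset.sum_add_distrib, ← Finset.sum_sub_distrib,
    ← Finset.sum_add_distrib, ← Finset.sum_sub_distrib]
  push_cast
  rw [Finset.mul_sum, ← Finset.sum_add_distrib]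
  refine (Finset.abs_sum_le_sum_abs _ _).trans (Finset.sum_le_sum fun v _ => ?_)
  have h1 := abs_le.1 (abs_netGain_le hβ hβ' (d v))
  have h3 : (1 : ℝ) ≤ d v := by exact_mod_cast hd v
  have h4 : (0 : ℝ) ≤ 2 * if M < d v then (d v : ℝ) else 0 := by split_ifs <;> linarith
  by_cases hv : v ∈ R₀
  · have hv' : v ∉ X₁ := fun h => hdis v h hv
    simp only [optionSize, optionSingle, hv, hv', if_true, if_false, hR₀ v hv, netGain_one hβ']
      at h4 ⊢
    norm_num
    simpa [hR₀ v hv] using h4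
  by_cases hv' : v ∈ X₁
  · simp only [optionSize, optionSingle, hv, hv', if_true, if_false, hX₁ v hv'] at h4 ⊢
    rw [show (k₀ : ℝ) + 0 + 0 - k₀ - (netGain β k₀ + -netGain β k₀) = 0 by ring, abs_zero, zero_add]
    simpa [hX₁ v hv'] using h4
  by_cases hM : M < d v
  · simp only [optionSize, optionSingle, hv, hv', hM, if_true, if_false]
    rw [abs_le]
    constructor <;> linarith
  · simp only [optionSize, optionSingle, hv, hv', hM, if_false, netGain]
    rw [show meanSize β (d v) + singleProb β (d v) + 0 - d v -
      (meanSize β (d v) + singleProb β (d v) - d v + 0) = 0 by ring]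
    simp

theorem sum_not_isFree_le {k₀ : ℕ} (hR₀ : ∀ v ∈ R₀, d v = 1) (hX₁ : ∀ v ∈ X₁, d v = k₀) :
    ∑ v with ¬ IsFree d R₀ X₁ M v, d v ≤
      R₀.card + X₁.card * k₀ + ∑ v with M < d v, d v := by
  have h1 : (Finset.univ.filter fun v => ¬ IsFree d R₀ X₁ M v) ⊆
      (R₀ ∪ X₁) ∪ Finset.univ.filter fun v => M < d v := by
    intro v hv
    simp only [Finset.mem_filter, Finset.mem_univ, true_and, Finset.mem_union] at hv ⊢
    by_contra h
    push Not at h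
    exact hv ⟨h.1.1, h.1.2, h.2⟩
  calc _ ≤ ∑ v ∈ (R₀ ∪ X₁) ∪ Finset.univ.filter fun v => M < d v, d v :=
        Finset.sum_le_sum_of_subset h1
    _ ≤ ∑ v ∈ R₀ ∪ X₁, d v + ∑ v with M < d v, d v := by
        rw [← Finset.sum_union_inter]; exact Nat.le_add_right _ _
    _ ≤ (∑ v ∈ R₀, d v + ∑ v ∈ X₁, d v) + ∑ v with M < d v, d v := by
        refine Nat.add_le_add_right ?_ _
        rw [← Finset.sum_union_inter]; exact Nat.le_add_right _ _
    _ = _ := by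
        rw [Finset.sum_congr rfl hR₀, Finset.sum_congr rfl hX₁]; simp

end NetGain

section FiniteBound

variable {V : Type*} [DecidableEq V] [Fintype V] {d : V → ℕ} {R₀ X₁ : Finset V} {M : ℕ} {β : ℝ}

theorem card_filter_two_le_val (k : ℕ) :
    (Finset.univ.filter fun i : Fin k => 2 ≤ i.val).card = k - 2 := by
  rw [← Fintype.card_subtype]
  have e : {i : Fin k // 2 ≤ i.val} ≃ Fin (k - 2) :=
    { toFun := fun i => ⟨i.1.val - 2, by have := i.1.2; have := i.2; omega⟩
      invFun := fun i => ⟨⟨i.val + 2, by have := i.2; omega⟩, by simp⟩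
      left_inv := fun i => by
        have := i.2
        ext; simp; omega
      right_inv := fun i => by ext; simp }
  rw [Fintype.card_congr e, Fintype.card_fin]

theorem card_filter_sigma_two_le (X₁ : Finset V) {k₀ : ℕ} (hX₁ : ∀ v ∈ X₁, d v = k₀) :
    (Finset.univ.filter fun x : Σ v, Fin (d v) => x.1 ∈ X₁ ∧ 2 ≤ x.2.val).card =
      X₁.card * (k₀ - 2) := by
  have h : (Finset.univ.filter fun x : Σ v, Fin (d v) => x.1 ∈ X₁ ∧ 2 ≤ x.2.val) =
      X₁.sigma fun v => Finset.univ.filter fun i => 2 ≤ i.val := by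
    ext x; simp
  rw [h, Finset.card_sigma]
  simp only [card_filter_two_le_val]
  rw [Finset.sum_congr rfl fun v hv => by rw [hX₁ v hv]]
  simp

theorem exists_factorial_mul_le_numConn (hβ : 0 < β) (hβ' : β < 1) (hd : ∀ v, 0 < d v)
    (hR₀ : ∀ v ∈ R₀, d v = 1) {Q k₀ : ℕ} (hQ : R₀.card = Q) (hMQ : M + M * M ≤ Q)
    (hQe : Even Q) (hℓe : Even (∑ v, d v)) (hX₁ : ∀ v ∈ X₁, d v = k₀) (hk₀ : 3 ≤ k₀)
    (hk₀M : k₀ ≤ M) (hℓV : 2 * Fintype.card V ≤ ∑ v, d v) {δ e : ℝ} (hδ : 0 < δ)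
    (hδM : 4 * (Fintype.card V * (M : ℝ) ^ 2) ≤ δ ^ 2)
    (he : |∑ v, netGain β (d v)| + Q + 2 * (∑ v with M < d v, d v : ℕ) + 2 * δ ≤ e)
    (he₁ : e < X₁.card * -netGain β k₀)
    (he₂ : X₁.card * -netGain β k₀ + e ≤ X₁.card * (k₀ - 2)) :
    ∃ σ N : ℕ, σ ≤ ∑ v, d v ∧
      |(σ : ℝ) - ∑ v, meanSize β (d v)| ≤ δ + (∑ v with ¬ IsFree d R₀ X₁ M v, d v : ℕ) ∧
      |(N : ℝ) - ∑ v, singleProb β (d v)| ≤ δ + (∑ v with ¬ IsFree d R₀ X₁ M v, d v : ℕ) ∧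
      (∏ v, (1 - β ^ d v)) * (β * (1 - β)) ^ (∑ v with ¬ IsFree d R₀ X₁ M v, d v) *
        (N.factorial * Nat.doubleFactorial (∑ v, d v - Q - 2 * N) : ℕ) ≤
      numConn (Sigma.fst : (Σ v, Fin (d v)) → V) * (2 * (∑ v, d v + 1) ^ (Q + 4) : ℕ) *
        ((1 - β) ^ σ * β ^ (∑ v, d v - σ)) := by
  have hdis : ∀ v ∈ X₁, v ∉ R₀ := fun v hv hv' => by
    have := hR₀ v hv'; have := hX₁ v hv; omega
  obtain ⟨σ, N, 𝒯, hsel, hσℓ, hσ, hN, hle⟩ := exists_many_selections (R₀ := R₀) (X₁ := X₁)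
    (M := M) hβ hβ' hd (fun v hv => by rw [hX₁ v hv]; exact hk₀)
    (fun v hv => by rw [hX₁ v hv]; exact hk₀M) (fun v hv => by rw [hR₀ v hv]; omega) hdis hδ hδM
  have hbal := abs_sum_option_sub_le (M := M) hβ hβ' hd hR₀ hX₁ hdis
  rw [Finset.sum_add_distrib, hQ] at hbal
  have h1 := abs_le.1 hσ
  have h2 := abs_le.1 hN
  have h3 := abs_le.1 hbal
  have h4 := abs_le.1 (le_refl |∑ v, netGain β (d v)|)
  have hlow : (∑ v, (d v : ℝ)) < σ + N + Q := by linarith [h1.1, h2.1, h3.1, h4.1]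
  have hhigh : (σ : ℝ) + N + Q ≤ ∑ v, (d v : ℝ) + X₁.card * (k₀ - 2) := by
    linarith [h1.2, h2.2, h3.2, h4.2]
  have hlow' : ∑ v, d v < σ + N + Q := by exact_mod_cast hlow
  have hhigh' : σ + N + Q ≤ ∑ v, d v + X₁.card * (k₀ - 2) := by
    have : ((k₀ - 2 : ℕ) : ℝ) = k₀ - 2 := by push_cast [show 2 ≤ k₀ by omega]; ring
    rw [← this] at hhigh
    exact_mod_cast hhigh
  obtain ⟨E, hEsub, hEc⟩ := Finset.exists_subset_card_eq
    (s := Finset.univ.filter fun x : Σ v, Fin (d v) => x.1 ∈ X₁ ∧ 2 ≤ x.2.val)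
    (n := σ + N + Q - ∑ v, d v) (by rw [card_filter_sigma_two_le X₁ hX₁]; omega)
  have hmain := card_mul_factorial_le_numConn hd hR₀ hQ hMQ hQe hℓe
    (fun v hv => by rw [hX₁ v hv]; exact hk₀) (E := E)
    (fun x hx => by simpa using hEsub hx) (by omega) (by omega) hℓV hsel
  refine ⟨σ, N, hσℓ, ?_, ?_, ?_⟩
  · have := abs_sum_optionSize_sub_le (R₀ := R₀) (X₁ := X₁) (M := M) hβ hβ' hd
    exact (abs_sub_le _ _ _).trans (add_le_add hσ this)
  · have := abs_sum_optionSingle_sub_le (R₀ := R₀) (X₁ := X₁) (M := M) hβ hβ' hd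
    exact (abs_sub_le _ _ _).trans (add_le_add hN this)
  · set ℓ := ∑ v, d v with hℓ
    set F := N.factorial * Nat.doubleFactorial (ℓ - Q - 2 * N) with hF
    set nc := numConn (Sigma.fst : (Σ v, Fin (d v)) → V) with hnc
    set w := (1 - β) ^ σ * β ^ (ℓ - σ) with hw
    have hw0 : 0 ≤ w := mul_nonneg (pow_nonneg (by linarith) _) (by positivity)
    have hVℓ : Fintype.card V ≤ ℓ + 1 := by omega
    have hpoly : 2 * ((ℓ + 1) * (Fintype.card V + 1)) * (Fintype.card V * ℓ ^ Q * Fintype.card V) ≤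
        2 * (ℓ + 1) ^ (Q + 4) := by
      calc _ ≤ 2 * ((ℓ + 1) * (ℓ + 1)) * ((ℓ + 1) * (ℓ + 1) ^ Q * (ℓ + 1)) := by
            refine Nat.mul_le_mul (Nat.mul_le_mul_left _ (Nat.mul_le_mul_left _ (by omega))) ?_
            exact Nat.mul_le_mul (Nat.mul_le_mul hVℓ (Nat.pow_le_pow_left (by omega) _)) hVℓ
        _ = _ := by ring
    calc _ ≤ 2 * ((ℓ + 1) * (Fintype.card V + 1) : ℕ) * (𝒯.card * w) * (F : ℝ) :=
          mul_le_mul_of_nonneg_right hle (Nat.cast_nonneg _)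
      _ = 2 * ((ℓ + 1) * (Fintype.card V + 1) : ℕ) * w * ((𝒯.card * F : ℕ) : ℝ) := by
          push_cast; ring
      _ ≤ 2 * ((ℓ + 1) * (Fintype.card V + 1) : ℕ) * w *
          ((nc * (Fintype.card V * ℓ ^ Q * Fintype.card V) : ℕ) : ℝ) := by
          refine mul_le_mul_of_nonneg_left (by exact_mod_cast hmain) (by positivity)
      _ = nc * ((2 * ((ℓ + 1) * (Fintype.card V + 1)) *
          (Fintype.card V * ℓ ^ Q * Fintype.card V) : ℕ) : ℝ) * w := by push_cast; ring
      _ ≤ _ := by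
          refine mul_le_mul_of_nonneg_right ?_ hw0
          refine mul_le_mul_of_nonneg_left ?_ (Nat.cast_nonneg _)
          exact_mod_cast hpoly

end FiniteBound

section Sequence

open Filter Topology

theorem eventually_mul_le_of_tendsto_div {f : ℕ → ℝ} {a c : ℝ}
    (h : Tendsto (fun n : ℕ => f n / n) atTop (𝓝 a)) (hc : c < a) :
    ∀ᶠ n : ℕ in atTop, c * n ≤ f n := by
  filter_upwards [h.eventually (lt_mem_nhds hc), eventually_gt_atTop 0] with n hn hn0
  have : (0 : ℝ) < n := by exact_mod_cast hn0
  exact ((lt_div_iff₀ this).1 hn).le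

theorem eventually_abs_sub_mul_le_of_tendsto_div {f : ℕ → ℝ} {a η : ℝ}
    (h : Tendsto (fun n : ℕ => f n / n) atTop (𝓝 a)) (hη : 0 < η) :
    ∀ᶠ n : ℕ in atTop, |f n - a * n| ≤ η * n := by
  filter_upwards [h.eventually (Metric.ball_mem_nhds a hη), eventually_gt_atTop 0] with n hn hn0
  have h0 : (0 : ℝ) < n := by exact_mod_cast hn0
  rw [Real.dist_eq] at hn
  have h1 : f n - a * n = (f n / n - a) * n := by field_simp
  rw [h1, abs_mul, abs_of_pos h0]
  exact mul_le_mul_of_nonneg_right hn.le h0.le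

variable {d : (n : ℕ) → Fin n → ℕ} {p : ℕ → ℝ} {β : ℝ}

theorem DegreeLimit.exists_three_le (D : DegreeLimit d p) : ∃ k, 3 ≤ k ∧ 0 < p k := by
  by_contra h
  push Not at h
  have h1 : ∑' i : ℕ, (i : ℝ) * p i ≤ ∑' i : ℕ, 2 * p i := by
    refine D.summable.tsum_le_tsum (fun k => ?_) (D.sum.summable.mul_left 2)
    rcases lt_or_ge k 3 with hk | hk
    · refine mul_le_mul_of_nonneg_right ?_ (D.nonneg k)
      exact_mod_cast Nat.lt_succ_iff.1 hk
    · rw [le_antisymm (h k hk) (D.nonneg k)]; simp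
  rw [tsum_mul_left, D.sum.tsum_eq] at h1
  linarith [D.two]

theorem tsum_mul_meanSize (hb : β ∈ Set.Ioo (0 : ℝ) 1)
    (hfix : ∑' k : ℕ, (k : ℝ) * p k = (1 - β ^ 2) * ∑' k : ℕ, (k : ℝ) * p k / (1 - β ^ k)) :
    ∑' k, p k * meanSize β k = (∑' k : ℕ, (k : ℝ) * p k) / (1 + β) := by
  have h1 : ∀ k : ℕ, p k * meanSize β k = (1 - β) * ((k : ℝ) * p k / (1 - β ^ k)) := fun k => by
    unfold meanSize; ring
  simp only [h1]
  have h2 : 1 + β ≠ 0 := by linarith [hb.1]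
  rw [tsum_mul_left, eq_div_iff h2, hfix]
  ring

theorem DegreeLimit.tsum_mul_singleProb (D : DegreeLimit d p) (hb : β ∈ Set.Ioo (0 : ℝ) 1)
    (hfix : ∑' k : ℕ, (k : ℝ) * p k = (1 - β ^ 2) * ∑' k : ℕ, (k : ℝ) * p k / (1 - β ^ k)) :
    ∑' k, p k * singleProb β k = (∑' k : ℕ, (k : ℝ) * p k) * β / (1 + β) := by
  have hb0 : β ≠ 0 := hb.1.ne'
  have h1 : ∀ k : ℕ, p k * singleProb β k =
      (1 - β) / β * ((k : ℝ) * (p k * β ^ k / (1 - β ^ k))) := fun k => by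
    rcases k with _ | k
    · simp [singleProb]
    · have := pow_lt_one₀ hb.1.le hb.2 (show k + 1 ≠ 0 by omega)
      have h3 : 1 - β ^ (k + 1) ≠ 0 := by linarith
      rw [singleProb, Nat.add_sub_cancel]
      field_simp
      ring
  simp only [h1]
  have h2 : 1 + β ≠ 0 := by linarith [hb.1]
  have h4 : 1 - β ≠ 0 := by linarith [hb.2]
  have h3 : 1 - β ^ 2 ≠ 0 := by
    rw [show 1 - β ^ 2 = (1 - β) * (1 + β) by ring]; exact mul_ne_zero h4 h2
  rw [tsum_mul_left, (hasSum_extraMass D hb hfix).tsum_eq]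
  rw [show 1 - β ^ 2 = (1 - β) * (1 + β) by ring]
  field_simp

theorem DegreeLimit.tendsto_sum_netGain (D : DegreeLimit d p) (hb : β ∈ Set.Ioo (0 : ℝ) 1)
    (hfix : ∑' k : ℕ, (k : ℝ) * p k = (1 - β ^ 2) * ∑' k : ℕ, (k : ℝ) * p k / (1 - β ^ k)) :
    Tendsto (fun n : ℕ => (∑ v, netGain β (d n v)) / n) atTop (𝓝 0) := by
  have h1 := D.tendsto_sum (h := meanSize β) (C := 1) fun k => by
    rw [abs_of_nonneg (meanSize_nonneg hb.1 hb.2 k), one_mul]; exact meanSize_le hb.1 hb.2 k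
  have h2 := D.tendsto_sum (h := singleProb β) (C := 1) fun k => by
    rw [abs_of_nonneg (singleProb_nonneg hb.1 hb.2 k), one_mul]; exact singleProb_le hb.1 hb.2 k
  have h3 := (h1.add h2).sub D.tendsto_mean
  rw [tsum_mul_meanSize hb hfix, D.tsum_mul_singleProb hb hfix] at h3
  have h4 : 1 + β ≠ 0 := by linarith [hb.1]
  convert h3 using 1
  · funext n
    simp only [netGain, Finset.sum_sub_distrib, Finset.sum_add_distrib]
    push_cast
    ring
  · congr 1
    field_simp
    ring

theorem DegreeLimit.tendsto_log_poly (D : DegreeLimit d p) (q : ℕ) :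
    Tendsto (fun n : ℕ => Real.log (2 * (∑ v, d n v + 1) ^ q : ℕ) / n) atTop (𝓝 0) := by
  have h1 : Tendsto (fun n : ℕ => Real.log 2 * (n : ℝ)⁻¹) atTop (𝓝 0) := by
    simpa using tendsto_inv_atTop_nhds_zero_nat (𝕜 := ℝ).const_mul (Real.log 2)
  have h2 := h1.add ((tendsto_log_div D.tendsto_mean).const_mul (q : ℝ))
  rw [mul_zero, add_zero] at h2
  refine h2.congr fun n => ?_
  push_cast
  rw [Real.log_mul (by norm_num) (by positivity), Real.log_pow]
  ring

theorem DegreeLimit.eventually_exists_factorial_mul_le (D : DegreeLimit d p)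
    (hb : β ∈ Set.Ioo (0 : ℝ) 1)
    (hfix : ∑' k : ℕ, (k : ℝ) * p k = (1 - β ^ 2) * ∑' k : ℕ, (k : ℝ) * p k / (1 - β ^ k))
    {η : ℝ} (hη : 0 < η) :
    ∀ᶠ n : ℕ in atTop, ∃ σ N e Q : ℕ, Even Q ∧ σ ≤ ∑ v, d n v ∧
      |(σ : ℝ) - (∑' k : ℕ, (k : ℝ) * p k) / (1 + β) * n| ≤ η * n ∧
      |(N : ℝ) - (∑' k : ℕ, (k : ℝ) * p k) * β / (1 + β) * n| ≤ η * n ∧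
      (e : ℝ) ≤ η * n ∧ (Q : ℝ) ≤ η * n ∧
      Real.log (2 * (∑ v, d n v + 1) ^ (Q + 4) : ℕ) ≤ η * n ∧
      (∏ v, (1 - β ^ d n v)) * (β * (1 - β)) ^ e *
        (N.factorial * Nat.doubleFactorial (∑ v, d n v - Q - 2 * N) : ℕ) ≤
      numConn (Sigma.fst : (Σ v, Fin (d n v)) → Fin n) * (2 * (∑ v, d n v + 1) ^ (Q + 4) : ℕ) *
        ((1 - β) ^ σ * β ^ (∑ v, d n v - σ)) := by
  obtain ⟨k₀, hk₀, hpk⟩ := D.exists_three_le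
  have hκ := neg_netGain_pos hb.1 hb.2 hk₀
  have hκ' := neg_netGain_lt hb.1 hb.2 hk₀
  set κ := -netGain β k₀ with hκdef
  obtain ⟨g, hg0, hg1, hg2⟩ : ∃ g > 0, g ≤ κ ∧ g ≤ k₀ - 2 - κ :=
    ⟨min κ (k₀ - 2 - κ), lt_min hκ (by linarith), min_le_left _ _, min_le_right _ _⟩
  have hk₀0 : (0 : ℝ) < k₀ := by exact_mod_cast (by omega : 0 < k₀)
  obtain ⟨θ, hθ0, hθ1, hθ2⟩ : ∃ θ > 0, θ < p k₀ ∧ θ * k₀ ≤ η / 8 :=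
    ⟨min (p k₀ / 2) (η / 8 / k₀), lt_min (by linarith) (by positivity),
      (min_le_left _ _).trans_lt (by linarith), by
        rw [← le_div_iff₀ hk₀0]; exact min_le_right _ _⟩
  obtain ⟨ε, hε0, hε1, hε2⟩ : ∃ ε > 0, ε ≤ η / 8 ∧ 32 * ε ≤ θ * g :=
    ⟨min (η / 8) (θ * g / 32), lt_min (by positivity) (by positivity), min_le_left _ _, by
      have := min_le_right (η / 8) (θ * g / 32); linarith⟩
  obtain ⟨M₀, hM₀⟩ := D.exists_tail hε0
  set M := max M₀ k₀ with hM
  have hQe : Even (M + M * M) := by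
    rw [show M + M * M = M * (M + 1) by ring]; exact Nat.even_mul_succ_self M
  have hsize := D.tendsto_sum (h := meanSize β) (C := 1) fun k => by
    rw [abs_of_nonneg (meanSize_nonneg hb.1 hb.2 k), one_mul]; exact meanSize_le hb.1 hb.2 k
  have hsingle := D.tendsto_sum (h := singleProb β) (C := 1) fun k => by
    rw [abs_of_nonneg (singleProb_nonneg hb.1 hb.2 k), one_mul]; exact singleProb_le hb.1 hb.2 k
  rw [tsum_mul_meanSize hb hfix] at hsize
  rw [D.tsum_mul_singleProb hb hfix] at hsingle
  have hη2 : 0 < η / 2 := by positivity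
  have hlin : ∀ c : ℝ, ∀ a > 0, ∀ᶠ n : ℕ in atTop, c ≤ a * (n : ℝ) := fun c a ha =>
    (tendsto_natCast_atTop_atTop.const_mul_atTop ha).eventually_ge_atTop c
  filter_upwards [hM₀ M (le_max_left _ _),
    eventually_abs_sub_mul_le_of_tendsto_div hsize hη2,
    eventually_abs_sub_mul_le_of_tendsto_div hsingle hη2,
    eventually_abs_sub_mul_le_of_tendsto_div (D.tendsto_sum_netGain hb hfix) hε0,
    eventually_abs_sub_mul_le_of_tendsto_div (D.tendsto_log_poly (M + M * M + 4)) hη,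
    eventually_mul_le_of_tendsto_div D.tendsto_mean D.two,
    eventually_mul_le_of_tendsto_div (D.tendsto k₀) hθ1,
    eventually_mul_le_of_tendsto_div (D.tendsto 1) (half_lt_self D.one),
    hlin ((M + M * M : ℕ) : ℝ) (p 1 / 2) (half_pos D.one), hlin ((M + M * M : ℕ) : ℝ) ε hε0,
    hlin 2 θ hθ0, hlin (4 * (M : ℝ) ^ 2) (ε ^ 2) (by positivity), eventually_gt_atTop 0]
    with n htail hsz hsg hnet hlog hmean hcard hcard1 hQ1 hQ2 hθn hMn hn0
  have hn : (0 : ℝ) < n := by exact_mod_cast hn0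
  obtain ⟨R₀, hR₀s, hR₀c⟩ := Finset.exists_subset_card_eq
    (s := Finset.univ.filter fun j => d n j = 1) (n := M + M * M) (by
      exact_mod_cast hQ1.trans hcard1)
  obtain ⟨X₁, hX₁s, hX₁c⟩ := Finset.exists_subset_card_eq
    (s := Finset.univ.filter fun j => d n j = k₀) (n := ⌊θ * n⌋₊) (by
      exact_mod_cast (Nat.floor_le (by positivity)).trans hcard)
  have hR₀ : ∀ v ∈ R₀, d n v = 1 := fun v hv => by simpa using hR₀s hv
  have hX₁ : ∀ v ∈ X₁, d n v = k₀ := fun v hv => by simpa using hX₁s hv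
  have hx1 : (X₁.card : ℝ) ≤ θ * n := by rw [hX₁c]; exact Nat.floor_le (by positivity)
  have hx2 : θ * n / 2 ≤ X₁.card := by
    have := Nat.lt_floor_add_one (θ * n)
    rw [hX₁c]; linarith
  simp only [zero_mul, sub_zero] at hnet hlog
  have hxg : 16 * (ε * n) ≤ X₁.card * g := by
    calc 16 * (ε * n) = (32 * ε) * n / 2 := by ring
      _ ≤ (θ * g) * n / 2 := by gcongr
      _ = θ * n / 2 * g := by ring
      _ ≤ _ := mul_le_mul_of_nonneg_right hx2 hg0.le
  have hεn : 0 < ε * n := by positivity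
  have hxκ : X₁.card * g ≤ X₁.card * κ := mul_le_mul_of_nonneg_left hg1 (Nat.cast_nonneg _)
  have hxκ' : X₁.card * g ≤ X₁.card * (k₀ - 2 - κ) :=
    mul_le_mul_of_nonneg_left hg2 (Nat.cast_nonneg _)
  obtain ⟨σ, N, hσℓ, hσ, hN, hle⟩ := exists_factorial_mul_le_numConn (R₀ := R₀) (X₁ := X₁) (M := M)
    hb.1 hb.2 (D.pos n) hR₀ hR₀c le_rfl hQe (D.even n) hX₁ hk₀ (le_max_right _ _)
    (by rw [Fintype.card_fin]; exact_mod_cast hmean) hεn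
    (by
      rw [Fintype.card_fin]
      calc 4 * ((n : ℝ) * (M : ℝ) ^ 2) = 4 * (M : ℝ) ^ 2 * n := by ring
        _ ≤ ε ^ 2 * n * n := mul_le_mul_of_nonneg_right hMn hn.le
        _ = (ε * n) ^ 2 := by ring)
    (e := 6 * (ε * n)) (by linarith) (by linarith) (by linarith)
  have hD : ((∑ v with ¬ IsFree (d n) R₀ X₁ M v, d n v : ℕ) : ℝ) ≤ 3 * η / 8 * n := by
    have h1 := sum_not_isFree_le (M := M) hR₀ hX₁
    rw [hR₀c] at h1
    have h2 : ((∑ v with ¬ IsFree (d n) R₀ X₁ M v, d n v : ℕ) : ℝ) ≤ (M + M * M : ℕ) +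
        X₁.card * k₀ + (∑ v with M < d n v, d n v : ℕ) := by exact_mod_cast h1
    have h3 : (X₁.card : ℝ) * k₀ ≤ η / 8 * n := by
      calc (X₁.card : ℝ) * k₀ ≤ θ * n * k₀ := mul_le_mul_of_nonneg_right hx1 hk₀0.le
        _ = θ * k₀ * n := by ring
        _ ≤ _ := mul_le_mul_of_nonneg_right hθ2 hn.le
    have h4 : ε * n ≤ η / 8 * n := mul_le_mul_of_nonneg_right hε1 hn.le
    linarith
  have h4 : ε * n ≤ η / 8 * n := mul_le_mul_of_nonneg_right hε1 hn.le
  have h5 : 0 < η * n := by positivity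
  refine ⟨σ, N, _, _, hQe, hσℓ, ?_, ?_, ?_, ?_, (le_abs_self _).trans hlog, hle⟩
  · refine (abs_sub_le _ _ _).trans ((add_le_add hσ hsz).trans ?_)
    linarith
  · refine (abs_sub_le _ _ _).trans ((add_le_add hN hsg).trans ?_)
    linarith
  · linarith
  · linarith

end Sequence

section Limits

open Filter Topology

theorem exists_tendsto_zero_eventually {P : ℝ → ℕ → Prop} (h : ∀ η > 0, ∀ᶠ n in atTop, P η n) :
    ∃ e : ℕ → ℝ, Tendsto e atTop (𝓝 0) ∧ ∀ᶠ n in atTop, P (e n) n := by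
  have h' : ∀ k : ℕ, ∃ N, ∀ n ≥ N, P (1 / ((k : ℝ) + 1)) n := fun k =>
    eventually_atTop.1 (h _ Nat.one_div_pos_of_nat)
  choose N hN using h'
  have ht : Tendsto (fun n => Nat.findGreatest (fun k => N k ≤ n) n) atTop atTop :=
    tendsto_atTop.2 fun K => by
      filter_upwards [eventually_ge_atTop K, eventually_ge_atTop (N K)] with n h1 h2
      exact Nat.le_findGreatest h1 h2
  refine ⟨fun n => 1 / ((Nat.findGreatest (fun k => N k ≤ n) n : ℕ) + 1),
    tendsto_one_div_add_atTop_nhds_zero_nat.comp ht, ?_⟩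
  filter_upwards [eventually_ge_atTop (N 0)] with n hn
  exact hN _ n (Nat.findGreatest_spec (P := fun k => N k ≤ n) (Nat.zero_le n) hn)

theorem tendsto_div_of_abs_sub_le {a : ℕ → ℕ} {e : ℕ → ℝ} {α : ℝ} (he : Tendsto e atTop (𝓝 0))
    (h : ∀ᶠ n : ℕ in atTop, |(a n : ℝ) - α * n| ≤ e n * n) :
    Tendsto (fun n => (a n : ℝ) / n) atTop (𝓝 α) := by
  rw [tendsto_iff_dist_tendsto_zero]
  refine squeeze_zero' (Eventually.of_forall fun _ => dist_nonneg) ?_ he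
  filter_upwards [h, eventually_gt_atTop 0] with n h1 hn
  have hn' : (0 : ℝ) < n := by exact_mod_cast hn
  rw [Real.dist_eq, show (a n : ℝ) / n - α = (a n - α * n) / n by field_simp, abs_div,
    abs_of_pos hn']
  exact div_le_of_le_mul₀ hn'.le ((mul_nonneg_iff_of_pos_right hn').1 ((abs_nonneg _).trans h1)) h1

theorem abs_log_one_sub_pow_le {b : ℝ} (hb : b ∈ Set.Ioo (0 : ℝ) 1) (k : ℕ) :
    |Real.log (1 - b ^ k)| ≤ |Real.log (1 - b)| * k := by
  rcases eq_or_ne k 0 with rfl | hk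
  · simp
  have h1 : 0 < 1 - b := sub_pos.2 hb.2
  have h2 : b ^ k ≤ b := pow_le_of_le_one hb.1.le hb.2.le hk
  have h3 : 0 < b ^ k := pow_pos hb.1 k
  have h4 : (1 : ℝ) ≤ k := by exact_mod_cast Nat.one_le_iff_ne_zero.2 hk
  rw [abs_of_nonpos (Real.log_nonpos (by linarith) (by linarith)),
    abs_of_nonpos (Real.log_nonpos h1.le (by linarith [hb.1]))]
  have h5 := Real.log_le_log h1 (by linarith : 1 - b ≤ 1 - b ^ k)
  nlinarith [Real.log_nonpos h1.le (by linarith [hb.1] : 1 - b ≤ 1)]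

theorem rate_identity {μ b S : ℝ} (hμ : 0 < μ) (hb : b ∈ Set.Ioo (0 : ℝ) 1) :
    S + (μ * b / (1 + b) * Real.log (μ * b / (1 + b)) - μ * b / (1 + b)) +
      ((μ - 2 * (μ * b / (1 + b))) * Real.log (μ - 2 * (μ * b / (1 + b))) -
        (μ - 2 * (μ * b / (1 + b)))) / 2 - (μ * Real.log μ - μ) / 2 -
      μ / (1 + b) * Real.log (1 - b) - (μ - μ / (1 + b)) * Real.log b =
    -(μ / 2 * Real.log (1 - b ^ 2) - S) := by
  have hb0 := hb.1
  have h1 : 0 < 1 - b := sub_pos.2 hb.2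
  have h2 : 0 < 1 + b := by linarith
  have h3 : μ - 2 * (μ * b / (1 + b)) = μ * (1 - b) / (1 + b) := by field_simp; ring
  have h4 : 1 - b ^ 2 = (1 - b) * (1 + b) := by ring
  rw [h3, h4, Real.log_div (by positivity) h2.ne', Real.log_div (by positivity) h2.ne',
    Real.log_mul hμ.ne' hb0.ne', Real.log_mul hμ.ne' h1.ne', Real.log_mul h1.ne' h2.ne']
  field_simp
  ring

variable {d : (n : ℕ) → Fin n → ℕ} {p : ℕ → ℝ}

theorem DegreeLimit.le_sum (D : DegreeLimit d p) (n : ℕ) : n ≤ ∑ v, d n v := by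
  simpa using Finset.card_nsmul_le_sum Finset.univ (d n) 1 fun v _ => D.pos n v

theorem log_le_of_factorial_mul_le {ι : Type*} [Fintype ι] {c : ι → ℕ} (hc : ∀ v, 0 < c v) {b : ℝ}
    (hb : b ∈ Set.Ioo (0 : ℝ) 1) {σ N e a K C : ℕ} (hC : 0 < C) (hσ : σ ≤ ∑ v, c v)
    (h : (∏ v, (1 - b ^ c v)) * (b * (1 - b)) ^ e * (N.factorial * Nat.doubleFactorial a : ℕ) ≤
      K * C * ((1 - b) ^ σ * b ^ (∑ v, c v - σ))) :
    0 < K ∧ ∑ v, Real.log (1 - b ^ c v) + e * Real.log (b * (1 - b)) +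
      Real.log (N.factorial : ℝ) + Real.log (Nat.doubleFactorial (a - 1) : ℝ) - Real.log C -
      σ * Real.log (1 - b) - (((∑ v, c v : ℕ) : ℝ) - σ) * Real.log b ≤ Real.log K := by
  have h1 : 0 < 1 - b := sub_pos.2 hb.2
  have hb0 := hb.1
  have h2 : ∀ v, 0 < 1 - b ^ c v := fun v => sub_pos.2 (pow_lt_one₀ hb0.le hb.2 (hc v).ne')
  have h3 : 0 < ∏ v, (1 - b ^ c v) := Finset.prod_pos fun v _ => h2 v
  have h4 : (0 : ℝ) < Nat.doubleFactorial a := by exact_mod_cast Nat.doubleFactorial_pos a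
  have h4' : (0 : ℝ) < Nat.doubleFactorial (a - 1) := by exact_mod_cast Nat.doubleFactorial_pos _
  have h5 : (0 : ℝ) < C := by exact_mod_cast hC
  have h6 : (0 : ℝ) < N.factorial := by exact_mod_cast N.factorial_pos
  push_cast at h
  have hK : 0 < K := by
    rcases Nat.eq_zero_or_pos K with rfl | hK
    · have : 0 < (∏ v, (1 - b ^ c v)) * (b * (1 - b)) ^ e *
        ((N.factorial : ℝ) * Nat.doubleFactorial a) := by positivity
      simp only [Nat.cast_zero, zero_mul] at h
      linarith
    · exact hK
  refine ⟨hK, ?_⟩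
  have hK' : (0 : ℝ) < K := by exact_mod_cast hK
  have hl := Real.log_le_log (by positivity) h
  rw [Real.log_mul (by positivity) (by positivity), Real.log_mul (by positivity) (by positivity),
    Real.log_mul (by positivity) (by positivity), Real.log_mul (by positivity) (by positivity),
    Real.log_mul (by positivity) (by positivity), Real.log_mul (by positivity) (by positivity),
    Real.log_pow, Real.log_pow, Real.log_pow, Real.log_prod fun v _ => (h2 v).ne',
    Nat.cast_sub hσ] at hl
  have h7 := Real.log_le_log h4'
    (by exact_mod_cast doubleFactorial_mono (Nat.sub_le a 1) :
      (Nat.doubleFactorial (a - 1) : ℝ) ≤ Nat.doubleFactorial a)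
  linarith

theorem DegreeLimit.exp_le_numConn (D : DegreeLimit d p) {ε : ℝ} (hε : 0 < ε) :
    ∀ᶠ n : ℕ in atTop, Nat.doubleFactorial (∑ v, d n v - 1) * Real.exp (n * (-Kof p - ε)) ≤
      (numConn (Sigma.fst : (Σ v, Fin (d n v)) → Fin n) : ℝ) := by
  obtain ⟨hb, hfix⟩ := betaOf_spec D
  set b := betaOf p with hbdef
  set μ := ∑' k : ℕ, (k : ℝ) * p k with hμ
  have hμ0 : 0 < μ := by linarith [D.two]
  have hb0 := hb.1
  have h1b : 0 < 1 - b := sub_pos.2 hb.2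
  obtain ⟨η, hη, hev⟩ := exists_tendsto_zero_eventually fun η hη =>
    D.eventually_exists_factorial_mul_le hb hfix (η := η) hη
  obtain ⟨n₀, hn₀⟩ := eventually_atTop.1 hev
  have hex : ∀ n, ∃ q : ℕ × ℕ × ℕ × ℕ, Even q.2.2.2 ∧ (n₀ ≤ n → q.1 ≤ ∑ v, d n v ∧
      |(q.1 : ℝ) - μ / (1 + b) * n| ≤ η n * n ∧
      |(q.2.1 : ℝ) - μ * b / (1 + b) * n| ≤ η n * n ∧
      (q.2.2.1 : ℝ) ≤ η n * n ∧ (q.2.2.2 : ℝ) ≤ η n * n ∧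
      Real.log (2 * (∑ v, d n v + 1) ^ (q.2.2.2 + 4) : ℕ) ≤ η n * n ∧
      (∏ v, (1 - b ^ d n v)) * (b * (1 - b)) ^ q.2.2.1 *
        (q.2.1.factorial * Nat.doubleFactorial (∑ v, d n v - q.2.2.2 - 2 * q.2.1) : ℕ) ≤
      numConn (Sigma.fst : (Σ v, Fin (d n v)) → Fin n) *
        (2 * (∑ v, d n v + 1) ^ (q.2.2.2 + 4) : ℕ) *
        ((1 - b) ^ q.1 * b ^ (∑ v, d n v - q.1))) := by
    intro n
    by_cases hn : n₀ ≤ n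
    · obtain ⟨σ, N, e, Q, h⟩ := hn₀ n hn
      exact ⟨(σ, N, e, Q), h.1, fun _ => h.2⟩
    · exact ⟨0, by simp, fun h => absurd h hn⟩
  choose q hqev hq using hex
  set σ : ℕ → ℕ := fun n => (q n).1 with hσ
  set N : ℕ → ℕ := fun n => (q n).2.1 with hN
  set e : ℕ → ℕ := fun n => (q n).2.2.1 with he
  set Q : ℕ → ℕ := fun n => (q n).2.2.2 with hQ
  set L : ℕ → ℕ := fun n => ∑ v, d n v with hL
  set C : ℕ → ℕ := fun n => 2 * (L n + 1) ^ (Q n + 4) with hC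
  set a : ℕ → ℕ := fun n => L n - Q n - 2 * N n with ha
  have hbig : ∀ᶠ n in atTop, n₀ ≤ n := eventually_ge_atTop n₀
  have tσ : Tendsto (fun n => (σ n : ℝ) / n) atTop (𝓝 (μ / (1 + b))) :=
    tendsto_div_of_abs_sub_le hη (hbig.mono fun n hn => (hq n hn).2.1)
  have tN : Tendsto (fun n => (N n : ℝ) / n) atTop (𝓝 (μ * b / (1 + b))) :=
    tendsto_div_of_abs_sub_le hη (hbig.mono fun n hn => (hq n hn).2.2.1)
  have te : Tendsto (fun n => (e n : ℝ) / n) atTop (𝓝 0) :=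
    tendsto_div_of_abs_sub_le hη (hbig.mono fun n hn => by
      rw [zero_mul, sub_zero, Nat.abs_cast]; exact (hq n hn).2.2.2.1)
  have tQ : Tendsto (fun n => (Q n : ℝ) / n) atTop (𝓝 0) :=
    tendsto_div_of_abs_sub_le hη (hbig.mono fun n hn => by
      rw [zero_mul, sub_zero, Nat.abs_cast]; exact (hq n hn).2.2.2.2.1)
  have hC1 : ∀ n, 1 ≤ C n := fun n => Nat.succ_le_of_lt (by positivity)
  have tC : Tendsto (fun n => Real.log (C n) / n) atTop (𝓝 0) := by
    refine squeeze_zero' (Eventually.of_forall fun n => ?_) ?_ hη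
    · exact div_nonneg (Real.log_nonneg (by exact_mod_cast hC1 n)) (Nat.cast_nonneg n)
    · filter_upwards [hbig, eventually_gt_atTop 0] with n hn hn0
      exact (div_le_iff₀ (by exact_mod_cast hn0)).2 (hq n hn).2.2.2.2.2.1
  have tQlog : Tendsto (fun n => (Q n : ℝ) * Real.log n / n) atTop (𝓝 0) := by
    refine squeeze_zero' (Eventually.of_forall fun n => ?_) ?_ tC
    · exact div_nonneg (mul_nonneg (Nat.cast_nonneg _) (Real.log_natCast_nonneg n))
        (Nat.cast_nonneg n)
    · filter_upwards [eventually_gt_atTop 0] with n hn0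
      have hn' : (0 : ℝ) < n := by exact_mod_cast hn0
      refine div_le_div_of_nonneg_right ?_ hn'.le
      rw [← Real.log_pow]
      refine Real.log_le_log (by positivity) ?_
      norm_cast
      calc n ^ Q n ≤ (L n + 1) ^ Q n := Nat.pow_le_pow_left ((D.le_sum n).trans (Nat.le_succ _)) _
        _ ≤ (L n + 1) ^ (Q n + 4) := Nat.pow_le_pow_right (Nat.succ_pos _) (Nat.le_add_right _ _)
        _ ≤ C n := Nat.le_mul_of_pos_left _ two_pos
  have tL : Tendsto (fun n => (L n : ℝ) / n) atTop (𝓝 μ) := D.tendsto_mean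
  have taux : Tendsto (fun n => ((L n : ℝ) - Q n - 2 * N n) / n) atTop
      (𝓝 (μ - 2 * (μ * b / (1 + b)))) := by
    have := (tL.sub tQ).sub (tN.const_mul 2)
    rw [sub_zero] at this
    exact this.congr fun n => by ring
  have hpos : 0 < μ - 2 * (μ * b / (1 + b)) := by
    have : μ - 2 * (μ * b / (1 + b)) = μ * (1 - b) / (1 + b) := by field_simp; ring
    rw [this]; positivity
  have hacast : ∀ᶠ n in atTop, (a n : ℝ) = (L n : ℝ) - Q n - 2 * N n := by
    filter_upwards [taux.eventually (lt_mem_nhds hpos), eventually_gt_atTop 0] with n h hn0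
    have hn' : (0 : ℝ) < n := by exact_mod_cast hn0
    have h2 : (0 : ℝ) < (L n : ℝ) - Q n - 2 * N n := by
      by_contra hneg
      exact absurd h (not_lt.2 (div_nonpos_of_nonpos_of_nonneg (not_lt.1 hneg) hn'.le))
    have h3 : Q n + 2 * N n ≤ L n := by
      have : ((Q n + 2 * N n : ℕ) : ℝ) ≤ L n := by push_cast; linarith
      exact_mod_cast this
    rw [ha]
    simp only
    rw [Nat.sub_sub, Nat.cast_sub h3]
    push_cast; ring
  have ta : Tendsto (fun n => (a n : ℝ) / n) atTop (𝓝 (μ - 2 * (μ * b / (1 + b)))) :=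
    taux.congr' (hacast.mono fun n hn => by simp only [hn])
  have haev : ∀ n, Even (a n) := fun n => by
    obtain ⟨x, hx⟩ := D.even n
    obtain ⟨y, hy⟩ := hqev n
    exact ⟨x - y - N n, by simp only [ha, hL, hQ]; omega⟩
  have tS := D.tendsto_sum (abs_log_one_sub_pow_le hb)
  have tall := (((((((tS.add (te.mul_const (Real.log (b * (1 - b))))).add
    (tendsto_log_factorial tN)).add (tendsto_log_doubleFactorial haev ta)).sub
    (tendsto_log_doubleFactorial D.even tL)).sub tC).sub (tσ.mul_const (Real.log (1 - b)))).sub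
    ((tL.sub tσ).mul_const (Real.log b))).sub (tQlog.div_const 2)
  have hval := rate_identity (S := ∑' k, p k * Real.log (1 - b ^ k)) hμ0 hb
  have hlim : ∀ᶠ n : ℕ in atTop, -Kof p - ε < _ :=
    tall.eventually (lt_mem_nhds (by rw [Kof, ← hbdef, ← hμ, ← hval]; linarith))
  filter_upwards [hlim, hacast, hbig, eventually_gt_atTop 0] with n h1 h2 h3 hn0
  have hn' : (0 : ℝ) < n := by exact_mod_cast hn0
  obtain ⟨hK, h4⟩ := log_le_of_factorial_mul_le (D.pos n) hb (hC1 n) (hq n h3).1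
    (hq n h3).2.2.2.2.2.2
  have hK' : (0 : ℝ) < numConn (Sigma.fst : (Σ v, Fin (d n v)) → Fin n) := by exact_mod_cast hK
  have hdf : (0 : ℝ) < Nat.doubleFactorial (∑ v, d n v - 1) := by
    exact_mod_cast Nat.doubleFactorial_pos _
  rw [← Real.log_le_log_iff (by positivity) hK', Real.log_mul hdf.ne' (Real.exp_ne_zero _),
    Real.log_exp]
  refine le_trans ?_ h4
  have h5 := mul_lt_mul_of_pos_left h1 hn'
  rw [h2] at h5
  field_simp at h5
  linarith

theorem DegreeLimit.tendsto_log_numConn (D : DegreeLimit d p) :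
    Tendsto (fun n : ℕ => (1 / (n : ℝ)) *
      Real.log ((numConn (Sigma.fst : (Σ v, Fin (d n v)) → Fin n) : ℝ) /
        Nat.doubleFactorial (∑ v, d n v - 1))) atTop (𝓝 (-Kof p)) := by
  refine Metric.tendsto_nhds.2 fun ε hε => ?_
  filter_upwards [D.numConn_le_exp (half_pos hε), D.exp_le_numConn (half_pos hε),
    eventually_gt_atTop 0] with n h1 h2 hn0
  have hn' : (0 : ℝ) < n := by exact_mod_cast hn0
  have hdf : (0 : ℝ) < Nat.doubleFactorial (∑ v, d n v - 1) := by
    exact_mod_cast Nat.doubleFactorial_pos _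
  have hK : (0 : ℝ) < numConn (Sigma.fst : (Σ v, Fin (d n v)) → Fin n) :=
    lt_of_lt_of_le (by positivity) h2
  have h3 := (Real.log_le_iff_le_exp (div_pos hK hdf)).2 ((div_le_iff₀' hdf).2 h1)
  have h4 := (Real.le_log_iff_exp_le (div_pos hK hdf)).2 ((le_div_iff₀' hdf).2 h2)
  rw [Real.dist_eq, one_div_mul_eq_div]
  rw [← div_le_iff₀' hn'] at h3
  rw [← le_div_iff₀' hn'] at h4
  rw [abs_lt]
  constructor <;> linarith

theorem numSimple_le_doubleFactorial {V : Type*} [Fintype V] (c : V → ℕ)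
    (hc : Even (∑ v, c v)) :
    numSimple (Sigma.fst : (Σ v, Fin (c v)) → V) ≤ Nat.doubleFactorial (∑ v, c v - 1) := by
  classical
  rw [← card_filter_isMatching c hc, numSimple]
  exact Finset.card_le_card fun F => by simp +contextual

theorem DegreeLimit.tendsto_log_numSimple (D : DegreeLimit d p) :
    Tendsto (fun n : ℕ => (1 / (n : ℝ)) *
      Real.log ((numSimple (Sigma.fst : (Σ v, Fin (d n v)) → Fin n) : ℝ) /
        Nat.doubleFactorial (∑ v, d n v - 1))) atTop (𝓝 0) := by
  refine Metric.tendsto_nhds.2 fun ε hε => ?_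
  filter_upwards [D.exp_le_numSimple (half_pos hε), eventually_gt_atTop 0] with n h2 hn0
  have hn' : (0 : ℝ) < n := by exact_mod_cast hn0
  have hdf : (0 : ℝ) < Nat.doubleFactorial (∑ v, d n v - 1) := by
    exact_mod_cast Nat.doubleFactorial_pos _
  have hK : (0 : ℝ) < numSimple (Sigma.fst : (Σ v, Fin (d n v)) → Fin n) :=
    lt_of_lt_of_le (by positivity) h2
  have h1 : (numSimple (Sigma.fst : (Σ v, Fin (d n v)) → Fin n) : ℝ) ≤
      Nat.doubleFactorial (∑ v, d n v - 1) := by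
    exact_mod_cast numSimple_le_doubleFactorial _ (D.even n)
  have h3 := Real.log_nonpos (div_pos hK hdf).le ((div_le_one hdf).2 h1)
  have h4 := (Real.le_log_iff_exp_le (div_pos hK hdf)).2 ((le_div_iff₀' hdf).2 h2)
  rw [Real.dist_eq, one_div_mul_eq_div, sub_zero,
    abs_of_nonpos (div_nonpos_of_nonpos_of_nonneg h3 hn'.le), ← neg_div, div_lt_iff₀ hn']
  nlinarith

theorem typeOf_apply (d : (n : ℕ) → Fin n → ℕ) (n i : ℕ) :
    typeOf d n i = (Finset.univ.filter fun j => d n j = i).card := by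
  simp [typeOf, Finsupp.finsetSum_apply, Finsupp.single_apply]

end Limits

/-- Theorem 1.1 of the paper: under Conditions (a), (b) and Condition P,
the number of connected simple graphs with degree sequence `d(n)` satisfies
`|𝒢c_{d(n)}| = e^{−K(p)n + o(n)} (ℓ_n−1)!!/∏ d_i!`, and
`|𝒢c_{d(n)}|/|𝒢_{d(n)}| = e^{−K(p)n + o(n)}`. -/
theorem number_of_connected_graphs_with_prescribed_degrees
    (d : (n : ℕ) → Fin n → ℕ) (p : ℕ → ℝ)
    (hdpos : ∀ n j, 0 < d n j) (hdeven : ∀ n, Even (ℓTot d n))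
    (hp0 : p 0 = 0) (hpnn : ∀ i, 0 ≤ p i) (hpsum : ∑' i : ℕ, p i = 1)
    (ha : ∀ i : ℕ, Filter.Tendsto (fun n : ℕ => (typeOf d n i : ℝ) / (n : ℝ))
      Filter.atTop (nhds (p i)))
    (hmom : Summable fun i : ℕ => (i : ℝ) * p i)
    (hb : Filter.Tendsto (fun n : ℕ => (ℓTot d n : ℝ) / (n : ℝ)) Filter.atTop
      (nhds (∑' i : ℕ, (i : ℝ) * p i)))
    (hP1 : 0 < p 1) (hP2 : 2 < ∑' i : ℕ, (i : ℝ) * p i) :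
    Filter.Tendsto (fun n : ℕ =>
        (1 / (n : ℝ)) * Real.log
          (((Set.ncard {G : SimpleGraph (Fin n) |
                (∀ v, Set.ncard (G.neighborSet v) = d n v) ∧ G.Connected}
              * ∏ j : Fin n, Nat.factorial (d n j) : ℕ) : ℝ)
            / (Nat.doubleFactorial (ℓTot d n - 1) : ℝ)))
      Filter.atTop (nhds (-(Kof p)))
    ∧ Filter.Tendsto (fun n : ℕ =>
        (1 / (n : ℝ)) * Real.log
          ((Set.ncard {G : SimpleGraph (Fin n) |
              (∀ v, Set.ncard (G.neighborSet v) = d n v) ∧ G.Connected} : ℝ)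
            / (Set.ncard {G : SimpleGraph (Fin n) |
                ∀ v, Set.ncard (G.neighborSet v) = d n v} : ℝ)))
      Filter.atTop (nhds (-(Kof p))) := by
  have D : DegreeLimit d p :=
    { pos := hdpos
      even := hdeven
      zero := hp0
      nonneg := hpnn
      sum := hpsum ▸ Summable.hasSum (by
        by_contra h
        exact zero_ne_one ((tsum_eq_zero_of_not_summable h).symm.trans hpsum))
      tendsto := fun i => by simpa only [typeOf_apply] using ha i
      summable := hmom
      tendsto_mean := hb
      one := hP1
      two := hP2 }
  refine ⟨D.tendsto_log_numConn.congr' ?_, ?_⟩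
  · filter_upwards [Filter.eventually_gt_atTop 0] with n hn
    have := Fin.pos_iff_nonempty.1 hn
    rw [← numConn_eq]
    rfl
  · have h := D.tendsto_log_numConn.sub D.tendsto_log_numSimple
    rw [sub_zero] at h
    refine h.congr' ?_
    filter_upwards [Filter.eventually_gt_atTop 0, D.exp_le_numConn one_pos,
      D.exp_le_numSimple one_pos] with n hn h1 h2
    have := Fin.pos_iff_nonempty.1 hn
    have hdf : (0 : ℝ) < Nat.doubleFactorial (∑ v, d n v - 1) := by
      exact_mod_cast Nat.doubleFactorial_pos _
    have hc := lt_of_lt_of_le (by positivity) h1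
    have hs := lt_of_lt_of_le (by positivity) h2
    have hf : (0 : ℝ) < ∏ v, (d n v).factorial := by positivity
    rw [← mul_sub, ← Real.log_div (by positivity) (by positivity),
      div_div_div_cancel_right₀ hdf.ne', numConn_eq, numSimple_eq, Nat.cast_mul, Nat.cast_mul,
      mul_div_mul_right _ _ hf.ne']

end PaperCM
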